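/- Let f : 𝓜 → S^1 be completely multiplicative. Suppose there exist Q ∈ 𝓜, a primitive Dirichlet character χ modulo Q, a short interval character ξ, and θ ∈ [0,1] such that 𝔻(f, χξe_θ; ∞) < ∞. If the set S = {P monic irreducible : f(P) ≠ χ(P)ξ(P)e_θ(P)} is infinite, then the short sum discrepancy 𝒮_f is infinite, i.e. limsup_{H→∞} limsup_{N→∞} max_{G_0 ∈ 𝓜, deg G_0 = N} |Σ_{G ∈ I_H(G_0)} f(G)| = ∞. -/

import Mathlib

open Polynomial Complex Filter
open scoped ENNReal ComplexConjugate

noncomputable section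

namespace FFEDP

variable {F : Type} [Field F] [Fintype F] [DecidableEq F]

/-- `f : 𝓜 → ℂ` is completely multiplicative (on monic polynomials). -/
def CompMultOnMonic (f : F[X] → ℂ) : Prop :=
  f 1 = 1 ∧ ∀ G H : F[X], G.Monic → H.Monic → f (G * H) = f G * f H

/-- `f` takes values in `S¹` on monic polynomials. -/
def UnimodularOnMonic (f : F[X] → ℂ) : Prop :=
  ∀ G : F[X], G.Monic → ‖f G‖ = 1

/-- A Dirichlet character modulo `Q`. -/
structure IsDirichletCharacter (Q : F[X]) (χ : F[X] → ℂ) : Prop where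
  map_mul : ∀ A B : F[X], χ (A * B) = χ A * χ B
  exists_ne_zero : ∃ M : F[X], χ M ≠ 0
  periodic : ∀ M : F[X], χ (M + Q) = χ M
  eq_zero_of_not_coprime : ∀ M : F[X], ¬ IsCoprime M Q → χ M = 0

/-- A primitive Dirichlet character modulo `Q`: not induced by a character of
smaller modulus. -/
def IsPrimitiveDirichletCharacter (Q : F[X]) (χ : F[X] → ℂ) : Prop :=
  IsDirichletCharacter Q χ ∧
    ¬ ∃ (Q' : F[X]) (χ' : F[X] → ℂ), Q' ∣ Q ∧ Q'.natDegree < Q.natDegree ∧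
        IsDirichletCharacter Q' χ' ∧ ∀ M : F[X], IsCoprime M Q → χ M = χ' M

def IsPrincipalDirichletCharacter (Q : F[X]) (χ : F[X] → ℂ) : Prop :=
  IsDirichletCharacter Q χ ∧ ∀ M : F[X], IsCoprime M Q → χ M = 1

/-- the `i`-th highest-degree coefficient of `A` (zero if `i` exceeds the degree). -/
def topCoeff (A : F[X]) (i : ℕ) : F :=
  if i ≤ A.natDegree then A.coeff (A.natDegree - i) else 0

/-- A short interval character whose value depends only on the `ν + 1`
highest-degree coefficients (so its length is at most `ν`). -/
def IsShortIntervalCharacterOfLength (ν : ℕ) (ξ : F[X] → ℂ) : Prop :=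
  (∀ A B : F[X], A.Monic → B.Monic → ξ (A * B) = ξ A * ξ B) ∧
    (∃ A : F[X], A.Monic ∧ ξ A ≠ 0) ∧
    ∀ A B : F[X], A.Monic → B.Monic →
      (∀ i : ℕ, i ≤ ν → topCoeff A i = topCoeff B i) → ξ A = ξ B

def IsShortIntervalCharacter (ξ : F[X] → ℂ) : Prop :=
  ∃ ν : ℕ, IsShortIntervalCharacterOfLength ν ξ

/-- the Archimedean character `e_θ(G) = e(θ · deg G)`. -/
def eTheta (θ : ℝ) (G : F[X]) : ℂ :=
  Complex.exp (2 * (Real.pi : ℂ) * Complex.I * (θ : ℂ) * (G.natDegree : ℂ))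

/-- `∑_{G ∈ 𝓜, deg G ≤ N} f(G)`. -/
def longSum (f : F[X] → ℂ) (N : ℕ) : ℂ :=
  ∑ᶠ G ∈ {G : F[X] | G.Monic ∧ G.natDegree ≤ N}, f G

/-- `∑_{G ∈ 𝓜, deg G < H} f(G)`. -/
def longSumLt (f : F[X] → ℂ) (H : ℕ) : ℂ :=
  ∑ᶠ G ∈ {G : F[X] | G.Monic ∧ G.natDegree < H}, f G

/-- `∑_{G ∈ I_H(G₀)} f(G)` where `I_H(G₀) = {G ∈ 𝓜 : deg (G - G₀) < H}`. -/
def shortIntervalSum (f : F[X] → ℂ) (H : ℕ) (G₀ : F[X]) : ℂ :=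
  ∑ᶠ G ∈ {G : F[X] | G.Monic ∧ (G - G₀).degree < (H : WithBot ℕ)}, f G

/-- the short sum discrepancy
`𝒮_f = limsup_{H → ∞} limsup_{N → ∞} max_{G₀ ∈ 𝓜_N} |∑_{G ∈ I_H(G₀)} f(G)|`,
as an extended nonnegative real. -/
def shortSumDisc (f : F[X] → ℂ) : ℝ≥0∞ :=
  Filter.limsup (fun H : ℕ =>
    Filter.limsup (fun N : ℕ =>
      ⨆ G₀ ∈ {G₀ : F[X] | G₀.Monic ∧ G₀.natDegree = N},
        (‖shortIntervalSum f H G₀‖₊ : ℝ≥0∞)) Filter.atTop) Filter.atTop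

/-- the pretentious distance `𝔻(f, g; N)`. -/
def pretDist (f g : F[X] → ℂ) (N : ℕ) : ℝ :=
  Real.sqrt (∑ᶠ P ∈ {P : F[X] | P.Monic ∧ Irreducible P ∧ P.natDegree ≤ N},
    ((Fintype.card F : ℝ) ^ P.natDegree)⁻¹ * (1 - (f P * conj (g P)).re))

/-- `ω(Q)`: the number of distinct monic irreducible divisors of `Q`. -/
def omegaPoly (Q : F[X]) : ℕ :=
  Set.ncard {P : F[X] | P.Monic ∧ Irreducible P ∧ P ∣ Q}

/-- `f` is a modified character associated with the character `χ` of modulus `Q`: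
it is completely multiplicative, takes values in `S¹` on monics, and agrees with
`χ` at every monic irreducible not dividing `Q`. -/
def IsModifiedCharacter (Q : F[X]) (χ f : F[X] → ℂ) : Prop :=
  CompMultOnMonic f ∧ UnimodularOnMonic f ∧ IsDirichletCharacter Q χ ∧
    ∀ P : F[X], P.Monic → Irreducible P → ¬ P ∣ Q → f P = χ P

variable {k : Type} [Field k] [Fintype k]

set_option linter.unusedSectionVars false

section PolynomialMeans

/-- The polynomials of degree less than `n`. -/
def polysLT (k : Type) [Field k] [Fintype k] (n : ℕ) : Finset k[X] :=
  Set.Finite.toFinset (s := {x : k[X] | x.degree < n}) <| by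
    have : Finite (degreeLT k n) := Finite.of_equiv _ (degreeLTEquiv k n).symm.toEquiv
    have h : {x : k[X] | x.degree < n} = (degreeLT k n : Set k[X]) := by
      ext x; simp [mem_degreeLT]
    rw [h]
    exact Set.toFinite _

@[simp] lemma mem_polysLT {n : ℕ} {x : k[X]} : x ∈ polysLT k n ↔ x.degree < n := by
  simp [polysLT]

lemma card_polysLT (n : ℕ) : (polysLT k n).card = Fintype.card k ^ n := by
  have e : polysLT k n ≃ (Fin n → k) :=
    (Equiv.subtypeEquivRight fun x => by rw [mem_polysLT, mem_degreeLT]).trans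
      (degreeLTEquiv k n).toEquiv
  have := Fintype.card_congr e
  simpa using this

/-- The mean value of `a` over the polynomials of degree less than `n`. -/
def mean {K : Type*} [Field K] (n : ℕ) (a : k[X] → K) : K :=
  (∑ x ∈ polysLT k n, a x) / (Fintype.card k : K) ^ n

open Classical in
/-- The indicator function of the multiples of `R`. -/
def ind (K : Type*) [Field K] (R x : k[X]) : K := if R ∣ x then 1 else 0

/-- `a` is periodic modulo `R`. -/
def PeriodicMod {K : Type*} (R : k[X]) (a : k[X] → K) : Prop := ∀ x y, a (x + R * y) = a x

lemma PeriodicMod.of_dvd {K : Type*} {R S : k[X]} {a : k[X] → K} (h : PeriodicMod R a)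
    (hd : R ∣ S) : PeriodicMod S a := by
  obtain ⟨T, rfl⟩ := hd
  intro x y
  rw [mul_assoc, h]

lemma PeriodicMod.eq_of_dvd_sub {K : Type*} {R x y : k[X]} {a : k[X] → K} (h : PeriodicMod R a)
    (hd : R ∣ x - y) : a x = a y := by
  obtain ⟨z, hz⟩ := hd
  rw [← h y z, ← hz]; ring_nf

lemma PeriodicMod.translate {K : Type*} {R : k[X]} {a : k[X] → K} (h : PeriodicMod R a)
    (M : k[X]) : PeriodicMod R (fun x => a (x + M)) := by
  intro x y
  have : x + R * y + M = x + M + R * y := by ring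
  simpa only [this] using h (x + M) y

lemma ind_periodic (K : Type*) [Field K] (R : k[X]) : PeriodicMod R (ind K R) := by
  intro x y
  unfold ind
  rw [dvd_add_left (dvd_mul_right R y)]

lemma sum_polysLT_add {K : Type*} [AddCommMonoid K] {R : k[X]} (hR : R.Monic) (n : ℕ)
    (a : k[X] → K) :
    ∑ x ∈ polysLT k (n + R.natDegree), a x =
      ∑ y ∈ polysLT k n, ∑ z ∈ polysLT k R.natDegree, a (z + R * y) := by
  have hRd : R.degree = R.natDegree := degree_eq_natDegree hR.ne_zero
  rw [← Finset.sum_product']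
  refine Finset.sum_bij' (fun x _ => (x /ₘ R, x %ₘ R)) (fun p _ => p.2 + R * p.1) ?_ ?_ ?_ ?_ ?_
  · intro x hx
    simp only [Finset.mem_product, mem_polysLT] at hx ⊢
    refine ⟨?_, by rw [← hRd]; exact degree_modByMonic_lt _ hR⟩
    by_cases h0 : x /ₘ R = 0
    · rw [h0, degree_zero]; exact WithBot.bot_lt_coe _
    · have hle : R.degree ≤ x.degree := by
        by_contra h
        exact h0 ((divByMonic_eq_zero_iff hR).2 (not_le.1 h))
      have := degree_add_divByMonic hR hle
      rw [degree_eq_natDegree h0, hRd] at this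
      rw [degree_eq_natDegree h0]
      rw [← this] at hx
      norm_cast at hx ⊢
      omega
  · intro p hp
    simp only [Finset.mem_product, mem_polysLT] at hp ⊢
    refine (degree_add_le _ _).trans_lt (max_lt ?_ ?_)
    · refine hp.2.trans_le ?_
      norm_cast; omega
    · rw [degree_mul, hRd]
      by_cases h0 : p.1 = 0
      · rw [h0, degree_zero, WithBot.add_bot]; exact WithBot.bot_lt_coe _
      · have h1 := hp.1
        rw [degree_eq_natDegree h0] at h1 ⊢
        norm_cast at h1 ⊢
        omega
  · intro x hx
    exact modByMonic_add_div x R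
  · intro p hp
    simp only [Finset.mem_product, mem_polysLT] at hp
    have := div_modByMonic_unique (f := p.2 + R * p.1) p.1 p.2 hR ⟨rfl, by rw [hRd]; exact hp.2⟩
    exact Prod.ext this.1 this.2
  · intro x hx
    dsimp only
    rw [modByMonic_add_div x R]

lemma eq_zero_of_dvd_of_mem_polysLT {R x : k[X]} {n : ℕ} (hx : x ∈ polysLT k n)
    (hn : n ≤ R.natDegree) (h : R ∣ x) : x = 0 := by
  by_contra h0
  have := natDegree_le_of_dvd h h0
  rw [mem_polysLT, degree_eq_natDegree h0] at hx
  norm_cast at hx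
  omega

lemma sub_mem_polysLT {n : ℕ} {x y : k[X]} (hx : x ∈ polysLT k n) (hy : y ∈ polysLT k n) :
    x - y ∈ polysLT k n := by
  rw [mem_polysLT] at *
  exact (degree_sub_le _ _).trans_lt (max_lt hx hy)

lemma sum_polysLT_affine {K : Type*} [AddCommMonoid K] {R L : k[X]} (hR : R.Monic)
    (hL : IsCoprime R L) {a : k[X] → K} (ha : PeriodicMod R a) (A : k[X]) :
    ∑ z ∈ polysLT k R.natDegree, a (A + L * z) = ∑ z ∈ polysLT k R.natDegree, a z := by
  classical
  have hRd : R.degree = R.natDegree := degree_eq_natDegree hR.ne_zero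
  set s := polysLT k R.natDegree
  let φ : k[X] → k[X] := fun z => (A + L * z) %ₘ R
  have hmaps : ∀ z ∈ s, φ z ∈ s := fun z _ => by
    rw [mem_polysLT, ← hRd]; exact degree_modByMonic_lt _ hR
  have hinj : Set.InjOn φ s := by
    intro x hx y hy hxy
    have h1 : R ∣ (A + L * x) - (A + L * y) := (modByMonic_eq_zero_iff_dvd hR).1 (by
      rw [sub_modByMonic]; exact sub_eq_zero.2 hxy)
    have h2 : R ∣ L * (x - y) := by convert h1 using 1; ring
    have h3 := hL.dvd_of_dvd_mul_left h2
    exact sub_eq_zero.1 (eq_zero_of_dvd_of_mem_polysLT (sub_mem_polysLT hx hy) le_rfl h3)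
  have himg : s.image φ = s :=
    Finset.eq_of_subset_of_card_le (Finset.image_subset_iff.2 hmaps)
      (Finset.card_image_of_injOn hinj).ge
  calc ∑ z ∈ s, a (A + L * z) = ∑ z ∈ s, a (φ z) := by
        refine Finset.sum_congr rfl fun z _ => ?_
        refine ha.eq_of_dvd_sub ?_
        refine ⟨(A + L * z) /ₘ R, ?_⟩
        have := modByMonic_add_div (A + L * z) R
        rw [sub_eq_iff_eq_add, add_comm (R * _)]; exact this.symm
    _ = ∑ z ∈ s.image φ, a z := (Finset.sum_image hinj).symm
    _ = _ := by rw [himg]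

variable {K : Type*} [Field K] [CharZero K]

lemma card_cast_ne_zero : (Fintype.card k : K) ≠ 0 := by
  exact_mod_cast Fintype.card_ne_zero

lemma mean_affine {R L : k[X]} (hR : R.Monic) (hL : IsCoprime R L) {a : k[X] → K}
    (ha : PeriodicMod R a) (A : k[X]) {n : ℕ} (hn : R.natDegree ≤ n) :
    mean n (fun x => a (A + L * x)) = mean R.natDegree a := by
  obtain ⟨m, rfl⟩ := Nat.exists_eq_add_of_le' hn
  have hq : (Fintype.card k : K) ≠ 0 := card_cast_ne_zero
  unfold mean
  rw [sum_polysLT_add hR]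
  have : ∀ y ∈ polysLT k m, ∑ z ∈ polysLT k R.natDegree, a (A + L * (z + R * y)) =
      ∑ z ∈ polysLT k R.natDegree, a z := by
    intro y _
    rw [← sum_polysLT_affine hR hL ha A]
    refine Finset.sum_congr rfl fun z _ => ?_
    rw [show A + L * (z + R * y) = A + L * z + R * (L * y) by ring, ha]
  rw [Finset.sum_congr rfl this, Finset.sum_const, card_polysLT, nsmul_eq_mul]
  push_cast
  rw [pow_add]
  field_simp

lemma mean_periodic {R : k[X]} (hR : R.Monic) {a : k[X] → K}
    (ha : PeriodicMod R a) {n : ℕ} (hn : R.natDegree ≤ n) :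
    mean n a = mean R.natDegree a := by
  simpa using mean_affine hR (isCoprime_one_right (x := R)) ha 0 hn

lemma mean_const (n : ℕ) (c : K) : mean n (fun _ : k[X] => c) = c := by
  have hq : (Fintype.card k : K) ≠ 0 := card_cast_ne_zero
  unfold mean
  rw [Finset.sum_const, card_polysLT, nsmul_eq_mul]
  push_cast
  field_simp

/-- Functions that are periodic modulo coprime polynomials are independent. -/
lemma mean_mul {R S : k[X]} (hR : R.Monic) (hS : S.Monic) (hRS : IsCoprime R S)
    {a b : k[X] → K} (ha : PeriodicMod R a) (hb : PeriodicMod S b) {n : ℕ}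
    (hn : R.natDegree + S.natDegree ≤ n) :
    mean n (fun x => a x * b x) = mean n a * mean n b := by
  have hq : (Fintype.card k : K) ≠ 0 := card_cast_ne_zero
  have hab : PeriodicMod (S * R) (fun x => a x * b x) := fun x y => by
    simp only [ha.of_dvd (dvd_mul_left R S) x y, hb.of_dvd (dvd_mul_right S R) x y]
  have hdeg : (S * R).natDegree = S.natDegree + R.natDegree := hS.natDegree_mul hR
  rw [mean_periodic (hS.mul hR) hab (by omega), hdeg, mean_periodic hR ha (by omega),
    mean_periodic hS hb (by omega)]
  unfold mean
  rw [sum_polysLT_add hR, Finset.sum_comm]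
  have : ∀ z ∈ polysLT k R.natDegree,
      ∑ y ∈ polysLT k S.natDegree, a (z + R * y) * b (z + R * y) =
        a z * ∑ y ∈ polysLT k S.natDegree, b y := by
    intro z _
    rw [← sum_polysLT_affine hS hRS.symm hb z, Finset.mul_sum]
    exact Finset.sum_congr rfl fun y _ => by rw [ha]
  rw [Finset.sum_congr rfl this, ← Finset.sum_mul, pow_add]
  field_simp

lemma mean_ind_affine {R L : k[X]} (hR : R.Monic) (hL : IsCoprime R L) (A : k[X]) {n : ℕ}
    (hn : R.natDegree ≤ n) :
    mean n (fun x => ind K R (A + L * x)) = ((Fintype.card k : K) ^ R.natDegree)⁻¹ := by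
  classical
  rw [mean_affine hR hL (ind_periodic K R) A hn]
  unfold mean
  rw [Finset.sum_eq_single 0]
  · simp [ind]
  · intro x hx h0
    unfold ind
    rw [if_neg fun h => h0 (eq_zero_of_dvd_of_mem_polysLT hx le_rfl h)]
  · intro h; exact absurd (by simp) h

lemma mean_ind_translate {R : k[X]} (hR : R.Monic) (M : k[X]) {n : ℕ}
    (hn : R.natDegree ≤ n) :
    mean n (fun x => ind K R (x + M)) = ((Fintype.card k : K) ^ R.natDegree)⁻¹ := by
  simpa [add_comm] using mean_ind_affine (K := K) hR (isCoprime_one_right (x := R)) M hn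

lemma mean_sum {ι : Type*} (s : Finset ι) (n : ℕ) (a : ι → k[X] → K) :
    mean n (fun x => ∑ i ∈ s, a i x) = ∑ i ∈ s, mean n (a i) := by
  unfold mean
  rw [Finset.sum_comm, Finset.sum_div]

lemma mean_const_mul (n : ℕ) (c : K) (a : k[X] → K) :
    mean n (fun x => c * a x) = c * mean n a := by
  unfold mean
  rw [← Finset.mul_sum, mul_div_assoc]

lemma mean_sub (n : ℕ) (a b : k[X] → K) :
    mean n (fun x => a x - b x) = mean n a - mean n b := by
  unfold mean
  rw [Finset.sum_sub_distrib, sub_div]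

lemma mean_add (n : ℕ) (a b : k[X] → K) :
    mean n (fun x => a x + b x) = mean n a + mean n b := by
  unfold mean
  rw [Finset.sum_add_distrib, add_div]

lemma mean_mono {n : ℕ} {a b : k[X] → ℝ} (h : ∀ x ∈ polysLT k n, a x ≤ b x) :
    mean n a ≤ mean n b := by
  unfold mean
  gcongr with x hx
  exact h x hx

lemma exists_le_of_le_mean {n : ℕ} {a : k[X] → ℝ} {c : ℝ} (h : c ≤ mean n a) :
    ∃ x ∈ polysLT k n, c ≤ a x := by
  by_contra! hc
  have hne : (polysLT k n).Nonempty := ⟨0, by simp⟩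
  have hq : (0 : ℝ) < (Fintype.card k : ℝ) ^ n := by
    have : 0 < Fintype.card k := Fintype.card_pos
    positivity
  have h1 := Finset.sum_lt_sum_of_nonempty hne hc
  rw [Finset.sum_const, card_polysLT, nsmul_eq_mul] at h1
  unfold mean at h
  rw [le_div_iff₀ hq] at h
  push_cast at h1
  linarith

/-- A coarse bound for the density of multiples, valid for moduli of any degree. -/
lemma mean_ind_affine_le {R L : k[X]} (hR : R.Monic) (hL : IsCoprime R L) (A : k[X]) (n : ℕ) :
    mean n (fun x => ind ℝ R (A + L * x)) ≤
      ((Fintype.card k : ℝ) ^ R.natDegree)⁻¹ + ((Fintype.card k : ℝ) ^ n)⁻¹ := by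
  classical
  have hq : (0 : ℝ) < Fintype.card k := by exact_mod_cast Fintype.card_pos
  rcases le_or_gt R.natDegree n with h | h
  · rw [mean_ind_affine hR hL A h]
    have : 0 < ((Fintype.card k : ℝ) ^ n)⁻¹ := by positivity
    linarith
  · have h1 : ∑ x ∈ polysLT k n, ind ℝ R (A + L * x) ≤ 1 := by
      simp only [ind]
      rw [Finset.sum_boole]
      norm_cast
      rw [Finset.card_le_one]
      intro x hx y hy
      rw [Finset.mem_filter] at hx hy
      have h2 : R ∣ L * (x - y) := by
        have := dvd_sub hx.2 hy.2
        convert this using 1; ring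
      exact sub_eq_zero.1 (eq_zero_of_dvd_of_mem_polysLT (sub_mem_polysLT hx.1 hy.1) h.le
        (hL.dvd_of_dvd_mul_left h2))
    have h3 : mean n (fun x => ind ℝ R (A + L * x)) ≤ ((Fintype.card k : ℝ) ^ n)⁻¹ := by
      unfold mean
      rw [div_eq_mul_inv]
      exact mul_le_of_le_one_left (by positivity) h1
    have : 0 < ((Fintype.card k : ℝ) ^ R.natDegree)⁻¹ := by positivity
    linarith

end PolynomialMeans

section Levels

/-- The component of exact level `P ^ j` of functions periodic modulo powers of `P`. -/
def level (P : k[X]) : ℕ → k[X] → ℂ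
  | 0, _ => 1
  | j + 1, x => ind ℂ (P ^ (j + 1)) x - ((Fintype.card k : ℂ) ^ P.natDegree)⁻¹ * ind ℂ (P ^ j) x

/-- The function `x ↦ β ^ min (v_P x) J`. -/
def truncPow (P : k[X]) (β : ℂ) (J : ℕ) (x : k[X]) : ℂ :=
  1 + ∑ i ∈ Finset.range J, β ^ i * (β - 1) * ind ℂ (P ^ (i + 1)) x

lemma ind_of_dvd {K : Type*} [Field K] {R x : k[X]} (h : R ∣ x) : ind K R x = 1 := by
  simp [ind, h]

lemma ind_of_not_dvd {K : Type*} [Field K] {R x : k[X]} (h : ¬ R ∣ x) : ind K R x = 0 := by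
  simp [ind, h]

lemma truncPow_eq {P x y : k[X]} (β : ℂ) {J v : ℕ} (hx : x = P ^ v * y) (hP : P ≠ 0)
    (hy : ¬ P ∣ y) : truncPow P β J x = β ^ min v J := by
  have hind : ∀ i, ind ℂ (P ^ (i + 1)) x = if i < v then 1 else 0 := by
    intro i
    split_ifs with h
    · exact ind_of_dvd (hx ▸ (pow_dvd_pow P h).mul_right y)
    · refine ind_of_not_dvd fun hd => hy ?_
      have h1 : P ^ (v + 1) ∣ P ^ v * y := hx ▸ (pow_dvd_pow P (by omega)).trans hd
      rw [pow_succ] at h1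
      exact (mul_dvd_mul_iff_left (pow_ne_zero v hP)).1 h1
  unfold truncPow
  simp only [hind]
  induction J with
  | zero => simp
  | succ J ih =>
    rw [Finset.sum_range_succ, ← add_assoc, ih]
    split_ifs with h
    · rw [min_eq_right h.le, min_eq_right h]; ring
    · rw [min_eq_left (by omega), min_eq_left (by omega)]; ring

lemma norm_truncPow {P x : k[X]} {β : ℂ} (hβ : ‖β‖ = 1) (J : ℕ) (hP : Irreducible P) :
    ‖truncPow P β J x‖ = 1 := by
  by_cases hx : x = 0
  · subst hx
    have : truncPow P β J 0 = β ^ J := by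
      unfold truncPow
      simp only [ind_of_dvd (dvd_zero _), mul_one]
      induction J with
      | zero => simp
      | succ J ih => rw [Finset.sum_range_succ, ← add_assoc, ih]; ring
    rw [this, norm_pow, hβ, one_pow]
  · obtain ⟨v, y, hy, hxy⟩ := WfDvdMonoid.max_power_factor hx hP
    rw [truncPow_eq β hxy hP.ne_zero hy, norm_pow, hβ, one_pow]

lemma conj_ind (R x : k[X]) : conj (ind ℂ R x) = ind ℂ R x := by
  unfold ind; split_ifs <;> simp

lemma conj_level (P : k[X]) (j : ℕ) (x : k[X]) : conj (level P j x) = level P j x := by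
  cases j with
  | zero => simp [level]
  | succ j => simp [level, conj_ind]

lemma level_periodic (P : k[X]) (j : ℕ) : PeriodicMod (P ^ j) (level P j) := by
  intro x y
  cases j with
  | zero => rfl
  | succ j =>
    simp only [level]
    rw [ind_periodic ℂ _ x y, (ind_periodic ℂ (P ^ j)).of_dvd (pow_dvd_pow P j.le_succ) x y]

lemma level_succ_eq_zero {P x : k[X]} {j : ℕ} (h : ¬ P ^ j ∣ x) : level P (j + 1) x = 0 := by
  simp only [level]
  rw [ind_of_not_dvd h, ind_of_not_dvd fun h' => h ((pow_dvd_pow P j.le_succ).trans h')]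
  simp

lemma mean_level_succ {P : k[X]} (hP : P.Monic) {j n : ℕ} (M : k[X])
    (hn : (j + 1) * P.natDegree ≤ n) : mean n (fun x => level P (j + 1) (x + M)) = 0 := by
  have hd : ∀ i, (P ^ i).natDegree = i * P.natDegree := fun i => hP.natDegree_pow i
  simp only [level]
  rw [mean_sub, mean_const_mul, mean_ind_translate (hP.pow _) M (by rw [hd]; exact hn),
    mean_ind_translate (hP.pow _) M (by rw [hd]; nlinarith), hd, hd,
    add_mul, one_mul, pow_add, mul_inv]
  ring

lemma mean_mul_level_succ {P : k[X]} (hP : P.Monic) {j n : ℕ} {a : k[X] → ℂ}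
    (ha : PeriodicMod (P ^ j) a) (M : k[X]) (hn : (j + 1) * P.natDegree ≤ n) :
    mean n (fun x => a x * level P (j + 1) (x + M)) = 0 := by
  have : (fun x => a x * level P (j + 1) (x + M)) =
      fun x => a (-M) * level P (j + 1) (x + M) := by
    funext x
    by_cases h : P ^ j ∣ x + M
    · rw [ha.eq_of_dvd_sub (x := x) (y := -M) (by simpa using h)]
    · rw [level_succ_eq_zero h]; simp
  rw [this, mean_const_mul, mean_level_succ hP M hn, mul_zero]

lemma mean_level_mul_level_of_lt {P : k[X]} (hP : P.Monic) {i j n : ℕ} (hij : i < j) (M M' : k[X])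
    (hn : j * P.natDegree ≤ n) :
    mean n (fun x => level P i (x + M) * level P j (x + M')) = 0 := by
  obtain ⟨s, rfl⟩ : ∃ s, j = s + 1 := ⟨j - 1, by omega⟩
  exact mean_mul_level_succ hP
    (((level_periodic P i).of_dvd (pow_dvd_pow P (by omega))).translate M) M' hn

lemma mean_level_mul_level_of_ne {P : k[X]} (hP : P.Monic) {i j n : ℕ} (hij : i ≠ j) (M M' : k[X])
    (hi : i * P.natDegree ≤ n) (hj : j * P.natDegree ≤ n) :
    mean n (fun x => level P i (x + M) * level P j (x + M')) = 0 := by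
  rcases lt_or_gt_of_ne hij with h | h
  · exact mean_level_mul_level_of_lt hP h M M' hj
  · simp only [mul_comm (level P i _)]
    exact mean_level_mul_level_of_lt hP h M' M hi

lemma level_mul_level_eq_zero {P M M' : k[X]} {j : ℕ} (h : ¬ P ^ j ∣ M - M') (x : k[X]) :
    level P (j + 1) (x + M) * level P (j + 1) (x + M') = 0 := by
  by_cases h1 : P ^ j ∣ x + M
  · rw [level_succ_eq_zero (x := x + M') fun h2 => h (by simpa using dvd_sub h1 h2), mul_zero]
  · rw [level_succ_eq_zero h1, zero_mul]

lemma mean_level_sq {P : k[X]} (hP : P.Monic) {j n : ℕ} (M : k[X])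
    (hn : (j + 1) * P.natDegree ≤ n) :
    mean n (fun x => level P (j + 1) (x + M) * level P (j + 1) (x + M)) =
      ((Fintype.card k : ℂ) ^ P.natDegree)⁻¹ ^ (j + 1) *
        (1 - ((Fintype.card k : ℂ) ^ P.natDegree)⁻¹) := by
  have hd : ∀ i, (P ^ i).natDegree = P.natDegree * i := fun i => by
    rw [hP.natDegree_pow i, mul_comm]
  set p := ((Fintype.card k : ℂ) ^ P.natDegree)⁻¹ with hp
  have : ∀ x, level P (j + 1) (x + M) * level P (j + 1) (x + M) =
      (1 - 2 * p) * ind ℂ (P ^ (j + 1)) (x + M) + p ^ 2 * ind ℂ (P ^ j) (x + M) := by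
    intro x
    simp only [level, ← hp]
    by_cases h1 : P ^ (j + 1) ∣ x + M
    · rw [ind_of_dvd h1, ind_of_dvd ((pow_dvd_pow P j.le_succ).trans h1)]; ring
    · by_cases h2 : P ^ j ∣ x + M
      · rw [ind_of_not_dvd h1, ind_of_dvd h2]; ring
      · rw [ind_of_not_dvd h1, ind_of_not_dvd h2]; ring
  have hpow : ∀ i, ((Fintype.card k : ℂ) ^ (P.natDegree * i))⁻¹ = p ^ i := fun i => by
    rw [hp, pow_mul, inv_pow]
  simp only [this]
  rw [mean_add, mean_const_mul, mean_const_mul,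
    mean_ind_translate (hP.pow _) M (by rw [hd]; linarith),
    mean_ind_translate (hP.pow _) M (by rw [hd]; nlinarith), hd, hd, hpow, hpow]
  ring

/-- The coefficients in the expansion of `truncPow` into levels. -/
def levelCoeff (P : k[X]) (β : ℂ) (J j : ℕ) : ℂ :=
  ∑ i ∈ Finset.Ico j (J + 1),
    (if i = 0 then 1 else β ^ (i - 1) * (β - 1)) * ((Fintype.card k : ℂ) ^ P.natDegree)⁻¹ ^ (i - j)

lemma ind_pow_eq_sum_level (P x : k[X]) (i : ℕ) :
    ind ℂ (P ^ i) x = ∑ j ∈ Finset.range (i + 1),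
      ((Fintype.card k : ℂ) ^ P.natDegree)⁻¹ ^ (i - j) * level P j x := by
  induction i with
  | zero => simp [level, ind]
  | succ i ih =>
    rw [Finset.sum_range_succ]
    have : ∀ j ∈ Finset.range (i + 1),
        ((Fintype.card k : ℂ) ^ P.natDegree)⁻¹ ^ (i + 1 - j) * level P j x =
        ((Fintype.card k : ℂ) ^ P.natDegree)⁻¹ *
          (((Fintype.card k : ℂ) ^ P.natDegree)⁻¹ ^ (i - j) * level P j x) := by
      intro j hj
      rw [Finset.mem_range] at hj
      rw [show i + 1 - j = (i - j) + 1 by omega]; ring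
    rw [Finset.sum_congr rfl this, ← Finset.mul_sum, ← ih]
    simp [level]

lemma truncPow_eq_sum_level (P : k[X]) (β : ℂ) (J : ℕ) (x : k[X]) :
    truncPow P β J x = ∑ j ∈ Finset.range (J + 1), levelCoeff P β J j * level P j x := by
  have h1 : truncPow P β J x = ∑ i ∈ Finset.range (J + 1),
      (if i = 0 then 1 else β ^ (i - 1) * (β - 1)) * ind ℂ (P ^ i) x := by
    rw [Finset.sum_range_succ', truncPow, add_comm]
    simp [ind]
  rw [h1]
  simp only [ind_pow_eq_sum_level, levelCoeff, Finset.mul_sum, Finset.sum_mul]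
  rw [Finset.sum_comm' (t' := Finset.range (J + 1)) (s' := fun j => Finset.Ico j (J + 1))]
  · exact Finset.sum_congr rfl fun _ _ => Finset.sum_congr rfl fun _ _ => by ring
  · intro i j
    simp only [Finset.mem_range, Finset.mem_Ico]
    omega

lemma norm_levelCoeff_ge {P : k[X]} {β : ℂ} (hβ : ‖β‖ = 1) (hP : 2 ≤ P.natDegree) {J j : ℕ}
    (hj : j + 1 ≤ J) : ‖β - 1‖ / 2 ≤ ‖levelCoeff P β J (j + 1)‖ := by
  set p := ((Fintype.card k : ℂ) ^ P.natDegree)⁻¹ with hp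
  have hq : (2 : ℝ) ≤ Fintype.card k := by exact_mod_cast Fintype.one_lt_card
  have hp1 : ‖p‖ ≤ 1 / 4 := by
    rw [hp, norm_inv, norm_pow, Complex.norm_natCast, ← one_div]
    apply one_div_le_one_div_of_le (by norm_num)
    calc (4 : ℝ) = 2 ^ 2 := by norm_num
      _ ≤ (Fintype.card k : ℝ) ^ 2 := by gcongr
      _ ≤ _ := pow_le_pow_right₀ (by linarith) hP
  have h1 : levelCoeff P β J (j + 1) =
      β ^ j * (β - 1) * ∑ r ∈ Finset.range (J - j), (β * p) ^ r := by
    unfold levelCoeff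
    rw [Finset.sum_Ico_eq_sum_range, Finset.mul_sum, show J + 1 - (j + 1) = J - j by omega]
    refine Finset.sum_congr rfl fun r _ => ?_
    rw [if_neg (by omega), show j + 1 + r - 1 = j + r by omega,
      show j + 1 + r - (j + 1) = r by omega, ← hp]
    ring
  have hz : ‖β * p‖ ≤ 1 / 4 := by rw [norm_mul, hβ, one_mul]; exact hp1
  have h2 : 1 / 2 ≤ ‖∑ r ∈ Finset.range (J - j), (β * p) ^ r‖ := by
    have h3 := geom_sum_mul_neg (β * p) (J - j)
    have h4 := congrArg norm h3
    rw [norm_mul] at h4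
    have h5 : ‖1 - β * p‖ ≤ 5 / 4 := by
      have := norm_sub_le (1 : ℂ) (β * p)
      rw [norm_one] at this; linarith
    have h6 : 3 / 4 ≤ ‖1 - (β * p) ^ (J - j)‖ := by
      have h7 := norm_sub_norm_le (1 : ℂ) ((β * p) ^ (J - j))
      rw [norm_one, norm_pow] at h7
      have : ‖β * p‖ ^ (J - j) ≤ ‖β * p‖ ^ 1 :=
        pow_le_pow_of_le_one (norm_nonneg _) (by linarith) (by omega)
      linarith
    by_contra! hlt
    have : ‖∑ r ∈ Finset.range (J - j), (β * p) ^ r‖ * ‖1 - β * p‖ ≤ 1 / 2 * (5 / 4) := by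
      gcongr
    linarith
  rw [h1, norm_mul, norm_mul, norm_pow, hβ, one_pow, one_mul]
  have := mul_le_mul_of_nonneg_left h2 (norm_nonneg (β - 1))
  linarith

end Levels

section SecondMoment

lemma ofReal_mean (n : ℕ) (a : k[X] → ℝ) : ((mean n a : ℝ) : ℂ) = mean n (fun x => (a x : ℂ)) := by
  simp [mean]

lemma mean_nonneg {n : ℕ} {a : k[X] → ℝ} (h : ∀ x, 0 ≤ a x) : 0 ≤ mean n a := by
  unfold mean
  exact div_nonneg (Finset.sum_nonneg fun x _ => h x) (by positivity)

lemma mean_norm_sq_sum_of_orthogonal {ι : Type*} (s : Finset ι) (n : ℕ) (c : ι → ℂ)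
    (Y : ι → k[X] → ℂ)
    (horth : ∀ i ∈ s, ∀ j ∈ s, i ≠ j → mean n (fun x => Y i x * conj (Y j x)) = 0) :
    mean n (fun x => ‖∑ i ∈ s, c i * Y i x‖ ^ 2) =
      ∑ i ∈ s, ‖c i‖ ^ 2 * mean n (fun x => ‖Y i x‖ ^ 2) := by
  apply Complex.ofReal_injective
  rw [ofReal_mean]
  push_cast
  simp only [ofReal_mean, Complex.ofReal_pow, ← Complex.mul_conj', map_sum, map_mul,
    Finset.sum_mul_sum]
  rw [mean_sum]
  refine Finset.sum_congr rfl fun i hi => ?_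
  rw [mean_sum, Finset.sum_eq_single_of_mem i hi]
  · rw [← mean_const_mul]
    congr 1; funext x; ring
  · intro j hj hij
    rw [← mul_zero (c i * conj (c j)), ← horth i hi j hj hij.symm, ← mean_const_mul]
    congr 1; funext x; ring

/-- The contribution of the levels `P₁ ^ j.1` and `P₂ ^ j.2` to a weighted short sum. -/
def levelSum (P₁ P₂ : k[X]) (u : k[X] → ℂ) (H : ℕ) (j : ℕ × ℕ) (x : k[X]) : ℂ :=
  ∑ M ∈ polysLT k H, u M * (level P₁ j.1 (x + M) * level P₂ j.2 (x + M))

lemma mean_levelSum_mul_conj {P₁ P₂ : k[X]} (h₁ : P₁.Monic) (h₂ : P₂.Monic)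
    (hco : IsCoprime P₁ P₂) (u : k[X] → ℂ) (H : ℕ) {J n : ℕ} {i j : ℕ × ℕ}
    (hi : i.1 ≤ J ∧ i.2 ≤ J) (hj : j.1 ≤ J ∧ j.2 ≤ J)
    (hn : J * P₁.natDegree + J * P₂.natDegree ≤ n) :
    mean n (fun x => levelSum P₁ P₂ u H i x * conj (levelSum P₁ P₂ u H j x)) =
      ∑ M ∈ polysLT k H, ∑ M' ∈ polysLT k H, u M * conj (u M') *
        (mean n (fun x => level P₁ i.1 (x + M) * level P₁ j.1 (x + M')) *
          mean n (fun x => level P₂ i.2 (x + M) * level P₂ j.2 (x + M'))) := by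
  simp only [levelSum, map_sum, map_mul, conj_level, Finset.sum_mul_sum]
  rw [mean_sum]
  refine Finset.sum_congr rfl fun M _ => ?_
  rw [mean_sum]
  refine Finset.sum_congr rfl fun M' _ => ?_
  have hper : ∀ {P : k[X]} {r s : ℕ}, r ≤ J → s ≤ J →
      PeriodicMod (P ^ J) (fun x => level P r (x + M) * level P s (x + M')) := by
    intro P r s hr hs x y
    have e1 := ((level_periodic P r).of_dvd (pow_dvd_pow P hr)).translate M x y
    have e2 := ((level_periodic P s).of_dvd (pow_dvd_pow P hs)).translate M' x y
    simp only at e1 e2 ⊢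
    rw [e1, e2]
  rw [← mean_mul (h₁.pow J) (h₂.pow J) hco.pow (hper hi.1 hj.1) (hper hi.2 hj.2)
    (by rw [h₁.natDegree_pow, h₂.natDegree_pow]; exact hn), ← mean_const_mul]
  congr 1; funext x; ring

lemma mean_levelSum_orthogonal {P₁ P₂ : k[X]} (h₁ : P₁.Monic) (h₂ : P₂.Monic)
    (hco : IsCoprime P₁ P₂) (u : k[X] → ℂ) (H : ℕ) {J n : ℕ} {i j : ℕ × ℕ}
    (hi : i.1 ≤ J ∧ i.2 ≤ J) (hj : j.1 ≤ J ∧ j.2 ≤ J)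
    (hn : J * P₁.natDegree + J * P₂.natDegree ≤ n) (hij : i ≠ j) :
    mean n (fun x => levelSum P₁ P₂ u H i x * conj (levelSum P₁ P₂ u H j x)) = 0 := by
  rw [mean_levelSum_mul_conj h₁ h₂ hco u H hi hj hn]
  have hle : ∀ {r d : ℕ}, r ≤ J → J * d ≤ n → r * d ≤ n := fun hr hd =>
    (Nat.mul_le_mul_right _ hr).trans hd
  refine Finset.sum_eq_zero fun M _ => Finset.sum_eq_zero fun M' _ => ?_
  by_cases h : i.1 = j.1
  · have h' : i.2 ≠ j.2 := fun h' => hij (Prod.ext h h')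
    rw [mean_level_mul_level_of_ne h₂ h' M M' (hle hi.2 (by omega)) (hle hj.2 (by omega))]
    simp
  · rw [mean_level_mul_level_of_ne h₁ h M M' (hle hi.1 (by omega)) (hle hj.1 (by omega))]
    simp

lemma mean_norm_sq_levelSum {P₁ P₂ : k[X]} (h₁ : P₁.Monic) (h₂ : P₂.Monic)
    (hco : IsCoprime P₁ P₂) {u : k[X] → ℂ} {H : ℕ} (hu : ∀ M ∈ polysLT k H, ‖u M‖ = 1)
    {n s t : ℕ} (hst : s * P₁.natDegree + t * P₂.natDegree = H)
    (J : ℕ) (hs : s + 1 ≤ J) (ht : t + 1 ≤ J)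
    (hn : J * P₁.natDegree + J * P₂.natDegree ≤ n) :
    mean n (fun x => ‖levelSum P₁ P₂ u H (s + 1, t + 1) x‖ ^ 2) =
      ((Fintype.card k : ℝ) ^ P₁.natDegree)⁻¹ * (1 - ((Fintype.card k : ℝ) ^ P₁.natDegree)⁻¹) *
      (((Fintype.card k : ℝ) ^ P₂.natDegree)⁻¹ *
        (1 - ((Fintype.card k : ℝ) ^ P₂.natDegree)⁻¹)) := by
  have hq : (Fintype.card k : ℂ) ≠ 0 := card_cast_ne_zero
  apply Complex.ofReal_injective
  rw [ofReal_mean]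
  simp only [Complex.ofReal_pow, ← Complex.mul_conj']
  rw [mean_levelSum_mul_conj h₁ h₂ hco u H (J := J) ⟨hs, ht⟩ ⟨hs, ht⟩ hn]
  have hle : ∀ {r d : ℕ}, r ≤ J → J * d ≤ n → r * d ≤ n := fun hr hd =>
    (Nat.mul_le_mul_right _ hr).trans hd
  have key : ∀ M ∈ polysLT k H, ∑ M' ∈ polysLT k H, u M * conj (u M') *
        (mean n (fun x => level P₁ (s + 1) (x + M) * level P₁ (s + 1) (x + M')) *
          mean n (fun x => level P₂ (t + 1) (x + M) * level P₂ (t + 1) (x + M'))) =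
      ((Fintype.card k : ℂ) ^ P₁.natDegree)⁻¹ ^ (s + 1) *
        (1 - ((Fintype.card k : ℂ) ^ P₁.natDegree)⁻¹) *
      (((Fintype.card k : ℂ) ^ P₂.natDegree)⁻¹ ^ (t + 1) *
        (1 - ((Fintype.card k : ℂ) ^ P₂.natDegree)⁻¹)) := by
    intro M hM
    rw [Finset.sum_eq_single_of_mem M hM]
    · rw [mean_level_sq h₁ M (hle hs (by omega)), mean_level_sq h₂ M (hle ht (by omega)),
        Complex.mul_conj', hu M hM]
      simp
    · intro M' hM' hne
      by_cases hd1 : P₁ ^ s ∣ M - M'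
      · have hd2 : ¬ P₂ ^ t ∣ M - M' := by
          intro hd2
          have hd := (hco.pow (m := s) (n := t)).mul_dvd hd1 hd2
          have := eq_zero_of_dvd_of_mem_polysLT (sub_mem_polysLT hM hM') (by
            rw [(h₁.pow s).natDegree_mul (h₂.pow t), h₁.natDegree_pow, h₂.natDegree_pow, hst]) hd
          exact hne (sub_eq_zero.1 this).symm
        simp only [level_mul_level_eq_zero hd2, mean_const, mul_zero]
      · simp only [level_mul_level_eq_zero hd1, mean_const, mul_zero, zero_mul]
  rw [Finset.sum_congr rfl key, Finset.sum_const, card_polysLT, nsmul_eq_mul, ← hst]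
  push_cast
  have ha : (Fintype.card k : ℂ) ^ P₁.natDegree ≠ 0 := pow_ne_zero _ hq
  have hb : (Fintype.card k : ℂ) ^ P₂.natDegree ≠ 0 := pow_ne_zero _ hq
  rw [pow_add, mul_comm s, mul_comm t, pow_mul, pow_mul, inv_pow, inv_pow]
  field_simp
  ring

/-- Averaging over translates, two primes at which the function is twisted force a second moment
that grows linearly in `m`. -/
lemma le_mean_norm_sq_truncPow {P₁ P₂ : k[X]} (h₁ : P₁.Monic) (h₂ : P₂.Monic)
    (hco : IsCoprime P₁ P₂) (hd₁ : 2 ≤ P₁.natDegree) (hd₂ : 2 ≤ P₂.natDegree) {β₁ β₂ : ℂ}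
    (hβ₁ : ‖β₁‖ = 1) (hβ₂ : ‖β₂‖ = 1) {u : k[X] → ℂ} {m J n : ℕ}
    (hu : ∀ M ∈ polysLT k (m * P₁.natDegree * P₂.natDegree), ‖u M‖ = 1)
    (hJ₁ : P₁.natDegree * m + 1 ≤ J) (hJ₂ : P₂.natDegree * m + 1 ≤ J)
    (hn : J * P₁.natDegree + J * P₂.natDegree ≤ n) :
    (m + 1) * ((‖β₁ - 1‖ / 2) ^ 2 * (‖β₂ - 1‖ / 2) ^ 2 *
      (((Fintype.card k : ℝ) ^ P₁.natDegree)⁻¹ * (1 - ((Fintype.card k : ℝ) ^ P₁.natDegree)⁻¹) *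
      (((Fintype.card k : ℝ) ^ P₂.natDegree)⁻¹ *
        (1 - ((Fintype.card k : ℝ) ^ P₂.natDegree)⁻¹)))) ≤
    mean n (fun x => ‖∑ M ∈ polysLT k (m * P₁.natDegree * P₂.natDegree),
      u M * (truncPow P₁ β₁ J (x + M) * truncPow P₂ β₂ J (x + M))‖ ^ 2) := by
  set H := m * P₁.natDegree * P₂.natDegree with hH
  set s := Finset.range (J + 1) ×ˢ Finset.range (J + 1) with hs
  set c : ℕ × ℕ → ℂ := fun j => levelCoeff P₁ β₁ J j.1 * levelCoeff P₂ β₂ J j.2 with hc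
  have hZ : ∀ x, ∑ M ∈ polysLT k H,
      u M * (truncPow P₁ β₁ J (x + M) * truncPow P₂ β₂ J (x + M)) =
      ∑ j ∈ s, c j * levelSum P₁ P₂ u H j x := by
    intro x
    simp only [levelSum, Finset.mul_sum]
    rw [Finset.sum_comm]
    refine Finset.sum_congr rfl fun M _ => ?_
    rw [truncPow_eq_sum_level, truncPow_eq_sum_level, Finset.sum_mul_sum, ← Finset.sum_product',
      Finset.mul_sum]
    exact Finset.sum_congr rfl fun j _ => by simp only [hc]; ring
  simp only [hZ]
  have hmem : ∀ {j}, j ∈ s ↔ j.1 ≤ J ∧ j.2 ≤ J := by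
    intro j
    simp only [hs, Finset.mem_product, Finset.mem_range, Nat.lt_succ_iff]
  rw [mean_norm_sq_sum_of_orthogonal s n c _ fun i hi j hj hij =>
    mean_levelSum_orthogonal h₁ h₂ hco u H (hmem.1 hi) (hmem.1 hj) hn hij]
  have hq : (1 : ℝ) ≤ Fintype.card k := by exact_mod_cast Fintype.card_pos
  have hp : ∀ d : ℕ, 0 ≤ 1 - ((Fintype.card k : ℝ) ^ d)⁻¹ := fun d =>
    sub_nonneg.2 (inv_le_one_of_one_le₀ (one_le_pow₀ hq))
  let φ : ℕ → ℕ × ℕ := fun i => (P₂.natDegree * i + 1, P₁.natDegree * (m - i) + 1)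
  have hinj : Function.Injective φ := by
    intro a b hab
    have h := congrArg Prod.fst hab
    simp only [φ, add_left_inj] at h
    exact Nat.eq_of_mul_eq_mul_left (by omega) h
  have hle1 : ∀ i ∈ Finset.range (m + 1), P₂.natDegree * i + 1 ≤ J := by
    intro i hi
    have := Nat.mul_le_mul_left P₂.natDegree (Nat.lt_succ_iff.1 (Finset.mem_range.1 hi))
    omega
  have hle2 : ∀ i, P₁.natDegree * (m - i) + 1 ≤ J := by
    intro i
    have := Nat.mul_le_mul_left P₁.natDegree (Nat.sub_le m i)
    omega
  have hsub : (Finset.range (m + 1)).image φ ⊆ s := by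
    intro j hj
    obtain ⟨i, hi, rfl⟩ := Finset.mem_image.1 hj
    exact hmem.2 ⟨hle1 i hi, hle2 i⟩
  refine le_trans ?_ (Finset.sum_le_sum_of_subset_of_nonneg hsub fun i _ _ =>
    mul_nonneg (sq_nonneg _) (mean_nonneg fun x => sq_nonneg _))
  rw [Finset.sum_image hinj.injOn]
  have hcard : ((m : ℝ) + 1) = ((Finset.range (m + 1)).card : ℝ) := by simp
  rw [hcard, ← nsmul_eq_mul]
  refine Finset.card_nsmul_le_sum _ _ _ fun i hi => ?_
  have hi' : i ≤ m := Nat.lt_succ_iff.1 (Finset.mem_range.1 hi)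
  rw [mean_norm_sq_levelSum h₁ h₂ hco hu (s := P₂.natDegree * i) (t := P₁.natDegree * (m - i))
    _ J (hle1 i hi) (hle2 i) hn]
  · have e1 := norm_levelCoeff_ge hβ₁ hd₁ (hle1 i hi)
    have e2 := norm_levelCoeff_ge hβ₂ hd₂ (hle2 i)
    have hc' : (‖β₁ - 1‖ / 2) ^ 2 * (‖β₂ - 1‖ / 2) ^ 2 ≤ ‖c (φ i)‖ ^ 2 := by
      rw [← mul_pow, hc, norm_mul]
      gcongr
    have := hp P₁.natDegree
    have := hp P₂.natDegree
    gcongr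
  · obtain ⟨r, rfl⟩ := Nat.exists_eq_add_of_le hi'
    rw [hH, Nat.add_sub_cancel_left]; ring

end SecondMoment

section Concentration

/-- The monic irreducible polynomials whose degree lies in `(a, b]`. -/
def primesIoc (k : Type) [Field k] [Fintype k] (a b : ℕ) : Finset k[X] := by
  classical exact
  (polysLT k (b + 1)).filter fun P => P.Monic ∧ Irreducible P ∧ a < P.natDegree

lemma mem_primesIoc {a b : ℕ} {P : k[X]} :
    P ∈ primesIoc k a b ↔ P.Monic ∧ Irreducible P ∧ a < P.natDegree ∧ P.natDegree ≤ b := by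
  classical
  simp only [primesIoc, Finset.mem_filter, mem_polysLT]
  constructor
  · rintro ⟨h, h1, h2, h3⟩
    refine ⟨h1, h2, h3, ?_⟩
    rw [degree_eq_natDegree h1.ne_zero] at h
    norm_cast at h
    omega
  · rintro ⟨h1, h2, h3, h4⟩
    refine ⟨?_, h1, h2, h3⟩
    rw [degree_eq_natDegree h1.ne_zero]
    norm_cast
    omega

lemma isCoprime_of_irreducible_of_ne {P P' : k[X]} (hP : P.Monic) (hP' : P'.Monic)
    (hi : Irreducible P) (hi' : Irreducible P') (hne : P ≠ P') : IsCoprime P P' := by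
  rw [hi.coprime_iff_not_dvd]
  intro hd
  exact hne (eq_of_monic_of_associated hP hP' (hi.associated_of_dvd hi' hd))

lemma card_irreducible_mul_le {s : Finset k[X]} {d : ℕ} (hd : d ≠ 0)
    (hs : ∀ P ∈ s, P.Monic ∧ Irreducible P ∧ P.natDegree = d) :
    s.card * d ≤ Fintype.card k ^ d := by
  have h1 : 1 < Fintype.card k := Fintype.one_lt_card
  have hdvd : ∏ P ∈ s, P ∣ X ^ Fintype.card k ^ d - X := by
    apply Finset.prod_dvd_of_coprime
    · intro P hP P' hP' hne
      exact isCoprime_of_irreducible_of_ne (hs P hP).1 (hs P' hP').1 (hs P hP).2.1 (hs P' hP').2.1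
        hne
    · intro P hP
      have := ((hs P hP).2.1.natDegree_dvd_iff_dvd_X_pow_card_pow_sub_X (n := d)).1
        (hs P hP).2.2.dvd
      rwa [Nat.card_eq_fintype_card] at this
  have hle := natDegree_le_of_dvd hdvd (FiniteField.X_pow_card_pow_sub_X_ne_zero k hd h1)
  rw [FiniteField.X_pow_card_pow_sub_X_natDegree_eq k hd h1,
    natDegree_prod_of_monic _ _ fun P hP => (hs P hP).1,
    Finset.sum_congr rfl fun P hP => (hs P hP).2.2, Finset.sum_const, smul_eq_mul] at hle
  exact hle

lemma sum_primesIoc_le (a b : ℕ) {h : ℕ → ℝ} (hh : ∀ d, 0 ≤ h d) :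
    ∑ P ∈ primesIoc k a b, h P.natDegree ≤
      ∑ d ∈ Finset.Ioc a b, (Fintype.card k : ℝ) ^ d / d * h d := by
  classical
  rw [← Finset.sum_fiberwise_of_maps_to (t := Finset.Ioc a b) (g := fun P : k[X] => P.natDegree)
    fun P hP => Finset.mem_Ioc.2 (mem_primesIoc.1 hP).2.2]
  refine Finset.sum_le_sum fun d hd => ?_
  have hd0 : 0 < d := by have := (Finset.mem_Ioc.1 hd).1; omega
  rw [Finset.sum_congr rfl fun P hP => by rw [(Finset.mem_filter.1 hP).2], Finset.sum_const,
    nsmul_eq_mul]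
  refine mul_le_mul_of_nonneg_right ?_ (hh d)
  rw [le_div_iff₀ (by exact_mod_cast hd0)]
  have := card_irreducible_mul_le (k := k) (s := {P ∈ primesIoc k a b | P.natDegree = d}) hd0.ne'
    fun P hP => by
      have h := Finset.mem_filter.1 hP
      have h' := mem_primesIoc.1 h.1
      exact ⟨h'.1, h'.2.1, h.2⟩
  exact_mod_cast this

lemma sum_inv_pow_le {q : ℝ} (hq : 2 ≤ q) (a b : ℕ) :
    ∑ d ∈ Finset.Ioc a b, (q ^ d)⁻¹ ≤ (q ^ a)⁻¹ := by
  have hq0 : 0 < q := by linarith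
  rcases le_total a b with hab | hab
  · suffices ∑ d ∈ Finset.Ioc a b, (q ^ d)⁻¹ ≤ (q ^ a)⁻¹ - (q ^ b)⁻¹ by
      have : 0 < (q ^ b)⁻¹ := by positivity
      linarith
    induction b, hab using Nat.le_induction with
    | base => simp
    | succ b hb ih =>
      rw [Finset.sum_Ioc_succ_top (by omega)]
      have : (q ^ b)⁻¹ = q * (q ^ (b + 1))⁻¹ := by rw [pow_succ]; field_simp
      have h2 : 2 * (q ^ (b + 1))⁻¹ ≤ q * (q ^ (b + 1))⁻¹ := by gcongr
      linarith
  · rw [Finset.Ioc_eq_empty (by omega), Finset.sum_empty]; positivity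

lemma sum_pow_le {q : ℝ} (hq : 2 ≤ q) (a b : ℕ) :
    ∑ d ∈ Finset.Ioc a b, q ^ d ≤ q ^ (b + 1) := by
  have hq0 : 0 < q := by linarith
  rcases le_total a b with hab | hab
  · induction b, hab using Nat.le_induction with
    | base => simp; positivity
    | succ b hb ih =>
      rw [Finset.sum_Ioc_succ_top (by omega)]
      have h2 : 2 * q ^ (b + 1) ≤ q * q ^ (b + 1) := by gcongr
      have : q ^ (b + 1 + 1) = q * q ^ (b + 1) := by ring
      linarith
  · rw [Finset.Ioc_eq_empty (by omega), Finset.sum_empty]; positivity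

lemma two_le_card : (2 : ℝ) ≤ Fintype.card k := by exact_mod_cast Fintype.one_lt_card

/-- The variance of a truncated additive function. -/
lemma mean_sq_additive_le (τ : k[X] → ℝ) {w m n : ℕ} (hm : 2 * m ≤ n) {L : k[X]}
    (hL : ∀ P : k[X], P.Monic → Irreducible P → w < P.natDegree → IsCoprime P L) (A : k[X]) :
    mean n (fun x => (∑ P ∈ primesIoc k w m, τ P * (ind ℝ P (A + L * x) -
      ((Fintype.card k : ℝ) ^ P.natDegree)⁻¹)) ^ 2) ≤
      ∑ P ∈ primesIoc k w m, ((Fintype.card k : ℝ) ^ P.natDegree)⁻¹ * τ P ^ 2 := by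
  set s := primesIoc k w m
  set p : k[X] → ℝ := fun P => ((Fintype.card k : ℝ) ^ P.natDegree)⁻¹ with hp
  have hmean : ∀ P ∈ s, mean n (fun x => ind ℝ P (A + L * x)) = p P := fun P hP => by
    have h := mem_primesIoc.1 hP
    exact mean_ind_affine h.1 (hL P h.1 h.2.1 h.2.2.1) A (by omega)
  have hper : ∀ P : k[X], PeriodicMod P (fun x => ind ℝ P (A + L * x) - p P) := by
    intro P x y
    have : A + L * (x + P * y) = A + L * x + P * (L * y) := by ring
    simp only [this, ind_periodic ℝ P (A + L * x) (L * y)]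
  have hcent : ∀ P ∈ s, mean n (fun x => ind ℝ P (A + L * x) - p P) = 0 := fun P hP => by
    rw [mean_sub, hmean P hP, mean_const, sub_self]
  simp only [sq, Finset.sum_mul_sum]
  rw [mean_sum]
  refine Finset.sum_le_sum fun P hP => ?_
  have hP' := mem_primesIoc.1 hP
  rw [mean_sum, Finset.sum_eq_single_of_mem P hP]
  · have : (fun x => τ P * (ind ℝ P (A + L * x) - p P) * (τ P * (ind ℝ P (A + L * x) - p P))) =
        fun x => (τ P * τ P) * ((1 - 2 * p P) * ind ℝ P (A + L * x) + p P ^ 2) := by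
      funext x
      by_cases h : P ∣ A + L * x
      · rw [ind_of_dvd h]; ring
      · rw [ind_of_not_dvd h]; ring
    rw [this, mean_const_mul, mean_add, mean_const_mul, hmean P hP, mean_const]
    nlinarith [mul_nonneg (mul_self_nonneg (τ P)) (sq_nonneg (p P))]
  · intro P' hP' hne
    have h' := mem_primesIoc.1 hP'
    have h := mem_primesIoc.1 hP
    have : (fun x => τ P * (ind ℝ P (A + L * x) - p P) * (τ P' * (ind ℝ P' (A + L * x) - p P'))) =
        fun x => (τ P * τ P') * ((ind ℝ P (A + L * x) - p P) * (ind ℝ P' (A + L * x) - p P')) := by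
      funext x; ring
    rw [this, mean_const_mul, mean_mul h.1 h'.1
      (isCoprime_of_irreducible_of_ne h.1 h'.1 h.2.1 h'.2.1 hne.symm) (hper P) (hper P') (by omega),
      hcent P hP, zero_mul, mul_zero]

lemma mean_abs_additive_le (τ : k[X] → ℝ) {w m n : ℕ} (hm : 2 * m ≤ n) {L : k[X]}
    (hL : ∀ P : k[X], P.Monic → Irreducible P → w < P.natDegree → IsCoprime P L) (A : k[X])
    {s : ℝ} (hs : 0 < s)
    (htail : ∑ P ∈ primesIoc k w m, ((Fintype.card k : ℝ) ^ P.natDegree)⁻¹ * τ P ^ 2 ≤ s ^ 2) :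
    mean n (fun x => |∑ P ∈ primesIoc k w m, τ P * ind ℝ P (A + L * x) -
      ∑ P ∈ primesIoc k w m, τ P * ((Fintype.card k : ℝ) ^ P.natDegree)⁻¹|) ≤ s := by
  have h1 := (mean_sq_additive_le τ hm hL A).trans htail
  have h2 : ∀ y : ℝ, |y| ≤ s / 2 + (2 * s)⁻¹ * y ^ 2 := fun y => by
    have : s / 2 + (2 * s)⁻¹ * y ^ 2 - |y| = (2 * s)⁻¹ * (|y| - s) ^ 2 := by
      rw [← sq_abs y]; field_simp; ring
    have h3 : 0 ≤ (2 * s)⁻¹ * (|y| - s) ^ 2 := by positivity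
    linarith
  refine (mean_mono fun x _ => h2 _).trans ?_
  rw [mean_add, mean_const, mean_const_mul]
  simp only [← Finset.sum_sub_distrib, ← mul_sub]
  have h4 : (2 * s)⁻¹ * s ^ 2 = s / 2 := by field_simp
  have h5 := mul_le_mul_of_nonneg_left h1 (show 0 ≤ (2 * s)⁻¹ by positivity)
  linarith

lemma sum_inv_primesIoc_le {m N : ℕ} (hm : 0 < m) (hN : N ≤ 5 * m) :
    ∑ P ∈ primesIoc k m N, ((Fintype.card k : ℝ) ^ P.natDegree)⁻¹ ≤ 4 := by
  have hq := two_le_card (k := k)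
  refine (sum_primesIoc_le (k := k) m N (h := fun d => ((Fintype.card k : ℝ) ^ d)⁻¹)
    fun d => by positivity).trans ?_
  have hm' : (0 : ℝ) < m := by exact_mod_cast hm
  calc ∑ d ∈ Finset.Ioc m N, (Fintype.card k : ℝ) ^ d / d * ((Fintype.card k : ℝ) ^ d)⁻¹
      ≤ ∑ d ∈ Finset.Ioc m N, (m : ℝ)⁻¹ := by
        refine Finset.sum_le_sum fun d hd => ?_
        have hd' : (m : ℝ) ≤ d := by exact_mod_cast (Finset.mem_Ioc.1 hd).1.le
        have hq' : (Fintype.card k : ℝ) ^ d ≠ 0 := by positivity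
        have : (Fintype.card k : ℝ) ^ d / d * ((Fintype.card k : ℝ) ^ d)⁻¹ = (d : ℝ)⁻¹ := by
          field_simp
        rw [this]
        gcongr
    _ ≤ 4 := by
        rw [Finset.sum_const, Nat.card_Ioc, nsmul_eq_mul, ← div_eq_mul_inv, div_le_iff₀ hm']
        have : N - m ≤ 4 * m := by omega
        exact_mod_cast this

lemma mean_large_primes_le (τ : k[X] → ℝ) {w m n l : ℕ} (hw : w ≤ m) (hm : 0 < m)
    (hN : n + l ≤ 5 * m) {L : k[X]}
    (hL : ∀ P : k[X], P.Monic → Irreducible P → w < P.natDegree → IsCoprime P L) (A : k[X])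
    {s : ℝ} (hs : 0 < s)
    (htail : ∑ P ∈ primesIoc k m (n + l), ((Fintype.card k : ℝ) ^ P.natDegree)⁻¹ * τ P ^ 2 ≤
      s ^ 2) :
    mean n (fun x => ∑ P ∈ primesIoc k m (n + l), |τ P| * ind ℝ P (A + L * x)) ≤
      (1 + (Fintype.card k : ℝ) ^ l) * (3 * s) := by
  have hq := two_le_card (k := k)
  set q := (Fintype.card k : ℝ)
  rw [mean_sum]
  have h1 : ∀ P ∈ primesIoc k m (n + l), mean n (fun x => |τ P| * ind ℝ P (A + L * x)) ≤
      (1 + q ^ l) * (s / 2 * (q ^ P.natDegree)⁻¹ +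
        (2 * s)⁻¹ * ((q ^ P.natDegree)⁻¹ * τ P ^ 2)) := by
    intro P hP
    have h := mem_primesIoc.1 hP
    have h2 := mean_ind_affine_le h.1 (hL P h.1 h.2.1 (by omega)) A n
    have h3 : (q ^ n)⁻¹ ≤ q ^ l * (q ^ P.natDegree)⁻¹ := by
      rw [inv_le_iff_one_le_mul₀ (by positivity), mul_comm, ← mul_assoc, ← pow_add,
        ← div_eq_mul_inv, one_le_div (by positivity)]
      exact pow_le_pow_right₀ (by linarith) h.2.2.2
    have h4 : |τ P| ≤ s / 2 + (2 * s)⁻¹ * τ P ^ 2 := by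
      have : s / 2 + (2 * s)⁻¹ * τ P ^ 2 - |τ P| = (2 * s)⁻¹ * (|τ P| - s) ^ 2 := by
        rw [← sq_abs (τ P)]; field_simp; ring
      have h3 : 0 ≤ (2 * s)⁻¹ * (|τ P| - s) ^ 2 := by positivity
      linarith
    rw [mean_const_mul]
    calc |τ P| * mean n (fun x => ind ℝ P (A + L * x))
        ≤ |τ P| * ((1 + q ^ l) * (q ^ P.natDegree)⁻¹) := by
          refine mul_le_mul_of_nonneg_left ?_ (abs_nonneg _)
          linarith
      _ ≤ (s / 2 + (2 * s)⁻¹ * τ P ^ 2) * ((1 + q ^ l) * (q ^ P.natDegree)⁻¹) := by gcongr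
      _ = _ := by ring
  refine (Finset.sum_le_sum h1).trans ?_
  rw [← Finset.mul_sum, Finset.sum_add_distrib, ← Finset.mul_sum, ← Finset.mul_sum]
  have h5 := sum_inv_primesIoc_le (k := k) hm hN
  have h6 : (2 * s)⁻¹ * s ^ 2 = s / 2 := by field_simp
  have h7 := mul_le_mul_of_nonneg_left htail (show 0 ≤ (2 * s)⁻¹ by positivity)
  have h8 := mul_le_mul_of_nonneg_left h5 (show 0 ≤ s / 2 by positivity)
  gcongr
  linarith

lemma mean_squares_le {w n N : ℕ} {L : k[X]}
    (hL : ∀ P : k[X], P.Monic → Irreducible P → w < P.natDegree → IsCoprime P L) (A : k[X]) :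
    mean n (fun x => ∑ P ∈ primesIoc k w (N / 2), ind ℝ (P ^ 2) (A + L * x)) ≤
      ((Fintype.card k : ℝ) ^ w)⁻¹ +
        (Fintype.card k : ℝ) ^ (N / 2 + 1) * ((Fintype.card k : ℝ) ^ n)⁻¹ := by
  have hq := two_le_card (k := k)
  set q := (Fintype.card k : ℝ)
  rw [mean_sum]
  have h1 : ∀ P ∈ primesIoc k w (N / 2), mean n (fun x => ind ℝ (P ^ 2) (A + L * x)) ≤
      (q ^ (P.natDegree * 2))⁻¹ + (q ^ n)⁻¹ := by
    intro P hP
    have h := mem_primesIoc.1 hP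
    have := mean_ind_affine_le (h.1.pow 2) ((hL P h.1 h.2.1 h.2.2.1).pow_left) A n
    rwa [h.1.natDegree_pow, mul_comm 2] at this
  refine (Finset.sum_le_sum h1).trans ?_
  refine (sum_primesIoc_le (k := k) w (N / 2) (h := fun d => (q ^ (d * 2))⁻¹ + (q ^ n)⁻¹)
    fun d => by positivity).trans ?_
  calc ∑ d ∈ Finset.Ioc w (N / 2), q ^ d / d * ((q ^ (d * 2))⁻¹ + (q ^ n)⁻¹)
      ≤ ∑ d ∈ Finset.Ioc w (N / 2), ((q ^ d)⁻¹ + q ^ d * (q ^ n)⁻¹) := by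
        refine Finset.sum_le_sum fun d hd => ?_
        have hd' : (1 : ℝ) ≤ d := by
          have := (Finset.mem_Ioc.1 hd).1
          exact_mod_cast (by omega : 1 ≤ d)
        have h2 : q ^ d / d ≤ q ^ d := div_le_self (by positivity) hd'
        have h3 : (q ^ d)⁻¹ = q ^ d * (q ^ (d * 2))⁻¹ := by
          rw [pow_mul]; field_simp
        rw [h3, ← mul_add]
        gcongr
    _ = ∑ d ∈ Finset.Ioc w (N / 2), (q ^ d)⁻¹ + (∑ d ∈ Finset.Ioc w (N / 2), q ^ d) * (q ^ n)⁻¹ := by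
        rw [Finset.sum_add_distrib, Finset.sum_mul]
    _ ≤ _ := by
        gcongr
        · exact sum_inv_pow_le hq _ _
        · exact sum_pow_le hq _ _

end Concentration

section Deviation

/-- The tails of the series `∑ q^{-deg P} τ(P)²` over the monic irreducibles tend to zero. -/
def HasSmallTails (τ : k[X] → ℝ) : Prop :=
  ∀ ε : ℝ, 0 < ε → ∃ w₀ : ℕ, ∀ a, w₀ ≤ a → ∀ b,
    ∑ P ∈ primesIoc k a b, ((Fintype.card k : ℝ) ^ P.natDegree)⁻¹ * τ P ^ 2 ≤ ε

lemma exists_sum_primesIoc_le {c : k[X] → ℝ}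
    (hc : Summable fun P : {P : k[X] // P.Monic ∧ Irreducible P} => c P) {ε : ℝ} (hε : 0 < ε) :
    ∃ w₀ : ℕ, ∀ a, w₀ ≤ a → ∀ b, ∑ P ∈ primesIoc k a b, c P ≤ ε := by
  classical
  obtain ⟨s, hs⟩ := summable_iff_vanishing_norm.1 hc ε hε
  refine ⟨s.sup fun P => (P : k[X]).natDegree, fun a ha b => ?_⟩
  set t : Finset {P : k[X] // P.Monic ∧ Irreducible P} := (primesIoc k a b).subtype _ with ht
  have hdisj : Disjoint t s := by
    rw [Finset.disjoint_left]
    intro P hP hPs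
    have h1 := (mem_primesIoc.1 (Finset.mem_subtype.1 hP)).2.2.1
    have h2 := Finset.le_sup (f := fun P : {P : k[X] // P.Monic ∧ Irreducible P} =>
      (P : k[X]).natDegree) hPs
    omega
  have h := (le_abs_self _).trans (hs t hdisj).le
  rw [ht, Finset.sum_subtype_of_mem (fun P => c P) fun P hP =>
    ⟨(mem_primesIoc.1 hP).1, (mem_primesIoc.1 hP).2.1⟩] at h
  exact h

/-- The expected value of the additive function attached to `τ`. -/
def centre (τ : k[X] → ℝ) (w n : ℕ) : ℝ :=
  ∑ P ∈ primesIoc k w (n / 2), τ P * ((Fintype.card k : ℝ) ^ P.natDegree)⁻¹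

/-- An upper bound for the distance of `∑_{P ∣ G} τ(P)` to its expected value, also accounting for
repeated irreducible factors. -/
def deviation (τ : k[X] → ℝ) (w n l : ℕ) (G : k[X]) : ℝ :=
  |∑ P ∈ primesIoc k w (n / 2), τ P * ind ℝ P G - centre τ w n| +
    ∑ P ∈ primesIoc k (n / 2) (n + l), |τ P| * ind ℝ P G +
    2 * ∑ P ∈ primesIoc k w ((n + l) / 2), ind ℝ (P ^ 2) G

lemma exists_inv_card_pow_le (k : Type) [Field k] [Fintype k] {ε : ℝ} (hε : 0 < ε) :
    ∃ j₀ : ℕ, ∀ j, j₀ ≤ j → ((Fintype.card k : ℝ) ^ j)⁻¹ ≤ ε := by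
  have hq := two_le_card (k := k)
  obtain ⟨j₀, hj₀⟩ := exists_pow_lt_of_lt_one hε
    (show ((Fintype.card k : ℝ))⁻¹ < 1 from inv_lt_one_of_one_lt₀ (by linarith))
  refine ⟨j₀, fun j hj => le_trans ?_ hj₀.le⟩
  rw [inv_pow]
  gcongr
  linarith

lemma exists_mean_deviation_le {τ : k[X] → ℝ} (hτ : HasSmallTails τ) {δ : ℝ} (hδ : 0 < δ) :
    ∃ w₀ : ℕ, ∀ w, w₀ ≤ w → ∀ L : k[X],
      (∀ P : k[X], P.Monic → Irreducible P → w < P.natDegree → IsCoprime P L) →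
      ∀ l : ℕ, ∃ n₀ : ℕ, ∀ n, n₀ ≤ n → ∀ A : k[X],
        mean n (fun x => deviation τ w n l (A + L * x)) ≤ δ := by
  have hq := two_le_card (k := k)
  obtain ⟨w₁, hw₁⟩ := hτ ((δ / 4) ^ 2) (by positivity)
  obtain ⟨w₂, hw₂⟩ := exists_inv_card_pow_le k (show 0 < δ / 8 by positivity)
  refine ⟨max w₁ w₂, fun w hw L hL l => ?_⟩
  set q := (Fintype.card k : ℝ) with hqdef
  set s : ℝ := δ / (12 * (1 + q ^ l)) with hsdef
  have hs : 0 < s := by positivity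
  obtain ⟨m₁, hm₁⟩ := hτ (s ^ 2) (by positivity)
  obtain ⟨m₂, hm₂⟩ := exists_inv_card_pow_le k (show 0 < δ / 8 / q ^ (l + 1) by positivity)
  refine ⟨2 * (m₁ + m₂ + w + l + 5), fun n hn A => ?_⟩
  simp only [deviation]
  rw [mean_add, mean_add, mean_const_mul]
  have h1 := mean_abs_additive_le τ (w := w) (m := n / 2) (n := n) (by omega) hL A
    (show 0 < δ / 4 by positivity) (hw₁ w (le_of_max_le_left hw) _)
  have h2 := mean_large_primes_le τ (w := w) (m := n / 2) (n := n) (l := l) (by omega) (by omega)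
    (by omega) hL A hs (hm₁ _ (by omega) _)
  have h3 := mean_squares_le (w := w) (n := n) (N := n + l) hL A
  have h4 := hw₂ w (le_of_max_le_right hw)
  have h5 : q ^ ((n + l) / 2 + 1) * (q ^ n)⁻¹ ≤ δ / 8 := by
    have h6 := hm₂ (n / 2) (by omega)
    have h7 : q ^ ((n + l) / 2 + 1) * (q ^ n)⁻¹ ≤ q ^ (l + 1) * (q ^ (n / 2))⁻¹ := by
      rw [← div_eq_mul_inv, ← div_eq_mul_inv, div_le_div_iff₀ (by positivity) (by positivity),
        ← pow_add, ← pow_add]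
      exact pow_le_pow_right₀ (by linarith) (by omega)
    refine h7.trans ?_
    rwa [le_div_iff₀ (by positivity), mul_comm] at h6
  have h8 : (1 + q ^ l) * (3 * s) = δ / 4 := by
    rw [hsdef]; field_simp; ring
  rw [h8] at h2
  simp only [centre]
  linarith

lemma map_prod_of_monic {h : k[X] → ℂ} (h1 : h 1 = 1)
    (hmul : ∀ A B : k[X], A.Monic → B.Monic → h (A * B) = h A * h B) (s : Finset k[X])
    (hs : ∀ P ∈ s, P.Monic) : h (∏ P ∈ s, P) = ∏ P ∈ s, h P := by
  classical
  induction s using Finset.induction_on with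
  | empty => simpa using h1
  | insert P s hP ih =>
    rw [Finset.prod_insert hP, Finset.prod_insert hP,
      hmul _ _ (hs P (Finset.mem_insert_self _ _))
        (monic_prod_of_monic _ _ fun P' h' => hs P' (Finset.mem_insert_of_mem h')),
      ih fun P' h' => hs P' (Finset.mem_insert_of_mem h')]

lemma norm_exp_mul_I_sub_le (a b : ℝ) : ‖exp (a * I) - exp (b * I)‖ ≤ |a - b| := by
  have h : exp (a * I) - exp (b * I) = exp (b * I) * (exp (I * (a - b : ℝ)) - 1) := by
    rw [mul_sub, ← Complex.exp_add, mul_one]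
    congr 2
    push_cast
    ring
  rw [h, norm_mul, norm_exp_ofReal_mul_I, one_mul]
  exact Real.norm_exp_I_mul_ofReal_sub_one_le

lemma ind_nonneg (R x : k[X]) : 0 ≤ ind ℝ R x := by
  unfold ind; split_ifs <;> norm_num

lemma exists_monic_irreducible_dvd {R : k[X]} (hR : R.Monic) (h1 : R ≠ 1) :
    ∃ P : k[X], P.Monic ∧ Irreducible P ∧ P ∣ R := by
  have hu : ¬ IsUnit R := fun h => h1 (hR.eq_one_of_isUnit h)
  obtain ⟨P, hP, hd⟩ := WfDvdMonoid.exists_irreducible_factor hu hR.ne_zero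
  classical
  exact ⟨normalize P, monic_normalize hP.ne_zero,
    ((associated_normalize P).irreducible_iff).1 hP, normalize_dvd_iff.2 hd⟩

lemma eq_prod_primes_of_squarefree {E : k[X]} (hE : E.Monic) {w N : ℕ} (hN : E.natDegree ≤ N)
    (hw : ∀ P : k[X], P.Monic → Irreducible P → P ∣ E → w < P.natDegree)
    (hsq : ∀ P ∈ primesIoc k w (N / 2), ¬ P ^ 2 ∣ E) [DecidablePred (· ∣ E)] :
    E = ∏ P ∈ (primesIoc k w N).filter (· ∣ E), P := by
  set s := (primesIoc k w N).filter (· ∣ E)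
  have hs : ∀ P ∈ s, P.Monic ∧ Irreducible P ∧ P ∣ E := fun P hP => by
    have h := Finset.mem_filter.1 hP
    have h' := mem_primesIoc.1 h.1
    exact ⟨h'.1, h'.2.1, h.2⟩
  have hm : (∏ P ∈ s, P).Monic := monic_prod_of_monic _ _ fun P hP => (hs P hP).1
  obtain ⟨R, hR⟩ : ∏ P ∈ s, P ∣ E := Finset.prod_dvd_of_coprime
    (fun P hP P' hP' hne => isCoprime_of_irreducible_of_ne (hs P hP).1 (hs P' hP').1
      (hs P hP).2.1 (hs P' hP').2.1 hne) fun P hP => (hs P hP).2.2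
  have hRm : R.Monic := hm.of_mul_monic_left (hR ▸ hE)
  by_cases hR1 : R = 1
  · rw [hR1, mul_one] at hR; exact hR
  exfalso
  obtain ⟨P, hP, hPi, hPR⟩ := exists_monic_irreducible_dvd hRm hR1
  have hPE : P ∣ E := hR ▸ hPR.mul_left _
  have hPw := hw P hP hPi hPE
  have hPs : P ∈ s := Finset.mem_filter.2 ⟨mem_primesIoc.2
    ⟨hP, hPi, hPw, (natDegree_le_of_dvd hPE hE.ne_zero).trans hN⟩, hPE⟩
  have hP2 : P ^ 2 ∣ E := by
    rw [sq, hR]; exact mul_dvd_mul (Finset.dvd_prod_of_mem _ hPs) hPR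
  have hdeg := natDegree_le_of_dvd hP2 hE.ne_zero
  rw [hP.natDegree_pow] at hdeg
  exact hsq P (mem_primesIoc.2 ⟨hP, hPi, hPw, by omega⟩) hP2

/-- A completely multiplicative function with phases `τ` deviates from `exp (i · centre)` by at
most the deviation of the additive function attached to `τ`. -/
lemma norm_sub_exp_centre_le {τ : k[X] → ℝ} {h : k[X] → ℂ} {w n l : ℕ} (hwn : w ≤ n / 2)
    (h1 : h 1 = 1) (hmul : ∀ A B : k[X], A.Monic → B.Monic → h (A * B) = h A * h B)
    (hτ : ∀ P : k[X], P.Monic → Irreducible P → w < P.natDegree → h P = exp (τ P * I))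
    {E G : k[X]} (hE : E.Monic) (hdeg : E.natDegree ≤ n + l)
    (hw : ∀ P : k[X], P.Monic → Irreducible P → P ∣ E → w < P.natDegree)
    (hEG : E ∣ G)
    (hGE : ∀ P : k[X], P.Monic → Irreducible P → w < P.natDegree → P ∣ G → P ∣ E)
    (hnorm : ‖h E‖ = 1) :
    ‖h E - exp (centre τ w n * I)‖ ≤ deviation τ w n l G := by
  classical
  have hsum0 : 0 ≤ ∑ P ∈ primesIoc k w ((n + l) / 2), ind ℝ (P ^ 2) G :=
    Finset.sum_nonneg fun P _ => ind_nonneg _ _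
  have hlarge0 : 0 ≤ ∑ P ∈ primesIoc k (n / 2) (n + l), |τ P| * ind ℝ P G :=
    Finset.sum_nonneg fun P _ => mul_nonneg (abs_nonneg _) (ind_nonneg _ _)
  by_cases hsq : ∃ P ∈ primesIoc k w ((n + l) / 2), P ^ 2 ∣ E
  · obtain ⟨P, hP, hPE⟩ := hsq
    have h2 : (1 : ℝ) ≤ ∑ P ∈ primesIoc k w ((n + l) / 2), ind ℝ (P ^ 2) G := by
      rw [← ind_of_dvd (K := ℝ) (hPE.trans hEG)]
      exact Finset.single_le_sum (f := fun P => ind ℝ (P ^ 2) G) (fun P _ => ind_nonneg _ _) hP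
    have h3 : ‖h E - exp (centre τ w n * I)‖ ≤ 2 := by
      refine (norm_sub_le _ _).trans ?_
      rw [hnorm, norm_exp_ofReal_mul_I]; norm_num
    unfold deviation
    have := abs_nonneg (∑ P ∈ primesIoc k w (n / 2), τ P * ind ℝ P G - centre τ w n)
    linarith
  · push Not at hsq
    have hprod := eq_prod_primes_of_squarefree hE hdeg hw hsq
    have hval : h E = exp ((∑ P ∈ primesIoc k w (n + l), τ P * ind ℝ P G : ℝ) * I) := by
      rw [hprod, map_prod_of_monic h1 hmul _ fun P hP =>
        (mem_primesIoc.1 (Finset.mem_filter.1 hP).1).1]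
      push_cast
      rw [Finset.sum_mul, Complex.exp_sum, Finset.prod_filter]
      refine Finset.prod_congr rfl fun P hP => ?_
      have h' := mem_primesIoc.1 hP
      by_cases hd : P ∣ E
      · rw [if_pos hd, ind_of_dvd (hd.trans hEG), hτ P h'.1 h'.2.1 h'.2.2.1]; simp
      · rw [if_neg hd, ind_of_not_dvd fun h => hd (hGE P h'.1 h'.2.1 h'.2.2.1 h)]; simp
    have hunion : primesIoc k w (n + l) = primesIoc k w (n / 2) ∪ primesIoc k (n / 2) (n + l) := by
      ext P
      simp only [Finset.mem_union, mem_primesIoc]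
      constructor
      · rintro ⟨a, b, c, d⟩
        rcases le_or_gt P.natDegree (n / 2) with e | e
        · exact Or.inl ⟨a, b, c, e⟩
        · exact Or.inr ⟨a, b, e, d⟩
      · rintro (⟨a, b, c, d⟩ | ⟨a, b, c, d⟩)
        · exact ⟨a, b, c, by omega⟩
        · exact ⟨a, b, by omega, d⟩
    have hdisj : Disjoint (primesIoc k w (n / 2)) (primesIoc k (n / 2) (n + l)) := by
      rw [Finset.disjoint_left]
      intro P hP hP'
      have := (mem_primesIoc.1 hP).2.2.2
      have := (mem_primesIoc.1 hP').2.2.1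
      omega
    rw [hval]
    refine (norm_exp_mul_I_sub_le _ _).trans ?_
    rw [hunion, Finset.sum_union hdisj, add_sub_right_comm]
    refine (abs_add_le _ _).trans ?_
    have h4 : |∑ P ∈ primesIoc k (n / 2) (n + l), τ P * ind ℝ P G| ≤
        ∑ P ∈ primesIoc k (n / 2) (n + l), |τ P| * ind ℝ P G := by
      refine (Finset.abs_sum_le_sum_abs _ _).trans (Finset.sum_le_sum fun P _ => ?_)
      rw [abs_mul, abs_of_nonneg (ind_nonneg P G)]
    unfold deviation
    linarith

end Deviation

section DivisorMoves

/-- The equivalence relation generated by the moves `ν ↦ ν + d`, where `d` is a common divisor of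
`W` and `ν`. -/
def MoveRel (W : k[X]) : k[X] → k[X] → Prop :=
  Relation.EqvGen fun ν ν' => ∃ d, d ∣ W ∧ d ∣ ν ∧ ν' = ν + d

lemma MoveRel.refl (W ν : k[X]) : MoveRel W ν ν := Relation.EqvGen.refl ν

lemma MoveRel.symm {W ν ν' : k[X]} (h : MoveRel W ν ν') : MoveRel W ν' ν :=
  Relation.EqvGen.symm _ _ h

lemma MoveRel.trans {W ν ν' ν'' : k[X]} (h : MoveRel W ν ν') (h' : MoveRel W ν' ν'') :
    MoveRel W ν ν'' := Relation.EqvGen.trans _ _ _ h h'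

lemma MoveRel.mono {W W' ν ν' : k[X]} (hW : W ∣ W') (h : MoveRel W ν ν') : MoveRel W' ν ν' :=
  Relation.EqvGen.mono (r := fun ν ν' => ∃ d, d ∣ W ∧ d ∣ ν ∧ ν' = ν + d)
    (fun _ _ ⟨d, h1, h2, h3⟩ => ⟨d, h1.trans hW, h2, h3⟩) _ _ h

lemma MoveRel.mul_left {W ν ν' : k[X]} (x : k[X]) (h : MoveRel W ν ν') :
    MoveRel (x * W) (x * ν) (x * ν') := by
  induction h with
  | rel a b h =>
    obtain ⟨d, h1, h2, rfl⟩ := h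
    exact Relation.EqvGen.rel _ _ ⟨x * d, mul_dvd_mul_left x h1, mul_dvd_mul_left x h2, by ring⟩
  | refl a => exact MoveRel.refl _ _
  | symm a b _ ih => exact ih.symm
  | trans a b c _ _ ih ih' => exact ih.trans ih'

lemma MoveRel.add_mul {W ν ν' : k[X]} (y : k[X]) (h : MoveRel W ν ν') :
    MoveRel W (ν + W * y) (ν' + W * y) := by
  induction h with
  | rel a b h =>
    obtain ⟨d, h1, h2, rfl⟩ := h
    exact Relation.EqvGen.rel _ _ ⟨d, h1, h2.add (h1.mul_right y), by ring⟩
  | refl a => exact MoveRel.refl _ _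
  | symm a b _ ih => exact ih.symm
  | trans a b c _ _ ih ih' => exact ih.trans ih'

lemma moveRel_add_mul_iff {W ν ν' : k[X]} (y : k[X]) :
    MoveRel W (ν + W * y) (ν' + W * y) ↔ MoveRel W ν ν' := by
  refine ⟨fun h => ?_, fun h => h.add_mul y⟩
  have := h.add_mul (-y)
  rwa [show ν + W * y + W * -y = ν by ring, show ν' + W * y + W * -y = ν' by ring] at this

open Classical in
/-- The indicator function of the `ν` that are not related to `ν + e`. -/
def moveDefect (W e ν : k[X]) : ℝ := if MoveRel W ν (ν + e) then 0 else 1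

lemma moveDefect_nonneg (W e ν : k[X]) : 0 ≤ moveDefect W e ν := by
  unfold moveDefect; split_ifs <;> norm_num

lemma moveDefect_of_rel {W e ν : k[X]} (h : MoveRel W ν (ν + e)) : moveDefect W e ν = 0 :=
  if_pos h

lemma moveDefect_of_not_rel {W e ν : k[X]} (h : ¬ MoveRel W ν (ν + e)) : moveDefect W e ν = 1 :=
  if_neg h

lemma moveDefect_le_one (W e ν : k[X]) : moveDefect W e ν ≤ 1 := by
  unfold moveDefect; split_ifs <;> norm_num

lemma moveDefect_periodic (W e : k[X]) : PeriodicMod W (moveDefect W e) := by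
  intro x y
  have : x + W * y + e = x + e + W * y := by ring
  unfold moveDefect
  rw [this, moveRel_add_mul_iff]

/-- For every `ε > 0`, all `ν` outside a set of density at most `b + ε` can be connected to `ν + e`
by moves along the divisors of a polynomial coprime to `L`. -/
def IsNear (L e : k[X]) (b : ℝ) : Prop :=
  ∀ ε : ℝ, 0 < ε → ∃ W : k[X], W.Monic ∧ IsCoprime W L ∧
    mean W.natDegree (moveDefect W e) ≤ b + ε

/-- The sum of `q^{-deg P}` over `P ∈ T` converges. -/
def IsThin (T : Set k[X]) : Prop :=
  Summable (T.indicator fun P => ((Fintype.card k : ℝ) ^ P.natDegree)⁻¹)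

lemma IsThin.mono {T T' : Set k[X]} (h : T ⊆ T') (hT' : IsThin T') : IsThin T := by
  have hq : (0 : ℝ) < Fintype.card k := by exact_mod_cast Fintype.card_pos
  refine Summable.of_nonneg_of_le (fun P => Set.indicator_nonneg (fun _ _ => by positivity) _)
    (fun P => Set.indicator_le_indicator_of_subset h (fun _ => by positivity) P) hT'

lemma IsThin.union {T T' : Set k[X]} (hT : IsThin T) (hT' : IsThin T') : IsThin (T ∪ T') := by
  have hq : (0 : ℝ) < Fintype.card k := by exact_mod_cast Fintype.card_pos
  refine Summable.of_nonneg_of_le (fun P => Set.indicator_nonneg (fun _ _ => by positivity) _)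
    (fun P => ?_) (Summable.add hT hT')
  by_cases h1 : P ∈ T <;> by_cases h2 : P ∈ T' <;> simp [h1, h2]

lemma isThin_of_finite {T : Set k[X]} (hT : T.Finite) : IsThin T :=
  summable_of_hasFiniteSupport (hT.subset (by
    intro x hx
    by_contra h
    simp [h] at hx))

lemma isThin_biUnion {ι : Type*} (s : Finset ι) (T : ι → Set k[X]) (h : ∀ i ∈ s, IsThin (T i)) :
    IsThin (⋃ i ∈ s, T i) := by
  classical
  induction s using Finset.induction_on with
  | empty => simpa using isThin_of_finite (Set.finite_empty (α := k[X]))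
  | insert a s _ ih =>
    rw [Finset.set_biUnion_insert]
    exact (h a (Finset.mem_insert_self a s)).union
      (ih fun i hi => h i (Finset.mem_insert_of_mem hi))

lemma isThin_of_sum_le {T : Set k[X]} {C : ℝ}
    (h : ∀ S : Finset k[X], (∀ P ∈ S, P ∈ T) →
      ∑ P ∈ S, ((Fintype.card k : ℝ) ^ P.natDegree)⁻¹ ≤ C) : IsThin T := by
  classical
  have hq : (0 : ℝ) < Fintype.card k := by exact_mod_cast Fintype.card_pos
  refine summable_of_sum_le (c := C)
    (fun P => Set.indicator_nonneg (fun _ _ => by positivity) _) fun u => ?_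
  rw [Finset.sum_indicator_eq_sum_filter u (fun _ P => ((Fintype.card k : ℝ) ^ P.natDegree)⁻¹)
    (fun _ => T) fun P => P]
  exact h _ fun P hP => (Finset.mem_filter.1 hP).2

/-- Enlarging an equivalence relation that is finer than a partition into blocks decreases the
number of classes by at least the number of blocks where something changes. -/
lemma card_image_quotient_add_le {α γ : Type*} [Nonempty α] {r r' : Setoid α}
    [DecidableEq (Quotient r)] [DecidableEq (Quotient r')]
    (hr : ∀ a b, r a b → r' a b) (β : α → γ) (hβ : ∀ a b, r a b → β a = β b)
    (B : Finset α) (T : Finset γ)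
    (hT : ∀ t ∈ T, ∃ a ∈ B, ∃ a' ∈ B, β a = t ∧ β a' = t ∧ r' a a' ∧ ¬ r a a') :
    (B.image (Quotient.mk r')).card + T.card ≤ (B.image (Quotient.mk r)).card := by
  classical
  have hs : ∀ c ∈ B.image (Quotient.mk r'), ∃ a ∈ B, Quotient.mk r' a = c := fun c hc => by
    simpa using hc
  choose! s hsB hs using hs
  have key : ∀ t ∈ T, ∃ a ∈ B, β a = t ∧ ¬ r a (s (Quotient.mk r' a)) := by
    intro t ht
    obtain ⟨a, ha, a', ha', h1, h2, h3, h4⟩ := hT t ht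
    have h5 : Quotient.mk r' a = Quotient.mk r' a' := Quotient.sound h3
    by_cases h : r a (s (Quotient.mk r' a))
    · refine ⟨a', ha', h2, fun h' => h4 ?_⟩
      rw [← h5] at h'
      exact r.trans h (r.symm h')
    · exact ⟨a, ha, h1, h⟩
  choose! g hgB hg hgs using key
  have hd : Disjoint ((B.image (Quotient.mk r')).image fun c => Quotient.mk r (s c))
      (T.image fun t => Quotient.mk r (g t)) := by
    rw [Finset.disjoint_left]
    rintro x hx hx'
    obtain ⟨c, hc, rfl⟩ := Finset.mem_image.1 hx
    obtain ⟨t, ht, h⟩ := Finset.mem_image.1 hx'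
    have h1 : r (g t) (s c) := Quotient.exact h
    have h2 : Quotient.mk r' (g t) = c := (Quotient.sound (hr _ _ h1)).trans (hs c hc)
    exact hgs t ht (h2 ▸ h1)
  have h1 : ((B.image (Quotient.mk r')).image fun c => Quotient.mk r (s c)).card =
      (B.image (Quotient.mk r')).card := by
    refine Finset.card_image_of_injOn fun c hc c' hc' h => ?_
    have := hr _ _ (Quotient.exact h)
    rw [← hs c hc, ← hs c' hc']
    exact Quotient.sound this
  have h2 : (T.image fun t => Quotient.mk r (g t)).card = T.card := by
    refine Finset.card_image_of_injOn fun t ht t' ht' h => ?_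
    rw [← hg t ht, ← hg t' ht']
    exact hβ _ _ (Quotient.exact h)
  rw [← h1, ← h2, ← Finset.card_union_of_disjoint hd]
  refine Finset.card_le_card (Finset.union_subset ?_ ?_)
  · intro x hx
    obtain ⟨c, hc, rfl⟩ := Finset.mem_image.1 hx
    exact Finset.mem_image_of_mem _ (hsB c hc)
  · intro x hx
    obtain ⟨t, ht, rfl⟩ := Finset.mem_image.1 hx
    exact Finset.mem_image_of_mem _ (hgB t ht)

end DivisorMoves

section Gain

/-- The equivalence relation generated by the moves `P μ ↦ P (μ + e)`, where `P ∈ S` and `μ` is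
related to `μ + e`. -/
def gainSetoid (W e : k[X]) (S : Finset k[X]) : Setoid k[X] :=
  Relation.EqvGen.setoid fun ν ν' => ∃ P ∈ S, ∃ μ, MoveRel W μ (μ + e) ∧ ν = P * μ ∧ ν' = P * (μ + e)

lemma gainSetoid_mono (W e : k[X]) {S S' : Finset k[X]} (h : S ⊆ S') {ν ν' : k[X]}
    (hr : gainSetoid W e S ν ν') : gainSetoid W e S' ν ν' :=
  Relation.EqvGen.mono
    (r := fun ν ν' => ∃ P ∈ S, ∃ μ, MoveRel W μ (μ + e) ∧ ν = P * μ ∧ ν' = P * (μ + e))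
    (fun _ _ ⟨P, h1, h2⟩ => ⟨P, h h1, h2⟩) _ _ hr

lemma moveRel_of_gainSetoid {W e : k[X]} {S : Finset k[X]} {ν ν' : k[X]}
    (h : gainSetoid W e S ν ν') : MoveRel (W * ∏ P ∈ S, P) ν ν' := by
  induction h with
  | rel a b h =>
    obtain ⟨P, hP, μ, h1, rfl, rfl⟩ := h
    refine (h1.mul_left P).mono ?_
    rw [mul_comm P]
    exact mul_dvd_mul_left W (Finset.dvd_prod_of_mem _ hP)
  | refl a => exact MoveRel.refl _ _
  | symm a b _ ih => exact ih.symm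
  | trans a b c _ _ ih ih' => exact ih.trans ih'

lemma sub_mem_of_gainSetoid {W e : k[X]} {S : Finset k[X]} {l : ℕ}
    (hl : ∀ P ∈ S, (P * e).degree < l) {ν ν' : k[X]}
    (h : gainSetoid W e S ν ν') : ν - ν' ∈ degreeLT k l := by
  induction h with
  | rel a b h =>
    obtain ⟨P, hP, μ, h1, rfl, rfl⟩ := h
    rw [show P * μ - P * (μ + e) = -(P * e) by ring]
    exact Submodule.neg_mem _ (mem_degreeLT.2 (hl P hP))
  | refl a => simp
  | symm a b _ ih => rw [← neg_sub]; exact Submodule.neg_mem _ ih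
  | trans a b c _ _ ih ih' => rw [← sub_add_sub_cancel a b c]; exact Submodule.add_mem _ ih ih'

lemma card_le_card_image_mul {A : Finset k[X]} {l : ℕ} {γ : Type*} [DecidableEq γ] (φ : k[X] → γ)
    (h : ∀ x y, φ x = φ y → x - y ∈ polysLT k l) :
    A.card ≤ Fintype.card k ^ l * (A.image φ).card := by
  classical
  refine Finset.card_le_mul_card_image A _ fun c hc => ?_
  obtain ⟨x, hx, rfl⟩ := Finset.mem_image.1 hc
  rw [← card_polysLT]
  refine Finset.card_le_card_of_injOn (fun y => y - x) (fun y hy => ?_) fun y _ z _ h => by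
    simpa using h
  exact h y x (Finset.mem_filter.1 hy).2

lemma card_gain_le {W e L : k[X]} (hW : W.Monic) (hWL : IsCoprime W L) (he : e ≠ 0) {b η : ℝ}
    (hb : mean W.natDegree (moveDefect W e) ≤ b + η / 2) (S : Finset k[X])
    (hS : ∀ P ∈ S, P.Monic ∧ Irreducible P ∧ ¬ P ∣ L ∧ ¬ P ∣ W ∧ ∀ W' : k[X], W'.Monic →
      IsCoprime W' L → b + η < mean W'.natDegree (moveDefect W' (P * e)))
    {n : ℕ} (hn : W.natDegree + ∑ P ∈ S, P.natDegree + e.natDegree + 1 ≤ n) :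
    open Classical in
    (((polysLT k n).image (Quotient.mk (gainSetoid W e S))).card : ℝ) +
      ∑ P ∈ S, ((Fintype.card k : ℝ) ^ P.natDegree)⁻¹ *
        (η / 2 * (Fintype.card k : ℝ) ^ n / (Fintype.card k : ℝ) ^ (e.natDegree + 1)) ≤
      (Fintype.card k : ℝ) ^ n := by
  classical
  have hq : (0 : ℝ) < Fintype.card k := by exact_mod_cast Fintype.card_pos
  revert hS hn
  refine Finset.induction_on_max_value (fun P : k[X] => P.natDegree) S ?_ ?_
  · intro _ _
    simp only [Finset.sum_empty, add_zero]
    calc _ ≤ ((polysLT k n).card : ℝ) := by exact_mod_cast Finset.card_image_le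
      _ = _ := by rw [card_polysLT]; push_cast; ring
  intro P S hPS hmax ih hS hn
  rw [Finset.sum_insert hPS] at hn ⊢
  have ih := ih (fun P' h => hS P' (Finset.mem_insert_of_mem h)) (by omega)
  obtain ⟨hPm, hPi, hPL, hPW, hP⟩ := hS P (Finset.mem_insert_self P S)
  obtain ⟨m, rfl⟩ := Nat.exists_eq_add_of_le (show P.natDegree ≤ n by omega)
  set R := W * ∏ P ∈ S, P with hR
  have hSm : ∀ P' ∈ S, P'.Monic := fun P' h => (hS P' (Finset.mem_insert_of_mem h)).1
  have hRm : R.Monic := hW.mul (monic_prod_of_monic _ _ hSm)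
  have hRdeg : R.natDegree = W.natDegree + ∑ P ∈ S, P.natDegree := by
    rw [hR, hW.natDegree_mul (monic_prod_of_monic _ _ hSm), natDegree_prod_of_monic _ _ hSm]
  have hRP : IsCoprime R P := by
    refine IsCoprime.mul_left ((hPi.coprime_iff_not_dvd.2 hPW).symm) ?_
    refine IsCoprime.prod_left fun P' h => ?_
    exact isCoprime_of_irreducible_of_ne (hSm P' h) hPm (hS P' (Finset.mem_insert_of_mem h)).2.1 hPi
      (fun h' => hPS (h' ▸ h))
  have hRL : IsCoprime R L := by
    refine IsCoprime.mul_left hWL (IsCoprime.prod_left fun P' h => ?_)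
    have := hS P' (Finset.mem_insert_of_mem h)
    exact this.2.1.coprime_iff_not_dvd.2 this.2.2.1
  have hdens : η / 2 ≤ mean m (fun μ => moveDefect R (P * e) (P * μ) - moveDefect W e μ) := by
    rw [mean_sub, mean_periodic hW (moveDefect_periodic W e) (by omega)]
    have h1 := mean_affine hRm hRP (moveDefect_periodic R (P * e)) 0 (n := m) (by omega)
    simp only [zero_add] at h1
    rw [h1]
    linarith [hP R hRm hRL]
  set A := (polysLT k m).filter fun μ =>
    MoveRel W μ (μ + e) ∧ ¬ MoveRel R (P * μ) (P * μ + P * e) with hA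
  have hAcard : η / 2 * (Fintype.card k : ℝ) ^ m ≤ A.card := by
    have h1 : ∑ μ ∈ polysLT k m, (moveDefect R (P * e) (P * μ) - moveDefect W e μ) ≤ A.card := by
      rw [Finset.card_eq_sum_ones, hA, Finset.sum_filter]
      push_cast
      refine Finset.sum_le_sum fun μ _ => ?_
      by_cases h1 : MoveRel W μ (μ + e) <;> by_cases h2 : MoveRel R (P * μ) (P * μ + P * e) <;>
        simp [h1, h2, moveDefect]
    refine le_trans ?_ h1
    unfold mean at hdens
    rwa [le_div_iff₀ (by positivity)] at hdens
  set l := P.natDegree + e.natDegree + 1 with hl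
  set φ : k[X] → k[X] ⧸ degreeLT k l := fun μ => Submodule.Quotient.mk (P * μ) with hφ
  have hφ' : ∀ x y, φ x = φ y → x - y ∈ polysLT k (e.natDegree + 1) := by
    intro x y h
    have h1 : P * (x - y) ∈ degreeLT k l := by
      rw [mul_sub]; exact (Submodule.Quotient.eq _).1 h
    rw [mem_degreeLT, degree_mul, degree_eq_natDegree hPm.ne_zero, hl] at h1
    rw [mem_polysLT]
    rcases eq_or_ne (x - y) 0 with h0 | h0
    · rw [h0, degree_zero]; exact WithBot.bot_lt_coe _
    · rw [degree_eq_natDegree h0] at h1 ⊢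
      norm_cast at h1 ⊢
      omega
  have hAφ := card_le_card_image_mul (A := A) φ hφ'
  have hdeg : ∀ P' ∈ insert P S, (P' * e).degree < l := by
    intro P' hP'
    have h1 : P'.natDegree ≤ P.natDegree := by
      rcases Finset.mem_insert.1 hP' with rfl | h
      · exact le_rfl
      · exact hmax P' h
    have h2 : (P' * e).degree ≤ (P'.natDegree + e.natDegree : ℕ) :=
      (degree_le_natDegree).trans (by exact_mod_cast natDegree_mul_le)
    refine h2.trans_lt ?_
    rw [hl]
    norm_cast
    omega
  have hmem : ∀ μ ∈ polysLT k m, P * μ ∈ polysLT k (P.natDegree + m) := by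
    intro μ hμ
    rw [mem_polysLT] at hμ ⊢
    rw [degree_mul, degree_eq_natDegree hPm.ne_zero]
    rcases eq_or_ne μ 0 with h0 | h0
    · rw [h0, degree_zero, WithBot.add_bot]; exact WithBot.bot_lt_coe _
    · rw [degree_eq_natDegree h0] at hμ ⊢
      norm_cast at hμ ⊢
      omega
  have hdrop := card_image_quotient_add_le (r := gainSetoid W e S) (r' := gainSetoid W e (insert P S))
    (fun a b h => gainSetoid_mono W e (Finset.subset_insert P S) h)
    (fun ν => (Submodule.Quotient.mk ν : k[X] ⧸ degreeLT k l))
    (fun a b h => (Submodule.Quotient.eq _).2 (sub_mem_of_gainSetoid hdeg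
      (gainSetoid_mono W e (Finset.subset_insert P S) h)))
    (polysLT k (P.natDegree + m)) (A.image φ) (by
      intro t ht
      obtain ⟨μ, hμ, rfl⟩ := Finset.mem_image.1 ht
      obtain ⟨hμ1, hμ2, hμ3⟩ := Finset.mem_filter.1 hμ
      have hμe : μ + e ∈ polysLT k m := by
        rw [mem_polysLT] at hμ1 ⊢
        refine (degree_add_le _ _).trans_lt (max_lt hμ1 ?_)
        rw [degree_eq_natDegree he]
        norm_cast
        omega
      refine ⟨P * μ, hmem μ hμ1, P * (μ + e), hmem _ hμe, rfl, ?_, ?_, ?_⟩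
      · refine (Submodule.Quotient.eq _).2 ?_
        rw [show P * (μ + e) - P * μ = P * e by ring]
        exact mem_degreeLT.2 (hdeg P (Finset.mem_insert_self P S))
      · exact Relation.EqvGen.rel _ _ ⟨P, Finset.mem_insert_self P S, μ, hμ2, rfl, rfl⟩
      · intro h
        refine hμ3 ?_
        rw [← mul_add]
        exact moveRel_of_gainSetoid h)
  have h1 : (((Fintype.card k : ℝ) ^ P.natDegree)⁻¹ *
      (η / 2 * (Fintype.card k : ℝ) ^ (P.natDegree + m) /
        (Fintype.card k : ℝ) ^ (e.natDegree + 1))) ≤ (A.image φ).card := by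
    rw [show (((Fintype.card k : ℝ) ^ P.natDegree)⁻¹ *
      (η / 2 * (Fintype.card k : ℝ) ^ (P.natDegree + m) /
        (Fintype.card k : ℝ) ^ (e.natDegree + 1))) = η / 2 * (Fintype.card k : ℝ) ^ m /
        (Fintype.card k : ℝ) ^ (e.natDegree + 1) by rw [pow_add]; field_simp,
      div_le_iff₀ (by positivity)]
    refine hAcard.trans ?_
    rw [mul_comm]
    exact_mod_cast hAφ
  have h2 : (((polysLT k (P.natDegree + m)).image
      (Quotient.mk (gainSetoid W e (insert P S)))).card : ℝ) + (A.image φ).card ≤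
      ((polysLT k (P.natDegree + m)).image (Quotient.mk (gainSetoid W e S))).card := by
    exact_mod_cast hdrop
  linarith

/-- If `ν` can mostly be moved to `ν + e`, then for all primes `P` outside a thin set it can mostly
be moved to `ν + P e`. -/
lemma isThin_not_isNear_mul {L e : k[X]} {b η : ℝ} (h : IsNear L e b) (hη : 0 < η) :
    IsThin {P : k[X] | P.Monic ∧ Irreducible P ∧ ¬ P ∣ L ∧ ¬ IsNear L (P * e) (b + η)} := by
  classical
  have hq : (0 : ℝ) < Fintype.card k := by exact_mod_cast Fintype.card_pos
  rcases eq_or_ne e 0 with rfl | he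
  · refine (isThin_of_finite (Set.finite_empty (α := k[X]))).mono ?_
    rintro P ⟨-, -, -, hP⟩
    refine hP ?_
    rw [mul_zero]
    intro ε hε
    obtain ⟨W, h1, h2, h3⟩ := h ε hε
    exact ⟨W, h1, h2, by linarith⟩
  obtain ⟨W, hW, hWL, hb⟩ := h (η / 2) (by positivity)
  refine IsThin.mono (T' := {P : k[X] | P.Monic ∧ Irreducible P ∧ ¬ P ∣ L ∧ ¬ P ∣ W ∧
      ¬ IsNear L (P * e) (b + η)} ∪ {P : k[X] | P.Monic ∧ P ∣ W}) ?_ ?_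
  · rintro P ⟨h1, h2, h3, h4⟩
    by_cases h5 : P ∣ W
    · exact Or.inr ⟨h1, h5⟩
    · exact Or.inl ⟨h1, h2, h3, h5, h4⟩
  refine IsThin.union ?_ (isThin_of_finite ?_)
  swap
  · refine (polysLT k (W.natDegree + 1)).finite_toSet.subset ?_
    rintro P ⟨h1, h2⟩
    rw [Finset.mem_coe, mem_polysLT, degree_eq_natDegree h1.ne_zero]
    have := natDegree_le_of_dvd h2 hW.ne_zero
    norm_cast
    omega
  refine isThin_of_sum_le (C := 2 * (Fintype.card k : ℝ) ^ (e.natDegree + 1) / η) fun S hS => ?_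
  have h1 := card_gain_le hW hWL he hb S (fun P hP => by
    obtain ⟨h1, h2, h3, h4, h5⟩ := hS P hP
    refine ⟨h1, h2, h3, h4, fun W' hW' hWL' => ?_⟩
    by_contra! hc
    exact h5 fun ε hε => ⟨W', hW', hWL', by linarith⟩) le_rfl
  rw [← Finset.sum_mul] at h1
  set n := W.natDegree + ∑ P ∈ S, P.natDegree + e.natDegree + 1
  have h2 : (∑ P ∈ S, ((Fintype.card k : ℝ) ^ P.natDegree)⁻¹) *
      (η / 2 * (Fintype.card k : ℝ) ^ n / (Fintype.card k : ℝ) ^ (e.natDegree + 1)) ≤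
      (Fintype.card k : ℝ) ^ n := by
    refine le_trans (le_add_of_nonneg_left ?_) h1
    positivity
  rw [le_div_iff₀ hη]
  rw [← mul_div_assoc, div_le_iff₀ (by positivity)] at h2
  have hqn : (0 : ℝ) < (Fintype.card k : ℝ) ^ n := by positivity
  refine le_of_mul_le_mul_right ?_ hqn
  linarith

end Gain

section ThinSieve

lemma monic_X_pow_add_of_mem {n : ℕ} {y : k[X]} (hy : y ∈ polysLT k n) : (X ^ n + y).Monic :=
  monic_X_pow_add (by simpa using hy)

lemma natDegree_X_pow_add_of_mem {n : ℕ} {y : k[X]} (hy : y ∈ polysLT k n) :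
    (X ^ n + y).natDegree = n := by
  rw [natDegree_add_eq_left_of_degree_lt (by rw [degree_X_pow]; simpa using hy), natDegree_X_pow]

lemma exists_le_of_mean_le {n : ℕ} {a : k[X] → ℝ} {c : ℝ} (h : mean n a ≤ c) :
    ∃ x ∈ polysLT k n, a x ≤ c := by
  have h1 : -c ≤ mean n (fun x => -1 * a x) := by rw [mean_const_mul]; linarith
  obtain ⟨x, hx, hxc⟩ := exists_le_of_le_mean h1
  exact ⟨x, hx, by linarith⟩

/-- A residue class coprime to its modulus contains a monic polynomial without prime factors in a
given thin set. -/
lemma exists_monic_forall_not_dvd {A R : k[X]} (hR : R.Monic) (hAR : IsCoprime A R)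
    {T : Set k[X]} (hT : IsThin T) (hTp : ∀ P ∈ T, P.Monic ∧ Irreducible P) :
    ∃ N : k[X], N.Monic ∧ R ∣ N - A ∧ ∀ P ∈ T, ¬ P ∣ N := by
  classical
  have hq : (0 : ℝ) < Fintype.card k := by exact_mod_cast Fintype.card_pos
  set c : k[X] → ℝ := fun P => ((Fintype.card k : ℝ) ^ P.natDegree)⁻¹ with hc
  have tail : ∀ ε : ℝ, 0 < ε → ∃ s : Finset k[X], ∀ t : Finset k[X], (∀ P ∈ t, P ∈ T) →
      Disjoint t s → ∑ P ∈ t, c P ≤ ε := by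
    intro ε hε
    obtain ⟨s, hs⟩ := summable_iff_vanishing_norm.1 hT ε hε
    refine ⟨s, fun t ht hd => ?_⟩
    have h1 := (le_abs_self _).trans (hs t hd).le
    rwa [Finset.sum_congr rfl fun P hP => Set.indicator_of_mem (ht P hP) _] at h1
  obtain ⟨s, hs⟩ := tail (1 / 4) (by norm_num)
  set M := ∏ P ∈ s.filter (fun P => P ∈ T ∧ ¬ P ∣ R), P with hM
  have hMm : M.Monic := monic_prod_of_monic _ _ fun P hP => (hTp P (Finset.mem_filter.1 hP).2.1).1
  have hRM : IsCoprime R M := IsCoprime.prod_right fun P hP =>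
    ((hTp P (Finset.mem_filter.1 hP).2.1).2.coprime_iff_not_dvd.2
      (Finset.mem_filter.1 hP).2.2).symm
  obtain ⟨u, v, huv⟩ := hRM
  set A' := A * (v * M) + u * R with hA'
  set R' := R * M with hR'
  have hR'm : R'.Monic := hR.mul hMm
  set D := R'.natDegree with hD
  obtain ⟨s', hs'⟩ := tail (1 / (4 * (1 + (Fintype.card k : ℝ) ^ D))) (by positivity)
  obtain ⟨n, hn⟩ : ∃ n : ℕ, A'.natDegree < n ∧ ∀ P ∈ s', P.natDegree ≤ n :=
    ⟨max (A'.natDegree + 1) (s'.sup natDegree), Nat.lt_of_succ_le (le_max_left _ _),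
      fun P hP => (Finset.le_sup (f := natDegree) hP).trans (le_max_right _ _)⟩
  set F := (polysLT k (n + D + 1)).filter fun P => P ∈ T ∧ ¬ P ∣ R' with hF
  have hdvd : ∀ P ∈ T, P ∈ s → P ∣ R' := by
    intro P hP hPs
    by_cases h : P ∣ R
    · exact h.mul_right M
    · exact (Finset.dvd_prod_of_mem (fun P => P) (Finset.mem_filter.2 ⟨hPs, hP, h⟩)).mul_left R
  have hmean : ∑ P ∈ F, mean n (fun y => ind ℝ P ((A' + R' * X ^ n) + R' * y)) ≤ 1 / 2 := by
    have hcop : ∀ P ∈ F, IsCoprime P R' := fun P hP =>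
      (hTp P (Finset.mem_filter.1 hP).2.1).2.coprime_iff_not_dvd.2 (Finset.mem_filter.1 hP).2.2
    rw [← Finset.sum_filter_add_sum_filter_not F (fun P => P.natDegree ≤ n)]
    have h1 : ∑ P ∈ F.filter (fun P => P.natDegree ≤ n),
        mean n (fun y => ind ℝ P ((A' + R' * X ^ n) + R' * y)) ≤ 1 / 4 := by
      rw [Finset.sum_congr rfl fun P hP => mean_ind_affine
        (hTp P (Finset.mem_filter.1 (Finset.mem_filter.1 hP).1).2.1).1
        (hcop P (Finset.mem_filter.1 hP).1) _ (Finset.mem_filter.1 hP).2]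
      refine hs _ (fun P hP => (Finset.mem_filter.1 (Finset.mem_filter.1 hP).1).2.1) ?_
      rw [Finset.disjoint_left]
      intro P hP hPs
      have h := (Finset.mem_filter.1 (Finset.mem_filter.1 hP).1).2
      exact h.2 (hdvd P h.1 hPs)
    have h2 : ∑ P ∈ F.filter (fun P => ¬ P.natDegree ≤ n),
        mean n (fun y => ind ℝ P ((A' + R' * X ^ n) + R' * y)) ≤ 1 / 4 := by
      have h3 : ∀ P ∈ F.filter (fun P => ¬ P.natDegree ≤ n),
          mean n (fun y => ind ℝ P ((A' + R' * X ^ n) + R' * y)) ≤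
            c P * (1 + (Fintype.card k : ℝ) ^ D) := by
        intro P hP
        have hPF := (Finset.mem_filter.1 hP).1
        have hPT := (Finset.mem_filter.1 hPF).2.1
        have hPdeg : P.natDegree ≤ n + D := by
          have := (Finset.mem_filter.1 hPF).1
          rw [mem_polysLT, degree_eq_natDegree (hTp P hPT).1.ne_zero] at this
          norm_cast at this
          omega
        refine (mean_ind_affine_le (hTp P hPT).1 (hcop P hPF) _ n).trans ?_
        have h4 : ((Fintype.card k : ℝ) ^ n)⁻¹ ≤ c P * (Fintype.card k : ℝ) ^ D := by
          rw [hc]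
          dsimp only
          rw [inv_mul_eq_div, inv_eq_one_div, div_le_div_iff₀ (by positivity) (by positivity),
            one_mul, ← pow_add, add_comm]
          exact pow_le_pow_right₀ (by linarith [two_le_card (k := k)]) hPdeg
        rw [mul_add, mul_one]
        exact add_le_add le_rfl h4
      refine (Finset.sum_le_sum h3).trans ?_
      rw [← Finset.sum_mul]
      have h5 := hs' (F.filter (fun P => ¬ P.natDegree ≤ n))
        (fun P hP => (Finset.mem_filter.1 (Finset.mem_filter.1 hP).1).2.1) (by
          rw [Finset.disjoint_left]
          intro P hP hPs
          exact (Finset.mem_filter.1 hP).2 (hn.2 P hPs))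
      calc _ ≤ 1 / (4 * (1 + (Fintype.card k : ℝ) ^ D)) * (1 + (Fintype.card k : ℝ) ^ D) := by
            gcongr
        _ = 1 / 4 := by
            have : (1 + (Fintype.card k : ℝ) ^ D) ≠ 0 := by positivity
            field_simp
    linarith
  rw [← mean_sum] at hmean
  obtain ⟨y, hy, hy'⟩ := exists_le_of_mean_le hmean
  have hXy : (X ^ n + y).Monic := monic_X_pow_add_of_mem hy
  have hXyd : (X ^ n + y).natDegree = n := natDegree_X_pow_add_of_mem hy
  have hNeq : A' + R' * X ^ n + R' * y = R' * (X ^ n + y) + A' := by ring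
  rw [hNeq] at hy'
  have hdeg : (R' * (X ^ n + y)).natDegree = D + n := by
    rw [hR'm.natDegree_mul hXy, hXyd]
  have hdegA : A'.degree < (R' * (X ^ n + y)).degree := by
    rw [degree_eq_natDegree (hR'm.mul hXy).ne_zero, hdeg]
    refine degree_le_natDegree.trans_lt ?_
    norm_cast
    omega
  have hNm : (R' * (X ^ n + y) + A').Monic := (hR'm.mul hXy).add_of_left hdegA
  refine ⟨_, hNm, ?_, ?_⟩
  · have h1 : R' * (X ^ n + y) + A' - A = R * (M * (X ^ n + y) + u - u * A) := by
      have : v * M = 1 - u * R := by rw [← huv]; ring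
      rw [hA', this, hR']; ring
    exact ⟨_, h1⟩
  · intro P hP hPN
    have hPi := (hTp P hP).2
    by_cases h : P ∣ R'
    · have h1 : P ∣ A' := (dvd_add_right (h.mul_right _)).1 hPN
      rcases hPi.prime.dvd_or_dvd h with h2 | h2
      · have h3 : P ∣ A := by
          have : A = A' + R * (u * A - u) := by
            have : v * M = 1 - u * R := by rw [← huv]; ring
            rw [hA', this]; ring
          rw [this]; exact dvd_add h1 (h2.mul_right _)
        exact hPi.not_isUnit (hAR.isUnit_of_dvd' h3 h2)
      · have h3 : P ∣ 1 := by
          have : (1 : k[X]) = A' + M * (v - A * v) := by rw [hA', ← huv]; ring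
          rw [this]; exact dvd_add h1 (h2.mul_right _)
        exact hPi.not_isUnit (isUnit_of_dvd_one h3)
    · have hPF : P ∈ F := by
        refine Finset.mem_filter.2 ⟨?_, hP, h⟩
        have h1 := natDegree_le_of_dvd hPN hNm.ne_zero
        rw [natDegree_add_eq_left_of_degree_lt hdegA, hdeg] at h1
        rw [mem_polysLT, degree_eq_natDegree (hTp P hP).1.ne_zero]
        norm_cast
        omega
      have h1 := Finset.single_le_sum (f := fun P => ind ℝ P (R' * (X ^ n + y) + A'))
        (fun P _ => ind_nonneg _ _) hPF
      simp only [ind_of_dvd hPN] at h1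
      linarith

end ThinSieve

section Closure

lemma mean_moveDefect {W : k[X]} (hW : W.Monic) (e A : k[X]) {n : ℕ} (hn : W.natDegree ≤ n) :
    mean n (fun ν => moveDefect W e (ν + A)) = mean W.natDegree (moveDefect W e) := by
  rw [← mean_affine hW isCoprime_one_right (moveDefect_periodic W e) A hn]
  simp only [one_mul, add_comm]

lemma isNear_zero (L : k[X]) : IsNear L 0 0 := fun ε hε =>
  ⟨1, monic_one, isCoprime_one_left, by
    have : ∀ ν : k[X], moveDefect 1 0 ν = 0 := fun ν => moveDefect_of_rel (by
      rw [add_zero]; exact MoveRel.refl _ _)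
    simp only [funext this, mean_const]
    linarith⟩

lemma isNear_one (L : k[X]) : IsNear L 1 0 := fun ε hε =>
  ⟨1, monic_one, isCoprime_one_left, by
    have : ∀ ν : k[X], moveDefect 1 1 ν = 0 := fun ν => moveDefect_of_rel
      (Relation.EqvGen.rel _ _ ⟨1, dvd_rfl, one_dvd _, rfl⟩)
    simp only [funext this, mean_const]
    linarith⟩

lemma IsNear.mono {L e : k[X]} {b b' : ℝ} (h : IsNear L e b) (hb : b ≤ b') : IsNear L e b' :=
  fun ε hε => by
    obtain ⟨W, h1, h2, h3⟩ := h ε hε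
    exact ⟨W, h1, h2, by linarith⟩

lemma IsNear.sub {L e e' : k[X]} (h : IsNear L e 0) (h' : IsNear L e' 0) :
    IsNear L (e - e') 0 := by
  intro ε hε
  obtain ⟨W, h1, h2, h3⟩ := h (ε / 2) (by positivity)
  obtain ⟨W', h1', h2', h3'⟩ := h' (ε / 2) (by positivity)
  refine ⟨W * W', h1.mul h1', h2.mul_left h2', ?_⟩
  have hdeg := h1.natDegree_mul h1'
  set n := (W * W').natDegree
  calc mean n (moveDefect (W * W') (e - e'))
      ≤ mean n (fun ν => moveDefect W e (ν + 0) + moveDefect W' e' (ν + (e - e'))) := by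
        refine mean_mono fun ν _ => ?_
        rw [add_zero]
        by_cases hr : MoveRel W ν (ν + e)
        · by_cases hr' : MoveRel W' (ν + (e - e')) (ν + (e - e') + e')
          · rw [moveDefect_of_rel]
            · exact add_nonneg (moveDefect_nonneg _ _ _) (moveDefect_nonneg _ _ _)
            · refine (hr.mono (dvd_mul_right W W')).trans ?_
              rw [show ν + (e - e') + e' = ν + e by ring] at hr'
              exact hr'.symm.mono (dvd_mul_left W' W)
          · rw [moveDefect_of_not_rel hr']
            linarith [moveDefect_le_one (W * W') (e - e') ν, moveDefect_nonneg W e ν]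
        · rw [moveDefect_of_not_rel hr]
          linarith [moveDefect_le_one (W * W') (e - e') ν, moveDefect_nonneg W' e' (ν + (e - e'))]
    _ = mean W.natDegree (moveDefect W e) + mean W'.natDegree (moveDefect W' e') := by
        rw [mean_add, mean_moveDefect h1 _ _ (by omega), mean_moveDefect h1' _ _ (by omega)]
    _ ≤ 0 + ε := by linarith

lemma finite_monic_dvd {L : k[X]} (hL : L ≠ 0) : {P : k[X] | P.Monic ∧ P ∣ L}.Finite := by
  refine (polysLT k (L.natDegree + 1)).finite_toSet.subset ?_
  rintro P ⟨h1, h2⟩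
  rw [Finset.mem_coe, mem_polysLT, degree_eq_natDegree h1.ne_zero]
  have := natDegree_le_of_dvd h2 hL
  norm_cast
  omega

/-- Every residue class modulo a prime `x` that is coprime to `x` contains displacements that are
almost always possible. -/
lemma exists_isNear_of_not_dvd {L x : k[X]} (hL : L ≠ 0) (hx : x.Monic) (hxi : Irreducible x)
    {u : k[X]} (hu : ¬ x ∣ u) {ε : ℝ} (hε : 0 < ε) :
    ∃ N : k[X], x ∣ N - u ∧ IsNear L N ε := by
  classical
  set cls : k[X] → Set k[X] := fun b =>
    {P | P.Monic ∧ Irreducible P ∧ ¬ P ∣ L ∧ x ∣ P - b} with hcls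
  have hcls_congr : ∀ b b', x ∣ b - b' → cls b ⊆ cls b' := by
    rintro b b' h P ⟨h1, h2, h3, h4⟩
    refine ⟨h1, h2, h3, ?_⟩
    rw [← sub_add_sub_cancel P b b']
    exact dvd_add h4 h
  set T : Set k[X] := {P | P.Monic ∧ Irreducible P ∧ (P ∣ L ∨ IsThin (cls P))} with hT
  have hTthin : IsThin T := by
    refine IsThin.mono (T' := {P : k[X] | P.Monic ∧ P ∣ L} ∪
      ⋃ b ∈ (polysLT k x.natDegree).filter fun b => IsThin (cls b), cls b) ?_ ?_
    · rintro P ⟨h1, h2, h3⟩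
      by_cases h4 : P ∣ L
      · exact Or.inl ⟨h1, h4⟩
      · right
        have h5 := h3.resolve_left h4
        have h6 : x ∣ P - P %ₘ x := ⟨P /ₘ x, by
          rw [sub_eq_iff_eq_add, add_comm (x * _)]; exact (modByMonic_add_div P x).symm⟩
        have h7 : P %ₘ x ∈ polysLT k x.natDegree := by
          rw [mem_polysLT, ← degree_eq_natDegree hx.ne_zero]
          exact degree_modByMonic_lt P hx
        refine Set.mem_biUnion (Finset.mem_filter.2 ⟨h7, h5.mono (hcls_congr _ _ ?_)⟩)
          ⟨h1, h2, h4, h6⟩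
        rw [← neg_sub]; exact (dvd_neg.2 h6)
    · exact (isThin_of_finite (finite_monic_dvd hL)).union
        (isThin_biUnion _ _ fun b hb => (Finset.mem_filter.1 hb).2)
  obtain ⟨N, hN, hNu, hNT⟩ := exists_monic_forall_not_dvd hx
    ((hxi.coprime_iff_not_dvd.2 hu).symm) hTthin fun P hP => ⟨hP.1, hP.2.1⟩
  set cl : k[X] → Prop := fun h => ∀ ε : ℝ, 0 < ε → ∃ N, x ∣ N - h ∧ IsNear L N ε with hcl
  have key : ∀ d : ℕ, ∀ N : k[X], N.natDegree ≤ d → N.Monic → (∀ P ∈ T, ¬ P ∣ N) → cl N := by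
    intro d
    induction d with
    | zero =>
      intro N hNd hN _ ε hε
      rw [hN.natDegree_eq_zero.1 (by omega)]
      exact ⟨1, by simp, (isNear_one L).mono hε.le⟩
    | succ d ih =>
      intro N hNd hN hNT ε hε
      by_cases h1 : N = 1
      · exact ⟨1, by simp [h1], (isNear_one L).mono hε.le⟩
      obtain ⟨P, hP, hPi, M, rfl⟩ := exists_monic_irreducible_dvd hN h1
      have hM : M.Monic := hP.of_mul_monic_left hN
      have hdeg := hP.natDegree_mul hM
      have hPd : 0 < P.natDegree := hPi.natDegree_pos
      obtain ⟨M', hM', hM'n⟩ := ih M (by omega) hM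
        (fun P' hP' h => hNT P' hP' (h.mul_left P)) (ε / 2) (by positivity)
      have hPT : ¬ P ∈ T := fun h => hNT P h (dvd_mul_right P M)
      have hPc : ¬ IsThin (cls P) := fun h => hPT ⟨hP, hPi, Or.inr h⟩
      have hbad := isThin_not_isNear_mul hM'n (show 0 < ε / 2 by positivity)
      obtain ⟨P', hP', hP'n⟩ : ∃ P' ∈ cls P, IsNear L (P' * M') (ε / 2 + ε / 2) := by
        by_contra! hc
        exact hPc (IsThin.mono (fun P' hP' => show _ ∧ _ from ⟨hP'.1, hP'.2.1, hP'.2.2.1, hc P' hP'⟩) hbad)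
      refine ⟨P' * M', ?_, by simpa using hP'n⟩
      rw [show P' * M' - P * M = (P' - P) * M' + P * (M' - M) by ring]
      exact dvd_add (hP'.2.2.2.mul_right _) (hM'.mul_left _)
  obtain ⟨N', h1, h2⟩ := key N.natDegree N le_rfl hN hNT ε hε
  refine ⟨N', ?_, h2⟩
  rw [← sub_add_sub_cancel N' N u]
  exact dvd_add h1 hNu

lemma mean_ind_mul_moveDefect_le {x W B : k[X]} (hx : x.Monic) (hW : W.Monic) :
    mean (x * W).natDegree (fun ν => ind ℝ x ν * moveDefect (x * W) (x * B) ν) ≤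
      mean W.natDegree (moveDefect W B) := by
  have hq : (1 : ℝ) ≤ Fintype.card k := by linarith [two_le_card (k := k)]
  rw [hx.natDegree_mul hW, add_comm]
  unfold mean
  rw [sum_polysLT_add hx]
  have h1 : ∀ y ∈ polysLT k W.natDegree, ∑ z ∈ polysLT k x.natDegree,
      ind ℝ x (z + x * y) * moveDefect (x * W) (x * B) (z + x * y) ≤ moveDefect W B y := by
    intro y _
    rw [Finset.sum_eq_single 0]
    · rw [zero_add, ind_of_dvd (dvd_mul_right x y), one_mul]
      by_cases h : MoveRel W y (y + B)
      · rw [moveDefect_of_rel h, moveDefect_of_rel]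
        rw [← mul_add]
        exact h.mul_left x
      · rw [moveDefect_of_not_rel h]; exact moveDefect_le_one _ _ _
    · intro z hz hz0
      rw [ind_of_not_dvd, zero_mul]
      rw [dvd_add_left (dvd_mul_right x y)]
      exact fun h => hz0 (eq_zero_of_dvd_of_mem_polysLT hz le_rfl h)
    · intro h; simp at h
  refine (div_le_div_of_nonneg_right (Finset.sum_le_sum h1) (by positivity)).trans ?_
  refine div_le_div_of_nonneg_left (Finset.sum_nonneg fun _ _ => moveDefect_nonneg _ _ _)
    (by positivity) (pow_le_pow_right₀ hq (by omega))

lemma IsNear.mul_irreducible {L x B : k[X]} (hL : L ≠ 0) (hx : x.Monic) (hxi : Irreducible x)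
    (hxL : ¬ x ∣ L) (hB : IsNear L B 0) : IsNear L (x * B) 0 := by
  classical
  intro ε hε
  have hq : (0 : ℝ) < Fintype.card k := by exact_mod_cast Fintype.card_pos
  set s := polysLT k x.natDegree with hs
  have hscard : (0 : ℝ) < s.card := by
    rw [hs, card_polysLT]; push_cast; positivity
  set ε' := ε / (5 * s.card) with hε'
  have hε'0 : 0 < ε' := by positivity
  have hN : ∀ u ∈ s, ∃ N W : k[X], x ∣ N + u ∧ W.Monic ∧ IsCoprime W L ∧
      mean W.natDegree (moveDefect W N) ≤ 2 * ε' := by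
    intro u hu
    by_cases h : x ∣ u
    · obtain ⟨W, h1, h2, h3⟩ := isNear_zero L ε' hε'0
      exact ⟨0, W, by simpa using h, h1, h2, by linarith⟩
    · obtain ⟨N, h1, h2⟩ := exists_isNear_of_not_dvd hL hx hxi (u := -u) (by simpa using h) hε'0
      obtain ⟨W, h3, h4, h5⟩ := h2 ε' hε'0
      exact ⟨N, W, by simpa using h1, h3, h4, by linarith⟩
  choose! N W hxN hWm hWL hWN using hN
  obtain ⟨WB, hWBm, hWBL, hWB⟩ := hB ε' hε'0
  set V := x * WB with hV
  have hVm : V.Monic := hx.mul hWBm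
  have hVL : IsCoprime V L := (hxi.coprime_iff_not_dvd.2 hxL).mul_left hWBL
  have hPm : (∏ u ∈ s, W u).Monic := monic_prod_of_monic _ _ hWm
  refine ⟨V * ∏ u ∈ s, W u, hVm.mul hPm, hVL.mul_left (IsCoprime.prod_left hWL), ?_⟩
  have hdeg := hVm.natDegree_mul hPm
  rw [natDegree_prod_of_monic _ _ hWm] at hdeg
  set R := V * ∏ u ∈ s, W u with hR
  have hWdeg : ∀ u ∈ s, (W u).natDegree ≤ R.natDegree := fun u hu => by
    have := Finset.single_le_sum (f := fun u => (W u).natDegree) (fun _ _ => Nat.zero_le _) hu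
    omega
  have hWR : ∀ u ∈ s, W u ∣ R := fun u hu => (Finset.dvd_prod_of_mem W hu).mul_left V
  have hVR : V ∣ R := dvd_mul_right _ _
  set D : k[X] → ℝ := fun ν => ind ℝ x ν * moveDefect V (x * B) ν with hD
  have hDper : PeriodicMod V D := fun a y => by
    simp only [hD, (ind_periodic ℝ x).of_dvd (dvd_mul_right x WB) a y, hV]
    rw [← hV, moveDefect_periodic V (x * B) a y]
  have hD0 : ∀ ν, 0 ≤ D ν := fun ν => mul_nonneg (ind_nonneg _ _) (moveDefect_nonneg _ _ _)
  have hpt : ∀ ν ∈ polysLT k R.natDegree, moveDefect R (x * B) ν ≤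
      ∑ u ∈ s, (moveDefect (W u) (N u) (ν + 0) + moveDefect (W u) (N u) (ν + x * B) +
        D (N u + 1 * ν)) := by
    intro ν _
    set u := ν %ₘ x with hu
    have hus : u ∈ s := by
      rw [hs, mem_polysLT, ← degree_eq_natDegree hx.ne_zero]
      exact degree_modByMonic_lt ν hx
    have hxν : x ∣ N u + 1 * ν := by
      have h1 : N u + 1 * ν = (N u + u) + x * (ν /ₘ x) := by
        have := modByMonic_add_div ν x
        rw [← hu] at this
        conv_lhs => rw [← this]
        ring
      rw [h1]
      exact dvd_add (hxN u hus) (dvd_mul_right _ _)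
    refine le_trans ?_ (Finset.single_le_sum (f := fun u => moveDefect (W u) (N u) (ν + 0) +
      moveDefect (W u) (N u) (ν + x * B) + D (N u + 1 * ν)) (fun u _ => ?_) hus)
    swap
    · have := moveDefect_nonneg (W u) (N u) (ν + 0)
      have := moveDefect_nonneg (W u) (N u) (ν + x * B)
      have := hD0 (N u + 1 * ν)
      positivity
    rw [add_zero]
    have n1 := moveDefect_nonneg (W u) (N u) ν
    have n2 := moveDefect_nonneg (W u) (N u) (ν + x * B)
    have n3 := hD0 (N u + 1 * ν)
    have n4 := moveDefect_le_one R (x * B) ν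
    by_cases h1 : MoveRel (W u) ν (ν + N u)
    swap
    · rw [moveDefect_of_not_rel h1]; linarith
    by_cases h2 : MoveRel (W u) (ν + x * B) (ν + x * B + N u)
    swap
    · rw [moveDefect_of_not_rel h2]; linarith
    by_cases h3 : MoveRel V (N u + 1 * ν) (N u + 1 * ν + x * B)
    swap
    · simp only [hD, moveDefect_of_not_rel h3, ind_of_dvd hxν] at n3 ⊢; linarith
    rw [moveDefect_of_rel]
    · linarith
    · refine (h1.mono (hWR u hus)).trans (MoveRel.trans ?_ (h2.mono (hWR u hus)).symm)
      have := h3.mono hVR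
      rwa [show N u + 1 * ν = ν + N u by ring,
        show ν + N u + x * B = ν + x * B + N u by ring] at this
  refine (mean_mono hpt).trans ?_
  rw [mean_sum, zero_add]
  have hterm : ∀ u ∈ s, mean R.natDegree (fun ν => moveDefect (W u) (N u) (ν + 0) +
      moveDefect (W u) (N u) (ν + x * B) + D (N u + 1 * ν)) ≤ 5 * ε' := by
    intro u hu
    rw [mean_add, mean_add, mean_moveDefect (hWm u hu) _ _ (hWdeg u hu),
      mean_moveDefect (hWm u hu) _ _ (hWdeg u hu),
      mean_affine hVm isCoprime_one_right hDper _ (by omega)]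
    have := mean_ind_mul_moveDefect_le (B := B) hx hWBm
    linarith [hWN u hu]
  refine (Finset.sum_le_sum hterm).trans (le_of_eq ?_)
  rw [Finset.sum_const, nsmul_eq_mul, hε']
  field_simp

lemma isNear_of_isCoprime {L : k[X]} (hL : L ≠ 0) {e : k[X]} (he : e.Monic)
    (heL : IsCoprime e L) : IsNear L e 0 := by
  induction h : e.natDegree using Nat.strong_induction_on generalizing e with
  | _ d ih =>
    by_cases h1 : e = 1
    · rw [h1]; exact isNear_one L
    obtain ⟨P, hP, hPi, M, rfl⟩ := exists_monic_irreducible_dvd he h1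
    have hM : M.Monic := hP.of_mul_monic_left he
    have hdeg := hP.natDegree_mul hM
    have hPd : 0 < P.natDegree := hPi.natDegree_pos
    exact (ih _ (by omega) hM heL.of_mul_left_right rfl).mul_irreducible hL hP hPi
      (hPi.coprime_iff_not_dvd.1 heL.of_mul_left_left)

/-- Almost every `ν` can be moved to `ν + L e` along the divisors of a polynomial coprime to `L`. -/
lemma isNear_mul {L : k[X]} (hL : L.Monic) (e : k[X]) : IsNear L (L * e) 0 := by
  set j := e.natDegree + 1 with hj
  have key : ∀ y ∈ polysLT k j, IsNear L (L * (X ^ j + y) + 1) 0 := by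
    intro y hy
    have hm := hL.mul (monic_X_pow_add_of_mem hy)
    refine isNear_of_isCoprime hL.ne_zero (hm.add_of_left ?_) ⟨1, -(X ^ j + y), by ring⟩
    rw [degree_eq_natDegree hm.ne_zero, hL.natDegree_mul (monic_X_pow_add_of_mem hy),
      natDegree_X_pow_add_of_mem hy, degree_one]
    norm_cast
    omega
  have h0 : (0 : k[X]) ∈ polysLT k j := by simp
  have he : e ∈ polysLT k j := by
    rw [mem_polysLT]
    refine degree_le_natDegree.trans_lt ?_
    norm_cast
    omega
  have := (key e he).sub (key 0 h0)
  rwa [show L * (X ^ j + e) + 1 - (L * (X ^ j + 0) + 1) = L * e by ring] at this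

end Closure

section DirichletCharacters

variable {Q : k[X]} {χ : k[X] → ℂ}

lemma IsDirichletCharacter.map_one (h : IsDirichletCharacter Q χ) : χ 1 = 1 := by
  obtain ⟨M, hM⟩ := h.exists_ne_zero
  have := h.map_mul 1 M
  rw [one_mul] at this
  exact (mul_eq_right₀ hM).1 this.symm

lemma IsDirichletCharacter.ne_zero_of_mul_eq_one (h : IsDirichletCharacter Q χ) {M N : k[X]}
    (hMN : M * N = 1) : χ M ≠ 0 := by
  intro h0
  have := h.map_mul M N
  rw [hMN, h0, zero_mul, h.map_one] at this
  exact one_ne_zero this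

lemma IsDirichletCharacter.C_ne_zero (h : IsDirichletCharacter Q χ) {c : k} (hc : c ≠ 0) :
    χ (C c) ≠ 0 :=
  h.ne_zero_of_mul_eq_one (N := C c⁻¹) (by rw [← C_mul, mul_inv_cancel₀ hc, C_1])

lemma IsDirichletCharacter.add_C_mul (h : IsDirichletCharacter Q χ) (M : k[X]) (c : k) :
    χ (M + C c * Q) = χ M := by
  rcases eq_or_ne c 0 with rfl | hc
  · simp
  have hcc : C c * C c⁻¹ = (1 : k[X]) := by rw [← C_mul, mul_inv_cancel₀ hc, C_1]
  have h1 : M + C c * Q = C c * (C c⁻¹ * M + Q) := by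
    rw [mul_add, ← mul_assoc, hcc, one_mul]
  rw [h1, h.map_mul, h.periodic, ← h.map_mul, ← mul_assoc, hcc, one_mul]

lemma IsDirichletCharacter.comp_ne_zero (h : IsDirichletCharacter Q χ) {F : k[X]}
    (hF : F.coeff 0 ≠ 0) : χ (F.comp Q) ≠ 0 := by
  induction hd : F.natDegree using Nat.strong_induction_on generalizing F with
  | _ d ih =>
    rcases le_or_gt d 1 with hd1 | hd1
    · rw [eq_X_add_C_of_natDegree_le_one (hd.trans_le hd1)]
      simp only [add_comp, mul_comp, C_comp, X_comp]
      rw [add_comm, h.add_C_mul]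
      exact h.C_ne_zero hF
    have hroot : (F + C (-F.eval 1) * X).IsRoot 1 := by simp
    obtain ⟨F₁, hF₁⟩ := dvd_iff_isRoot.2 hroot
    have hlt : (C (-F.eval 1) * X).natDegree < F.natDegree :=
      (natDegree_C_mul_le _ _).trans_lt (by rw [natDegree_X]; omega)
    have hne : F₁ ≠ 0 := by
      rintro rfl
      have := natDegree_add_eq_left_of_natDegree_lt hlt
      rw [hF₁, mul_zero, natDegree_zero] at this
      omega
    have hdeg : F₁.natDegree + 1 = d := by
      rw [← hd, ← natDegree_add_eq_left_of_natDegree_lt hlt, hF₁,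
        (monic_X_sub_C (1 : k)).natDegree_mul' hne, natDegree_X_sub_C, add_comm]
    have hcoeff : F₁.coeff 0 ≠ 0 := by
      intro h0
      have := congrArg (fun G => G.coeff 0) hF₁
      simp [mul_coeff_zero, h0] at this
      exact hF this
    have h1 : F.comp Q = (Q - 1) * F₁.comp Q + C (F.eval 1) * Q := by
      have := congrArg (fun G => G.comp Q) hF₁
      simp only [add_comp, mul_comp, C_comp, neg_comp, X_comp, sub_comp, C_neg, C_1,
        one_comp] at this
      rw [← this]; ring
    have h2 : χ (Q - 1) ≠ 0 := by
      rw [sub_eq_neg_add, h.periodic]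
      exact h.ne_zero_of_mul_eq_one (N := -1) (by ring)
    rw [h1, h.add_C_mul, h.map_mul]
    exact mul_ne_zero h2 (ih _ (by omega) hcoeff rfl)

lemma IsDirichletCharacter.eq_one_of_isUnit (h : IsDirichletCharacter 1 χ) (M : k[X]) :
    χ M = 1 := by
  have h0 : χ 0 = 1 := by rw [← h.periodic, zero_add, h.map_one]
  have := h.map_mul 0 M
  rwa [zero_mul, h0, one_mul, eq_comm] at this

lemma exists_pow_modEq_one {N : k[X]} (hN : N ≠ 0) (hNQ : IsCoprime N Q) :
    ∃ m, 0 < m ∧ N ∣ Q ^ m - 1 := by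
  have hfin : Finite (k[X] ⧸ Ideal.span {N}) := by
    have : Finite (polysLT k N.natDegree) := inferInstance
    refine Finite.of_surjective
      (fun x : polysLT k N.natDegree => Ideal.Quotient.mk (Ideal.span {N}) x) fun y => ?_
    obtain ⟨y, rfl⟩ := Ideal.Quotient.mk_surjective y
    refine ⟨⟨y % N, ?_⟩, ?_⟩
    · rw [mem_polysLT, ← degree_eq_natDegree hN]
      exact EuclideanDomain.mod_lt y hN
    · rw [Ideal.Quotient.eq, Ideal.mem_span_singleton]
      refine ⟨-(y / N), ?_⟩
      have := EuclideanDomain.div_add_mod y N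
      linear_combination this
  obtain ⟨u, v, huv⟩ := hNQ
  have hunit : IsUnit (Ideal.Quotient.mk (Ideal.span {N}) Q) := by
    refine IsUnit.of_mul_eq_one (Ideal.Quotient.mk _ v) ?_
    rw [← map_mul, ← map_one (Ideal.Quotient.mk (Ideal.span {N})), Ideal.Quotient.eq,
      Ideal.mem_span_singleton]
    exact ⟨-u, by linear_combination huv⟩
  obtain ⟨w, hw⟩ := hunit
  refine ⟨orderOf w, orderOf_pos w, ?_⟩
  rw [← Ideal.mem_span_singleton, ← Ideal.Quotient.eq, map_pow, ← hw, map_one]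
  rw [← Units.val_pow_eq_pow_val, pow_orderOf_eq_one, Units.val_one]

/-- A Dirichlet character does not vanish on the polynomials coprime to the modulus. -/
lemma IsDirichletCharacter.ne_zero (h : IsDirichletCharacter Q χ) (hQ : Q.Monic) {N : k[X]}
    (hN : IsCoprime N Q) : χ N ≠ 0 := by
  rcases eq_or_ne N 0 with rfl | hN0
  · have h1 : Q = 1 := hQ.eq_one_of_isUnit (isCoprime_zero_left.1 hN)
    subst h1
    rw [h.eq_one_of_isUnit]; exact one_ne_zero
  obtain ⟨m, hm, M, hM⟩ := exists_pow_modEq_one hN0 hN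
  have h1 : χ ((X ^ m - 1 : k[X]).comp Q) ≠ 0 := h.comp_ne_zero (by
    simp [coeff_X_pow, hm.ne])
  rw [sub_comp, X_pow_comp, one_comp, hM, h.map_mul] at h1
  exact left_ne_zero_of_mul h1

lemma IsDirichletCharacter.map_add_of_moveRel (h : IsDirichletCharacter Q χ) {W ν ν' : k[X]}
    (hr : MoveRel W ν ν') : ∀ N : k[X], W ∣ N - Q * ν → χ (N + Q * (ν' - ν)) = χ N := by
  induction hr with
  | rel a b hab =>
    obtain ⟨d, h1, h2, rfl⟩ := hab
    intro N hN
    have hd : d ∣ N := by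
      rw [← sub_add_cancel N (Q * a)]
      exact dvd_add (h1.trans hN) (h2.mul_left Q)
    obtain ⟨N₁, rfl⟩ := hd
    rw [show d * N₁ + Q * (a + d - a) = d * (N₁ + Q) by ring, h.map_mul, h.periodic, h.map_mul]
  | refl a => intro N _; simp
  | symm a b _ ih =>
    intro N hN
    have := ih (N + Q * (a - b)) (by rwa [show N + Q * (a - b) - Q * a = N - Q * b by ring])
    rw [← this]; ring_nf
  | trans a b c _ _ ih ih' =>
    intro N hN
    rw [← ih N hN, ← ih' (N + Q * (b - a))
      (by rwa [show N + Q * (b - a) - Q * b = N - Q * a by ring])]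
    ring_nf

/-- A bounded Dirichlet character is almost invariant under translation by multiples of `Q L`. -/
lemma IsDirichletCharacter.exists_mean_shift_le (h : IsDirichletCharacter Q χ)
    (hb : ∀ M, ‖χ M‖ ≤ 1) {L : k[X]} (hL : L.Monic) (hQL : Q ∣ L) (e : k[X]) {ε : ℝ}
    (hε : 0 < ε) : ∃ n₀ : ℕ, ∀ n, n₀ ≤ n → ∀ A B : k[X], B ∣ L →
      mean n (fun y => ‖χ (A + B * y + Q * (L * e)) - χ (A + B * y)‖) ≤ ε := by
  obtain ⟨W, hW, hWL, hWe⟩ := isNear_mul hL e (ε / 2) (by positivity)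
  obtain ⟨s, t, hst⟩ := hWL.of_isCoprime_of_dvd_right hQL
  have hWt : IsCoprime W t := ⟨s, Q, by linear_combination hst⟩
  refine ⟨W.natDegree, fun n hn A B hB => ?_⟩
  have hWB : IsCoprime W (t * B) := hWt.mul_right (hWL.of_isCoprime_of_dvd_right hB)
  calc _ ≤ mean n (fun y => 2 * moveDefect W (L * e) (t * A + t * B * y)) := by
        refine mean_mono fun y _ => ?_
        by_cases hr : MoveRel W (t * A + t * B * y) (t * A + t * B * y + L * e)
        · have h1 := h.map_add_of_moveRel hr (A + B * y) (by
            refine ⟨s * (A + B * y), ?_⟩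
            linear_combination (-(A + B * y)) * hst)
          rw [add_sub_cancel_left] at h1
          rw [h1, sub_self, norm_zero]
          exact mul_nonneg zero_le_two (moveDefect_nonneg _ _ _)
        · rw [moveDefect_of_not_rel hr]
          refine (norm_sub_le _ _).trans ?_
          linarith [hb (A + B * y + Q * (L * e)), hb (A + B * y)]
    _ = 2 * mean W.natDegree (moveDefect W (L * e)) := by
        rw [mean_const_mul, mean_affine hW hWB (moveDefect_periodic W _) _ hn]
    _ ≤ ε := by linarith

end DirichletCharacters

section PrimeCounting

lemma sum_range_card_pow_le (m : ℕ) :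
    ∑ d ∈ Finset.range (m + 1), Fintype.card k ^ d ≤ 2 * Fintype.card k ^ m := by
  have h1 : 2 ≤ Fintype.card k := Fintype.one_lt_card
  induction m with
  | zero => simp
  | succ m ih =>
    rw [Finset.sum_range_succ]
    have : 2 * Fintype.card k ^ m ≤ Fintype.card k ^ (m + 1) := by
      rw [pow_succ']; gcongr
    omega

lemma sum_natDegree_primesIoc_le (m : ℕ) :
    ∑ P ∈ primesIoc k 0 m, P.natDegree ≤ 2 * Fintype.card k ^ m := by
  classical
  refine le_trans ?_ (sum_range_card_pow_le m)
  have hmap : ∀ P ∈ primesIoc k 0 m, P.natDegree ∈ Finset.range (m + 1) := fun P hP => by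
    have := (mem_primesIoc.1 hP).2.2.2
    rw [Finset.mem_range]; omega
  rw [← Finset.sum_fiberwise_of_maps_to hmap]
  refine Finset.sum_le_sum fun d _ => ?_
  rcases eq_or_ne d 0 with rfl | hd
  · refine (Finset.sum_eq_zero fun P hP => (Finset.mem_filter.1 hP).2).le.trans (Nat.zero_le _)
  refine le_trans (le_of_eq ?_) (card_irreducible_mul_le hd
    (s := (primesIoc k 0 m).filter fun P => P.natDegree = d) fun P hP => ?_)
  · rw [Finset.sum_congr rfl fun P hP => (Finset.mem_filter.1 hP).2, Finset.sum_const,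
      smul_eq_mul]
  · have h := Finset.mem_filter.1 hP
    exact ⟨(mem_primesIoc.1 h.1).1, (mem_primesIoc.1 h.1).2.1, h.2⟩

/-- A lower bound for the number of monic irreducible polynomials of degree `n`. -/
lemma card_pow_le_card_primesIoc {n : ℕ} (hn : 3 ≤ n) :
    Fintype.card k ^ n ≤ 2 * n * (primesIoc k (n - 1) n).card := by
  classical
  have hq : 2 ≤ Fintype.card k := Fintype.one_lt_card
  set E : k[X] := X ^ Fintype.card k ^ n - X with hEdef
  have hpow : 1 < Fintype.card k ^ n := Nat.one_lt_pow (by omega) hq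
  have hE : E.Monic := monic_X_pow_sub (by rw [degree_X]; exact_mod_cast hpow)
  have hdeg : E.natDegree = Fintype.card k ^ n :=
    FiniteField.X_pow_card_pow_sub_X_natDegree_eq _ (by omega) hq
  have hsep : E.Separable := by
    obtain ⟨p, hp⟩ := CharP.exists k
    refine galois_poly_separable p _ (dvd_pow ?_ (by omega))
    obtain ⟨m, _, hm⟩ := FiniteField.card k p
    rw [hm]
    exact dvd_pow_self p m.ne_zero
  have hdvd : ∀ P : k[X], Irreducible P → P ∣ E → P.natDegree ∣ n := fun P hP h =>
    hP.natDegree_dvd_of_dvd_X_pow_card_pow_sub_X (by rwa [Nat.card_eq_fintype_card])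
  have hprod := eq_prod_primes_of_squarefree hE (w := 0) le_rfl
    (fun P _ hP _ => hP.natDegree_pos) (fun P hP h => by
      have hP := (mem_primesIoc.1 hP).2.1
      exact hP.not_isUnit (hsep.squarefree P (by rwa [← sq])))
  have h1 : Fintype.card k ^ n = ∑ P ∈ (primesIoc k 0 E.natDegree).filter (· ∣ E), P.natDegree := by
    conv_lhs => rw [← hdeg, hprod]
    rw [natDegree_prod_of_monic]
    exact fun P hP => (mem_primesIoc.1 (Finset.mem_filter.1 hP).1).1
  have hsub : (primesIoc k 0 E.natDegree).filter (· ∣ E) ⊆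
      primesIoc k 0 (n / 2) ∪ primesIoc k (n - 1) n := by
    intro P hP
    obtain ⟨hP, hPE⟩ := Finset.mem_filter.1 hP
    rw [mem_primesIoc] at hP
    have hd := hdvd P hP.2.1 hPE
    rw [Finset.mem_union, mem_primesIoc, mem_primesIoc]
    obtain ⟨c, hc⟩ := hd
    have hc0 : c ≠ 0 := by rintro rfl; omega
    rcases eq_or_ne c 1 with rfl | hc1
    · exact Or.inr ⟨hP.1, hP.2.1, by omega, by omega⟩
    · refine Or.inl ⟨hP.1, hP.2.1, hP.2.2.1, ?_⟩
      rw [Nat.le_div_iff_mul_le two_pos, hc]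
      exact Nat.mul_le_mul_left _ (by omega)
  have h2 : Fintype.card k ^ n ≤ 2 * Fintype.card k ^ (n / 2) +
      n * (primesIoc k (n - 1) n).card := by
    rw [h1]
    refine (Finset.sum_le_sum_of_subset hsub).trans
      ((Nat.le_add_right _ _).trans (Finset.sum_union_inter.le.trans ?_))
    refine add_le_add (sum_natDegree_primesIoc_le _) ?_
    rw [mul_comm, ← smul_eq_mul]
    exact Finset.sum_le_card_nsmul _ _ _ fun P hP => (mem_primesIoc.1 hP).2.2.2
  have h3 : 4 * Fintype.card k ^ (n / 2) ≤ Fintype.card k ^ n := by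
    calc 4 * Fintype.card k ^ (n / 2) ≤ Fintype.card k ^ 2 * Fintype.card k ^ (n / 2) := by
          gcongr; nlinarith
      _ = Fintype.card k ^ (2 + n / 2) := (pow_add _ _ _).symm
      _ ≤ _ := Nat.pow_le_pow_right (by omega) (by omega)
  nlinarith

end PrimeCounting

section Bessel

/-- The mean of `g` over the residue class of `u` modulo `P`. -/
def classMean (n : ℕ) (g : k[X] → ℂ) (P u : k[X]) : ℂ :=
  (Fintype.card k : ℂ) ^ P.natDegree * mean n (fun x => ind ℂ P (x - u) * g x)

lemma classMean_periodic (n : ℕ) (g : k[X] → ℂ) (P : k[X]) : PeriodicMod P (classMean n g P) := by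
  intro x y
  have h : ∀ z, ind ℂ P (z - (x + P * y)) = ind ℂ P (z - x) := fun z => by
    rw [← ind_periodic ℂ P (z - (x + P * y)) y]; ring_nf
  simp only [classMean, h]

lemma sum_mul_ind {K : Type*} [Field K] {P : k[X]} (hP : P.Monic) {a : k[X] → K}
    (ha : PeriodicMod P a) (x : k[X]) :
    ∑ u ∈ polysLT k P.natDegree, a u * ind K P (x - u) = a x := by
  have hmem : x %ₘ P ∈ polysLT k P.natDegree := by
    rw [mem_polysLT, ← degree_eq_natDegree hP.ne_zero]
    exact degree_modByMonic_lt x hP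
  have hdvd : P ∣ x - x %ₘ P := ⟨x /ₘ P, by rw [sub_eq_iff_eq_add', modByMonic_add_div]⟩
  rw [Finset.sum_eq_single (x %ₘ P)]
  · rw [ind_of_dvd hdvd, mul_one, ha.eq_of_dvd_sub hdvd]
  · intro u hu hne
    rw [ind_of_not_dvd, mul_zero]
    intro h
    refine hne (sub_eq_zero.1 (eq_zero_of_dvd_of_mem_polysLT (sub_mem_polysLT hu hmem) le_rfl ?_))
    rw [show u - x %ₘ P = (x - x %ₘ P) - (x - u) by ring]
    exact dvd_sub hdvd h
  · exact fun h => absurd hmem h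

lemma mean_mul_periodic (n : ℕ) (g : k[X] → ℂ) {P : k[X]} (hP : P.Monic) {a : k[X] → ℂ}
    (ha : PeriodicMod P a) :
    mean n (fun x => g x * a x) = mean P.natDegree (fun u => a u * classMean n g P u) := by
  have hq : (Fintype.card k : ℂ) ≠ 0 := card_cast_ne_zero
  have h1 : ∀ u, a u * classMean n g P u = (Fintype.card k : ℂ) ^ P.natDegree *
      mean n (fun x => g x * (a u * ind ℂ P (x - u))) := fun u => by
    unfold classMean
    rw [mul_left_comm, ← mean_const_mul]
    congr 2
    ext x
    ring
  simp only [h1]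
  rw [mean_const_mul]
  conv_rhs => rw [mean, ← mean_sum]
  simp only [← Finset.mul_sum, sum_mul_ind hP ha]
  field_simp

lemma mean_classMean_sub (n : ℕ) (g : k[X] → ℂ) {P : k[X]} (hP : P.Monic) :
    mean P.natDegree (fun u => classMean n g P u - mean n g) = 0 := by
  have h := mean_mul_periodic n g hP (a := fun _ => 1) (fun _ _ => rfl)
  simp only [mul_one, one_mul] at h
  rw [mean_sub, ← h, mean_const, sub_self]

lemma conj_mean (n : ℕ) (a : k[X] → ℂ) : conj (mean n a) = mean n (fun x => conj (a x)) := by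
  simp [mean]

/-- Bessel's inequality for the deviations of a function in residue classes. -/
lemma sum_mean_norm_sq_classMean_le (n : ℕ) (g : k[X] → ℂ) {T : Finset k[X]} {γ : ℕ}
    (hT : ∀ P ∈ T, P.Monic ∧ P.natDegree = γ)
    (hco : ∀ P ∈ T, ∀ P' ∈ T, P ≠ P' → IsCoprime P P') (hγ : 2 * γ ≤ n) :
    ∑ P ∈ T, mean γ (fun u => ‖classMean n g P u - mean n g‖ ^ 2) ≤
      mean n (fun x => ‖g x‖ ^ 2) := by
  set Y : k[X] → k[X] → ℂ := fun P u => classMean n g P u - mean n g with hY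
  have hper : ∀ P, PeriodicMod P (Y P) := fun P x y => by
    simp only [hY, classMean_periodic n g P x y]
  have hperc : ∀ P, PeriodicMod P (fun u => conj (Y P u)) := fun P x y => by
    simp only [hper P x y]
  have hmean : ∀ P ∈ T, mean n (Y P) = 0 := fun P hP => by
    rw [mean_periodic (hT P hP).1 (hper P) (by rw [(hT P hP).2]; omega)]
    exact mean_classMean_sub n g (hT P hP).1
  have horth : ∀ P ∈ T, ∀ P' ∈ T, P ≠ P' → mean n (fun x => Y P x * conj (Y P' x)) = 0 :=
    fun P hP P' hP' hne => by
      rw [mean_mul (hT P hP).1 (hT P' hP').1 (hco P hP P' hP' hne) (hper P) (hperc P')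
        (by rw [(hT P hP).2, (hT P' hP').2]; omega), hmean P hP, zero_mul]
  have hinner : ∀ P ∈ T, mean n (fun x => g x * conj (Y P x)) =
      ((mean γ (fun u => ‖Y P u‖ ^ 2) : ℝ) : ℂ) := fun P hP => by
    rw [mean_mul_periodic n g (hT P hP).1 (hperc P), ofReal_mean, (hT P hP).2]
    have h0 : mean γ (fun u => conj (Y P u) * mean n g) = 0 := by
      have h := mean_classMean_sub n g (hT P hP).1
      rw [(hT P hP).2] at h
      have h1 := mean_const_mul γ (mean n g) (fun u => conj (Y P u))
      rw [← conj_mean, h, map_zero, mul_zero] at h1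
      simpa only [mul_comm] using h1
    rw [← sub_zero (mean γ _), ← h0, ← mean_sub]
    congr 1
    ext u
    rw [← mul_sub, Complex.ofReal_pow, ← Complex.mul_conj', mul_comm]
  have hsq := mean_norm_sq_sum_of_orthogonal T n (fun _ => 1) Y horth
  simp only [one_mul, norm_one, one_pow] at hsq
  have hnn : 0 ≤ mean n (fun x => ‖g x - ∑ P ∈ T, Y P x‖ ^ 2) := mean_nonneg fun x => by positivity
  have hexp : mean n (fun x => ‖g x - ∑ P ∈ T, Y P x‖ ^ 2) = mean n (fun x => ‖g x‖ ^ 2) -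
      2 * ∑ P ∈ T, mean γ (fun u => ‖Y P u‖ ^ 2) +
      mean n (fun x => ‖∑ P ∈ T, Y P x‖ ^ 2) := by
    have h1 : ∑ P ∈ T, mean γ (fun u => ‖Y P u‖ ^ 2) =
        mean n (fun x => (g x * conj (∑ P ∈ T, Y P x)).re) := by
      have h2 : mean n (fun x => g x * conj (∑ P ∈ T, Y P x)) =
          ((∑ P ∈ T, mean γ (fun u => ‖Y P u‖ ^ 2) : ℝ) : ℂ) := by
        simp only [map_sum, Finset.mul_sum]
        rw [mean_sum, Finset.sum_congr rfl hinner]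
        push_cast
        rfl
      have h3 : mean n (fun x => (g x * conj (∑ P ∈ T, Y P x)).re) =
          (mean n (fun x => g x * conj (∑ P ∈ T, Y P x))).re := by
        unfold mean
        rw [← Complex.re_sum]
        norm_cast
        rw [Complex.div_natCast_re]
      rw [h3, h2, Complex.ofReal_re]
    rw [h1, ← mean_const_mul, ← mean_sub, ← mean_add]
    congr 1
    ext x
    rw [← Complex.normSq_eq_norm_sq, ← Complex.normSq_eq_norm_sq, ← Complex.normSq_eq_norm_sq,
      Complex.normSq_sub]
    ring
  have hper2 : ∀ P ∈ T, mean n (fun x => ‖Y P x‖ ^ 2) = mean γ (fun u => ‖Y P u‖ ^ 2) :=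
    fun P hP => by
      rw [mean_periodic (hT P hP).1 (fun x y => by simp only [hper P x y])
        (by rw [(hT P hP).2]; omega), (hT P hP).2]
  rw [Finset.sum_congr rfl hper2] at hsq
  rw [hexp, hsq] at hnn
  linarith

end Bessel

section MeanValueStability

variable {Q : k[X]} {h : k[X] → ℂ}

lemma mean_translate {K : Type*} [Field K] {n : ℕ} {r : k[X]} (hr : r ∈ polysLT k n)
    (a : k[X] → K) : mean n (fun x => a (x + r)) = mean n a := by
  unfold mean
  congr 1
  have hr' : -r ∈ polysLT k n := by simpa using hr
  refine Finset.sum_bij' (fun x _ => x + r) (fun x _ => x - r) (fun x hx => ?_) (fun x hx => ?_)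
    (by simp) (by simp) (by simp)
  · rw [show x + r = x - -r by ring]
    exact sub_mem_polysLT hx hr'
  · exact sub_mem_polysLT hx hr

lemma mean_ind_mul {K : Type*} [Field K] [CharZero K] {n : ℕ} {P : k[X]} (hP : P.Monic)
    (hn : P.natDegree ≤ n) (a : k[X] → K) :
    (Fintype.card k : K) ^ P.natDegree * mean n (fun x => ind K P x * a x) =
      mean (n - P.natDegree) (fun z => a (P * z)) := by
  obtain ⟨m, rfl⟩ := Nat.exists_eq_add_of_le' hn
  have hq : (Fintype.card k : K) ≠ 0 := card_cast_ne_zero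
  unfold mean
  rw [sum_polysLT_add hP, Nat.add_sub_cancel]
  have h1 : ∀ y, ∑ z ∈ polysLT k P.natDegree, ind K P (z + P * y) * a (z + P * y) = a (P * y) := by
    intro y
    rw [Finset.sum_eq_single 0]
    · simp [ind]
    · intro z hz hz0
      rw [ind_of_not_dvd, zero_mul]
      intro hd
      exact hz0 (eq_zero_of_dvd_of_mem_polysLT hz le_rfl
        ((dvd_add_left (dvd_mul_right P y)).1 hd))
    · simp
  simp only [h1]
  rw [pow_add]
  field_simp

/-- The mean of `h` over the monic polynomials of degree `n`. -/
def monicMean (h : k[X] → ℂ) (n : ℕ) : ℂ := mean n (fun x => h (X ^ n + x))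

lemma classMean_eq {n : ℕ} {P u : k[X]} (hP : P.Monic) (hn : P.natDegree ≤ n)
    (hu : u ∈ polysLT k n) (h : k[X] → ℂ) :
    classMean n (fun x => h (X ^ n + x)) P (u - X ^ n) =
      mean (n - P.natDegree) (fun z => h (u + P * (X ^ (n - P.natDegree) + z))) := by
  set m := n - P.natDegree with hm
  have hdeg : (P * X ^ m).natDegree = n := by
    rw [hP.natDegree_mul (monic_X_pow m), natDegree_X_pow]; omega
  have hmem : u + P * X ^ m - X ^ n ∈ polysLT k n := by
    rw [add_sub_assoc, ← sub_neg_eq_add]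
    refine sub_mem_polysLT hu ?_
    rw [mem_polysLT, degree_neg]
    have := degree_sub_lt_left (p := P * X ^ m) (q := X ^ n)
      (by rw [degree_eq_natDegree (hP.mul (monic_X_pow m)).ne_zero, hdeg, degree_X_pow])
      (hP.mul (monic_X_pow m)).ne_zero
      (by rw [(hP.mul (monic_X_pow m)).leadingCoeff, (monic_X_pow n).leadingCoeff])
    rwa [degree_eq_natDegree (hP.mul (monic_X_pow m)).ne_zero, hdeg] at this
  unfold classMean
  rw [← mean_translate hmem]
  have h1 : ∀ x, ind ℂ P (x + (u + P * X ^ m - X ^ n) - (u - X ^ n)) = ind ℂ P x := fun x => by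
    rw [← ind_periodic ℂ P x (X ^ m)]; ring_nf
  simp only [h1]
  rw [mean_ind_mul hP hn (fun x => h (X ^ n + (x + (u + P * X ^ m - X ^ n))))]
  congr 1
  ext z
  congr 1
  ring

lemma sum_inverse_le {P Q' : k[X]} (hP : P.Monic) (hi : Irreducible P) (hPQ : ¬ P ∣ Q')
    {F : k[X] → ℝ} (hF : ∀ x, 0 ≤ F x) (hper : PeriodicMod P F) {m : ℕ} (hm : P.natDegree ≤ m)
    {T : Finset k[X]} (hT : T ⊆ polysLT k m) {w : k[X] → k[X]}
    (hw : ∀ v ∈ T, P ∣ v * w v + Q') :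
    ∑ v ∈ T, F (w v) ≤ (Fintype.card k : ℝ) ^ m * mean P.natDegree F := by
  have hq : (0 : ℝ) < Fintype.card k := by exact_mod_cast Fintype.card_pos
  set a : k[X] → ℝ := fun v => ∑ u ∈ polysLT k P.natDegree, F u * ind ℝ P (Q' + u * v) with ha
  have ha0 : ∀ v, 0 ≤ a v := fun v =>
    Finset.sum_nonneg fun u _ => mul_nonneg (hF u) (ind_nonneg _ _)
  have h1 : ∀ v ∈ T, F (w v) ≤ a v := by
    intro v hv
    have hmem : w v %ₘ P ∈ polysLT k P.natDegree := by
      rw [mem_polysLT, ← degree_eq_natDegree hP.ne_zero]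
      exact degree_modByMonic_lt _ hP
    have hdvd : P ∣ w v - w v %ₘ P := ⟨w v /ₘ P, by rw [sub_eq_iff_eq_add', modByMonic_add_div]⟩
    refine le_trans (le_of_eq ?_) (Finset.single_le_sum
      (f := fun u => F u * ind ℝ P (Q' + u * v))
      (fun u _ => mul_nonneg (hF u) (ind_nonneg _ _)) hmem)
    rw [ind_of_dvd, mul_one, hper.eq_of_dvd_sub hdvd]
    rw [show Q' + w v %ₘ P * v = v * w v + Q' - (w v - w v %ₘ P) * v by ring]
    exact dvd_sub (hw v hv) (hdvd.mul_right v)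
  have h2 : mean m a ≤ mean P.natDegree F := by
    rw [ha, mean_sum]
    unfold mean
    rw [Finset.sum_div]
    refine Finset.sum_le_sum fun u _ => ?_
    change mean m (fun v => F u * ind ℝ P (Q' + u * v)) ≤ _
    rw [mean_const_mul, div_eq_mul_inv]
    refine mul_le_mul_of_nonneg_left ?_ (hF u)
    by_cases hu : P ∣ u
    · have h0 : ∀ v, ind ℝ P (Q' + u * v) = 0 := fun v =>
        ind_of_not_dvd fun hd => hPQ ((dvd_add_left (hu.mul_right v)).1 hd)
      simp only [h0, mean_const]
      positivity
    · exact (mean_ind_affine hP ((hi.coprime_iff_not_dvd).2 hu) Q' hm).le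
  calc ∑ v ∈ T, F (w v) ≤ ∑ v ∈ T, a v := Finset.sum_le_sum h1
    _ ≤ ∑ v ∈ polysLT k m, a v := Finset.sum_le_sum_of_subset_of_nonneg hT fun v _ _ => ha0 v
    _ = (Fintype.card k : ℝ) ^ m * mean m a := by unfold mean; field_simp
    _ ≤ _ := by gcongr

end MeanValueStability

section MeanValueStability

variable {Q : k[X]} {h : k[X] → ℂ}

lemma IsDirichletCharacter.norm_le_one (hχ : IsDirichletCharacter Q h)
    (hnorm : ∀ M, IsCoprime M Q → ‖h M‖ = 1) (M : k[X]) : ‖h M‖ ≤ 1 := by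
  by_cases hM : IsCoprime M Q
  · exact (hnorm M hM).le
  · rw [hχ.eq_zero_of_not_coprime M hM, norm_zero]
    exact zero_le_one

lemma mem_primesIoc_pred {γ : ℕ} (hγ : 0 < γ) {P : k[X]} :
    P ∈ primesIoc k (γ - 1) γ ↔ P.Monic ∧ Irreducible P ∧ P.natDegree = γ := by
  rw [mem_primesIoc]
  constructor
  · rintro ⟨h1, h2, h3, h4⟩; exact ⟨h1, h2, by omega⟩
  · rintro ⟨h1, h2, h3⟩; exact ⟨h1, h2, by omega, by omega⟩

lemma mem_polysLT_succ_of_natDegree {γ : ℕ} {P : k[X]} (h : P.natDegree = γ) :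
    P ∈ polysLT k (γ + 1) := by
  rw [mem_polysLT]
  refine degree_le_natDegree.trans_lt ?_
  rw [h]
  exact_mod_cast Nat.lt_succ_self γ

/-- Mean values of a unimodular Dirichlet character over consecutive degrees have nearly equal
modulus. -/
lemma IsDirichletCharacter.norm_monicMean_sub_sq_mul_le (hχ : IsDirichletCharacter Q h)
    (hQ : Q.Monic) (hnorm : ∀ M, IsCoprime M Q → ‖h M‖ = 1) {γ β : ℕ} (hγ : Q.natDegree < γ)
    (hβ : 2 * γ + 2 ≤ β) :
    (‖monicMean h (β + 1)‖ - ‖monicMean h β‖) ^ 2 *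
      ((primesIoc k (γ + 1 - 1) (γ + 1)).card * (primesIoc k (γ - 1) γ).card) ≤
      4 * (Fintype.card k : ℝ) ^ (γ + 2) := by
  have hq : (2 : ℝ) ≤ Fintype.card k := two_le_card
  set A := primesIoc k (γ + 1 - 1) (γ + 1) with hA
  set B := primesIoc k (γ - 1) γ with hB
  have hA' : ∀ P ∈ A, P.Monic ∧ Irreducible P ∧ P.natDegree = γ + 1 := fun P hP =>
    (mem_primesIoc_pred (by omega)).1 hP
  have hB' : ∀ P ∈ B, P.Monic ∧ Irreducible P ∧ P.natDegree = γ := fun P hP =>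
    (mem_primesIoc_pred (by omega)).1 hP
  have hndvd : ∀ P : k[X], γ ≤ P.natDegree → ¬ P ∣ Q := fun P hP hd => by
    have := natDegree_le_of_dvd hd hQ.ne_zero
    omega
  have hex : ∀ P₁ P₂ : k[X], ∃ a b : k[X], P₁ ∈ A → P₂ ∈ B →
      P₂ * b = P₁ * a + Q ∧ a ∈ polysLT k γ ∧ b ∈ polysLT k (γ + 1) := by
    intro P₁ P₂
    by_cases hP : P₁ ∈ A ∧ P₂ ∈ B
    · obtain ⟨h1, h2⟩ := hP
      have hco : IsCoprime P₂ P₁ := isCoprime_of_irreducible_of_ne (hB' _ h2).1 (hA' _ h1).1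
        (hB' _ h2).2.1 (hA' _ h1).2.1 (fun he => by
          have := (hB' _ h2).2.2; rw [he, (hA' _ h1).2.2] at this; omega)
      obtain ⟨s, t, hst⟩ := hco
      have hP₂ := (hB' _ h2).1
      set a := (-(t * Q)) %ₘ P₂ with ha
      have hdvd : P₂ ∣ P₁ * a + Q := by
        have h3 : P₂ ∣ -(t * Q) - a :=
          ⟨(-(t * Q)) /ₘ P₂, by rw [sub_eq_iff_eq_add', modByMonic_add_div]⟩
        rw [show P₁ * a + Q = P₂ * (s * Q) - P₁ * (-(t * Q) - a) by
          linear_combination (-Q) * hst]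
        exact dvd_sub (dvd_mul_right _ _) (h3.mul_left _)
      have hadeg : a.degree < γ := by
        have := degree_modByMonic_lt (-(t * Q)) hP₂
        rwa [degree_eq_natDegree hP₂.ne_zero, (hB' _ h2).2.2] at this
      obtain ⟨b, hb⟩ := hdvd
      refine ⟨a, b, fun _ _ => ⟨hb.symm, mem_polysLT.2 hadeg, mem_polysLT.2 ?_⟩⟩
      have h4 : (P₁ * a + Q).degree < ((2 * γ + 1 : ℕ) : WithBot ℕ) := by
        refine (degree_add_le _ _).trans_lt (max_lt ?_ ?_)
        · rw [degree_mul, degree_eq_natDegree (hA' _ h1).1.ne_zero, (hA' _ h1).2.2]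
          rcases eq_or_ne a 0 with h0 | h0
          · rw [h0, degree_zero, WithBot.add_bot]; exact WithBot.bot_lt_coe _
          rw [degree_eq_natDegree h0] at hadeg ⊢
          norm_cast at hadeg ⊢
          omega
        · rw [degree_eq_natDegree hQ.ne_zero]
          norm_cast
          omega
      rw [hb, degree_mul, degree_eq_natDegree hP₂.ne_zero, (hB' _ h2).2.2] at h4
      rcases eq_or_ne b 0 with h0 | h0
      · rw [h0, degree_zero]; exact WithBot.bot_lt_coe _
      rw [degree_eq_natDegree h0] at h4 ⊢
      norm_cast at h4 ⊢
      omega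
    · exact ⟨0, 0, fun h1 h2 => absurd ⟨h1, h2⟩ hP⟩
  choose a b hab using hex
  set Fa : k[X] → k[X] → ℝ := fun P u =>
    ‖classMean β (fun x => h (X ^ β + x)) P (u - X ^ β) - monicMean h β‖ ^ 2 with hFa
  set Fb : k[X] → k[X] → ℝ := fun P u =>
    ‖classMean (β + 1) (fun x => h (X ^ (β + 1) + x)) P (u - X ^ (β + 1)) -
      monicMean h (β + 1)‖ ^ 2 with hFb
  have hFaper : ∀ P, PeriodicMod P (Fa P) := fun P x y => by
    simp only [hFa, add_sub_right_comm, classMean_periodic _ _ P _ y]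
  have hFbper : ∀ P, PeriodicMod P (Fb P) := fun P x y => by
    simp only [hFb, add_sub_right_comm, classMean_periodic _ _ P _ y]
  have hmean_le : ∀ n, mean n (fun x => ‖h (X ^ n + x)‖ ^ 2) ≤ 1 := fun n => by
    rw [← mean_const (k := k) n (1 : ℝ)]
    exact mean_mono fun x _ => pow_le_one₀ (norm_nonneg _) (hχ.norm_le_one hnorm _)
  have hpair : ∀ P₁ ∈ A, ∀ P₂ ∈ B, (‖monicMean h (β + 1)‖ - ‖monicMean h β‖) ^ 2 ≤
      2 * Fa P₂ (a P₁ P₂) + 2 * Fb P₁ (b P₁ P₂) := by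
    intro P₁ h1 P₂ h2
    obtain ⟨hrel, hamem, hbmem⟩ := hab P₁ P₂ h1 h2
    have hh1 : ‖h P₁‖ = 1 := hnorm _ ((hA' _ h1).2.1.coprime_iff_not_dvd.2
      (hndvd _ (by rw [(hA' _ h1).2.2]; omega)))
    have hh2 : ‖h P₂‖ = 1 := hnorm _ ((hB' _ h2).2.1.coprime_iff_not_dvd.2
      (hndvd _ (by rw [(hB' _ h2).2.2])))
    have hsub : ∀ {i j : ℕ}, i ≤ j → polysLT k i ⊆ polysLT k j := fun hij x hx => by
      rw [mem_polysLT] at *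
      exact hx.trans_le (by exact_mod_cast hij)
    have hEa := classMean_eq (hB' _ h2).1 (n := β) (by rw [(hB' _ h2).2.2]; omega)
      (hsub (by omega) hamem) h
    have hEb := classMean_eq (hA' _ h1).1 (n := β + 1) (by rw [(hA' _ h1).2.2]; omega)
      (hsub (by omega) hbmem) h
    rw [(hB' _ h2).2.2] at hEa
    rw [(hA' _ h1).2.2, Nat.add_sub_add_right] at hEb
    simp only [hFa, hFb, hEa, hEb]
    set Ea := mean (β - γ) (fun z => h (a P₁ P₂ + P₂ * (X ^ (β - γ) + z)))
    set Eb := mean (β - γ) (fun z => h (b P₁ P₂ + P₁ * (X ^ (β - γ) + z)))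
    have heq : h P₁ * Ea = h P₂ * Eb := by
      rw [← mean_const_mul, ← mean_const_mul]
      congr 1
      ext z
      rw [← hχ.map_mul, ← hχ.map_mul, ← hχ.periodic]
      congr 1
      linear_combination -hrel
    have hnE : ‖Ea‖ = ‖Eb‖ := by
      have := congrArg norm heq
      rwa [norm_mul, norm_mul, hh1, hh2, one_mul, one_mul] at this
    have h3 := abs_norm_sub_norm_le Ea (monicMean h β)
    have h4 := abs_norm_sub_norm_le Eb (monicMean h (β + 1))
    rw [hnE] at h3
    have h5 : |‖monicMean h (β + 1)‖ - ‖monicMean h β‖| ≤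
        ‖Ea - monicMean h β‖ + ‖Eb - monicMean h (β + 1)‖ := by
      rw [abs_le] at *
      constructor <;> linarith [h3.1, h3.2, h4.1, h4.2]
    rw [← sq_abs]
    nlinarith [sq_nonneg (‖Ea - monicMean h β‖ - ‖Eb - monicMean h (β + 1)‖),
      abs_nonneg (‖monicMean h (β + 1)‖ - ‖monicMean h β‖)]
  have hsumA : ∑ P₂ ∈ B, ∑ P₁ ∈ A, Fa P₂ (a P₁ P₂) ≤ (Fintype.card k : ℝ) ^ (γ + 2) := by
    have h1 : ∀ P₂ ∈ B, ∑ P₁ ∈ A, Fa P₂ (a P₁ P₂) ≤ (Fintype.card k : ℝ) ^ (γ + 2) *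
        mean γ (fun u => ‖classMean β (fun x => h (X ^ β + x)) P₂ u - monicMean h β‖ ^ 2) := by
      intro P₂ h2
      have h3 := sum_inverse_le (hB' _ h2).1 (hB' _ h2).2.1
        (hndvd _ (hB' _ h2).2.2.ge) (F := Fa P₂) (fun x => by positivity) (hFaper P₂)
        (m := γ + 2) (by rw [(hB' _ h2).2.2]; omega) (T := A)
        (fun P hP => mem_polysLT_succ_of_natDegree (hA' _ hP).2.2)
        (w := fun P => a P P₂) (fun P hP => ⟨b P P₂, (hab P P₂ hP h2).1.symm⟩)
      refine h3.trans_eq ?_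
      have h4 := mean_affine (hB' _ h2).1 isCoprime_one_right
        (a := fun u => ‖classMean β (fun x => h (X ^ β + x)) P₂ u - monicMean h β‖ ^ 2)
        (fun x y => by simp only [classMean_periodic _ _ P₂ _ y]) (-X ^ β) le_rfl
      rw [(hB' _ h2).2.2] at h4 ⊢
      rw [← h4]
      simp only [hFa, one_mul, neg_add_eq_sub]
    calc _ ≤ _ := Finset.sum_le_sum h1
      _ ≤ (Fintype.card k : ℝ) ^ (γ + 2) * 1 := by
        rw [← Finset.mul_sum]
        gcongr
        exact (sum_mean_norm_sq_classMean_le β _ (fun P hP => ⟨(hB' P hP).1, (hB' P hP).2.2⟩)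
          (fun P hP P' hP' hne => isCoprime_of_irreducible_of_ne (hB' P hP).1 (hB' P' hP').1
            (hB' P hP).2.1 (hB' P' hP').2.1 hne) (by omega)).trans (hmean_le β)
      _ = _ := mul_one _
  have hsumB : ∑ P₁ ∈ A, ∑ P₂ ∈ B, Fb P₁ (b P₁ P₂) ≤ (Fintype.card k : ℝ) ^ (γ + 1) := by
    have h1 : ∀ P₁ ∈ A, ∑ P₂ ∈ B, Fb P₁ (b P₁ P₂) ≤ (Fintype.card k : ℝ) ^ (γ + 1) *
        mean (γ + 1) (fun u => ‖classMean (β + 1) (fun x => h (X ^ (β + 1) + x)) P₁ u -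
          monicMean h (β + 1)‖ ^ 2) := by
      intro P₁ h2
      have h3 := sum_inverse_le (hA' _ h2).1 (hA' _ h2).2.1
        (Q' := -Q) (by rw [dvd_neg]; exact hndvd _ (by rw [(hA' _ h2).2.2]; omega))
        (F := Fb P₁) (fun x => by positivity) (hFbper P₁)
        (m := γ + 1) (by rw [(hA' _ h2).2.2]) (T := B)
        (fun P hP => mem_polysLT_succ_of_natDegree (hB' _ hP).2.2)
        (w := fun P => b P₁ P) (fun P hP => ⟨a P₁ P, by
          linear_combination (hab P₁ P h2 hP).1⟩)
      refine h3.trans_eq ?_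
      have h4 := mean_affine (hA' _ h2).1 isCoprime_one_right
        (a := fun u => ‖classMean (β + 1) (fun x => h (X ^ (β + 1) + x)) P₁ u -
          monicMean h (β + 1)‖ ^ 2)
        (fun x y => by simp only [classMean_periodic _ _ P₁ _ y]) (-X ^ (β + 1)) le_rfl
      rw [(hA' _ h2).2.2] at h4 ⊢
      rw [← h4]
      simp only [hFb, one_mul, neg_add_eq_sub]
    calc _ ≤ _ := Finset.sum_le_sum h1
      _ ≤ (Fintype.card k : ℝ) ^ (γ + 1) * 1 := by
        rw [← Finset.mul_sum]
        gcongr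
        exact (sum_mean_norm_sq_classMean_le (β + 1) _
          (fun P hP => ⟨(hA' P hP).1, (hA' P hP).2.2⟩)
          (fun P hP P' hP' hne => isCoprime_of_irreducible_of_ne (hA' P hP).1 (hA' P' hP').1
            (hA' P hP).2.1 (hA' P' hP').2.1 hne) (by omega)).trans (hmean_le (β + 1))
      _ = _ := mul_one _
  calc _ = ∑ P₁ ∈ A, ∑ P₂ ∈ B, (‖monicMean h (β + 1)‖ - ‖monicMean h β‖) ^ 2 := by
        simp only [Finset.sum_const, nsmul_eq_mul]
        ring
    _ ≤ ∑ P₁ ∈ A, ∑ P₂ ∈ B, (2 * Fa P₂ (a P₁ P₂) + 2 * Fb P₁ (b P₁ P₂)) :=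
        Finset.sum_le_sum fun P₁ h1 => Finset.sum_le_sum fun P₂ h2 => hpair P₁ h1 P₂ h2
    _ = 2 * ∑ P₂ ∈ B, ∑ P₁ ∈ A, Fa P₂ (a P₁ P₂) + 2 * ∑ P₁ ∈ A, ∑ P₂ ∈ B, Fb P₁ (b P₁ P₂) := by
        rw [Finset.sum_comm (s := B)]
        simp only [Finset.sum_add_distrib, Finset.mul_sum]
    _ ≤ 2 * (Fintype.card k : ℝ) ^ (γ + 2) + 2 * (Fintype.card k : ℝ) ^ (γ + 1) := by linarith
    _ ≤ _ := by
        have : (Fintype.card k : ℝ) ^ (γ + 1) ≤ (Fintype.card k : ℝ) ^ (γ + 2) :=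
          pow_le_pow_right₀ (by linarith) (by omega)
        linarith

end MeanValueStability

section MeanValueLowerBound

variable {Q : k[X]}

lemma IsDirichletCharacter.norm_monicMean_sub_sq_le {h : k[X] → ℂ}
    (hχ : IsDirichletCharacter Q h) (hQ : Q.Monic) (hnorm : ∀ M, IsCoprime M Q → ‖h M‖ = 1)
    {γ β : ℕ} (hγ : Q.natDegree < γ) (hγ3 : 3 ≤ γ) (hβ : 2 * γ + 2 ≤ β) :
    (‖monicMean h (β + 1)‖ - ‖monicMean h β‖) ^ 2 ≤ 32 * (β : ℝ) ^ 2 * (1 / 2) ^ γ := by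
  have hq : (2 : ℝ) ≤ Fintype.card k := two_le_card
  have h0 := hχ.norm_monicMean_sub_sq_mul_le hQ hnorm hγ hβ
  have h1 : (Fintype.card k : ℝ) ^ γ ≤ 2 * γ * (primesIoc k (γ - 1) γ).card := by
    exact_mod_cast card_pow_le_card_primesIoc (k := k) hγ3
  have h2 : (Fintype.card k : ℝ) ^ (γ + 1) ≤ 2 * (γ + 1) * (primesIoc k (γ + 1 - 1) (γ + 1)).card := by
    exact_mod_cast card_pow_le_card_primesIoc (k := k) (n := γ + 1) (by omega)
  set q : ℝ := (Fintype.card k : ℝ)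
  set Δ := (‖monicMean h (β + 1)‖ - ‖monicMean h β‖) ^ 2
  have hΔ : 0 ≤ Δ := sq_nonneg _
  set a : ℝ := ((primesIoc k (γ + 1 - 1) (γ + 1)).card : ℝ)
  set b : ℝ := ((primesIoc k (γ - 1) γ).card : ℝ)
  have hγβ : (γ : ℝ) * (γ + 1) ≤ (β : ℝ) ^ 2 := by
    have : (2 * γ + 2 : ℝ) ≤ β := by exact_mod_cast hβ
    have hg : (0 : ℝ) ≤ γ := by positivity
    nlinarith
  have h3 : Δ * (q ^ (γ + 1) * q ^ γ) ≤ 4 * (β : ℝ) ^ 2 * (4 * q ^ (γ + 2)) := by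
    calc Δ * (q ^ (γ + 1) * q ^ γ) ≤ Δ * ((2 * (γ + 1) * a) * (2 * γ * b)) := by gcongr
      _ = 4 * (γ * (γ + 1)) * (Δ * (a * b)) := by ring
      _ ≤ _ := by gcongr
  have h4 : Δ * q ^ γ ≤ 16 * (β : ℝ) ^ 2 * q := by
    have hpos : (0 : ℝ) < q ^ (γ + 1) := by positivity
    refine le_of_mul_le_mul_right ?_ hpos
    calc Δ * q ^ γ * q ^ (γ + 1) = Δ * (q ^ (γ + 1) * q ^ γ) := by ring
      _ ≤ _ := h3
      _ = _ := by ring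
  have h5 : Δ * 2 ^ (γ - 1) ≤ 16 * (β : ℝ) ^ 2 := by
    have hpos : (0 : ℝ) < q := by positivity
    refine le_of_mul_le_mul_right ?_ hpos
    calc Δ * 2 ^ (γ - 1) * q ≤ Δ * q ^ (γ - 1) * q := by gcongr
      _ = Δ * q ^ γ := by rw [mul_assoc, ← pow_succ, Nat.sub_add_cancel (by omega)]
      _ ≤ _ := h4
  have h6 : (2 : ℝ) ^ γ = 2 * 2 ^ (γ - 1) := by
    rw [← pow_succ', Nat.sub_add_cancel (by omega)]
  rw [one_div, inv_pow, ← div_eq_mul_inv, le_div_iff₀ (by positivity), h6]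
  linarith

lemma exists_summable_norm_monicMean_sub_le (hQ : Q.Monic) :
    ∃ err : ℕ → ℝ, Summable err ∧ (∀ n, 0 ≤ err n) ∧ ∃ n₀ : ℕ, ∀ h : k[X] → ℂ,
      IsDirichletCharacter Q h → (∀ M, IsCoprime M Q → ‖h M‖ = 1) → ∀ n, n₀ ≤ n →
        ‖monicMean h n‖ ≤ ‖monicMean h (n + 1)‖ + err n := by
  obtain ⟨s, hs, hs0⟩ : ∃ s : ℝ, s ^ 4 = 1 / 2 ∧ 0 < s := by
    refine ⟨√(√(1 / 2)), ?_, by positivity⟩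
    have h1 : (√(√(1 / 2)) : ℝ) ^ 2 = √(1 / 2) := Real.sq_sqrt (Real.sqrt_nonneg _)
    have h2 : (√(1 / 2) : ℝ) ^ 2 = 1 / 2 := Real.sq_sqrt (by norm_num)
    calc (√(√(1 / 2)) : ℝ) ^ 4 = ((√(√(1 / 2)) : ℝ) ^ 2) ^ 2 := by ring
      _ = 1 / 2 := by rw [h1, h2]
  have hs1 : s < 1 := by
    by_contra! hc
    have := one_le_pow₀ hc (n := 4)
    norm_num [hs] at this
  have hsum : Summable fun n : ℕ => 6 * (s ^ 3)⁻¹ * ((n : ℝ) ^ 1 * s ^ n) := by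
    refine Summable.mul_left _ (summable_pow_mul_geometric_of_norm_lt_one 1 ?_)
    rwa [Real.norm_of_nonneg hs0.le]
  refine ⟨_, hsum, fun n => by positivity, 2 * Q.natDegree + 10, fun h hχ hnorm n hn => ?_⟩
  have hγ := hχ.norm_monicMean_sub_sq_le hQ hnorm (γ := n / 2 - 1) (β := n) (by omega) (by omega)
    (by omega)
  have h1 : (1 / 2 : ℝ) ^ (n / 2 - 1) ≤ ((s ^ 3)⁻¹ * s ^ n) ^ 2 := by
    rw [← hs, ← pow_mul]
    have h2 : s ^ (4 * (n / 2 - 1) + 6) ≤ s ^ (n * 2) :=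
      pow_le_pow_of_le_one hs0.le hs1.le (by omega)
    rw [mul_pow, inv_pow, ← pow_mul, ← pow_mul, inv_mul_eq_div, le_div_iff₀ (by positivity),
      ← pow_add]
    exact h2
  have h2 : (‖monicMean h (n + 1)‖ - ‖monicMean h n‖) ^ 2 ≤
      (6 * (s ^ 3)⁻¹ * ((n : ℝ) ^ 1 * s ^ n)) ^ 2 := by
    refine hγ.trans ?_
    calc 32 * (n : ℝ) ^ 2 * (1 / 2) ^ (n / 2 - 1) ≤
          36 * (n : ℝ) ^ 2 * ((s ^ 3)⁻¹ * s ^ n) ^ 2 := by gcongr; norm_num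
      _ = _ := by ring
  have h3 := abs_le_of_sq_le_sq' h2 (by positivity)
  linarith [h3.1]

lemma exists_norm_monicMean_sub_le (hQ : Q.Monic) {η : ℝ} (hη : 0 < η) :
    ∃ N : ℕ, Q.natDegree ≤ N ∧ ∀ h : k[X] → ℂ,
      IsDirichletCharacter Q h → (∀ M, IsCoprime M Q → ‖h M‖ = 1) → ∀ n, N ≤ n →
        ‖monicMean h N‖ - η ≤ ‖monicMean h n‖ := by
  obtain ⟨err, hsum, hnn, n₀, herr⟩ := exists_summable_norm_monicMean_sub_le hQ
  have ht := (tendsto_sum_nat_add err).eventually_le_const hη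
  obtain ⟨N₁, hN₁⟩ := eventually_atTop.1 ht
  refine ⟨N₁ + n₀ + Q.natDegree, by omega, fun h hχ hnorm n hn => ?_⟩
  set N := N₁ + n₀ + Q.natDegree with hN
  obtain ⟨m, rfl⟩ := Nat.exists_eq_add_of_le hn
  have h1 : ‖monicMean h N‖ ≤ ‖monicMean h (N + m)‖ + ∑ i ∈ Finset.range m, err (i + N) := by
    clear hn
    induction m with
    | zero => simp
    | succ m ih =>
      rw [Finset.sum_range_succ]
      have := herr h hχ hnorm (N + m) (by omega)
      rw [add_comm m N, ← add_assoc N m 1]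
      linarith
  have h2 : ∑ i ∈ Finset.range m, err (i + N) ≤ ∑' i, err (i + N) :=
    ((summable_nat_add_iff N).2 hsum).sum_le_tsum _ (fun i _ => hnn _)
  linarith [hN₁ N (by omega)]

end MeanValueLowerBound

section LocalIndependence

variable {Q : k[X]} {h : k[X] → ℂ}

lemma norm_mean_le (n : ℕ) (a : k[X] → ℂ) : ‖mean n a‖ ≤ mean n (fun x => ‖a x‖) := by
  unfold mean
  rw [norm_div, norm_pow, Complex.norm_natCast]
  gcongr
  exact norm_sum_le _ _

lemma sum_ind_add_mul {K : Type*} [Field K] {M R : k[X]} (hM : M.Monic) (hco : IsCoprime M R)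
    (Z : k[X]) : ∑ u ∈ polysLT k M.natDegree, ind K M (Z + R * u) = 1 := by
  rw [sum_polysLT_affine hM hco (ind_periodic K M), Finset.sum_eq_single 0]
  · exact ind_of_dvd (dvd_zero M)
  · intro z hz hz0
    exact ind_of_not_dvd fun hd => hz0 (eq_zero_of_dvd_of_mem_polysLT hz le_rfl hd)
  · simp

lemma IsDirichletCharacter.exists_norm_monicMean_add_sub_le (hχ : IsDirichletCharacter Q h)
    (hQ : Q.Monic) (hb : ∀ M, ‖h M‖ ≤ 1) {M : k[X]} (hM : M.Monic) (hco : IsCoprime M Q)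
    {ε : ℝ} (hε : 0 < ε) : ∃ n₀ : ℕ, ∀ n, n₀ ≤ n →
      ‖monicMean h (n + M.natDegree) - h M * monicMean h n‖ ≤ ε := by
  set d := M.natDegree with hd
  have hq : (0 : ℝ) < (Fintype.card k : ℝ) ^ d := by
    have : (0 : ℝ) < Fintype.card k := by exact_mod_cast Fintype.card_pos
    positivity
  have hex : ∀ u : k[X], ∃ n₀ : ℕ, ∀ n, n₀ ≤ n → ∀ A B : k[X], B ∣ Q →
      mean n (fun y => ‖h (A + B * y + Q * (Q * u)) - h (A + B * y)‖) ≤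
        ε / (Fintype.card k : ℝ) ^ d := fun u =>
    hχ.exists_mean_shift_le hb hQ dvd_rfl u (div_pos hε hq)
  choose n₀ hn₀ using hex
  refine ⟨∑ u ∈ polysLT k d, n₀ u + 2 * Q.natDegree + d, fun n hn => ?_⟩
  set N := n + d with hN
  have h1 : h M * monicMean h n =
      ∑ u ∈ polysLT k d, mean N (fun x => ind ℂ M (X ^ N + x) * h (X ^ N + x)) := by
    have hc := classMean_eq (n := N) (u := 0) hM (by omega) (by simp [mem_polysLT]) h
    rw [← hd, show N - d = n by omega] at hc
    rw [Finset.sum_const, card_polysLT, nsmul_eq_mul, monicMean, ← mean_const_mul]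
    simp only [← hχ.map_mul]
    simp only [zero_add, zero_sub] at hc
    rw [← hc, classMean, ← hd]
    push_cast
    congr 2
    ext x
    rw [sub_neg_eq_add, add_comm]
  have h2 : monicMean h N = ∑ u ∈ polysLT k d,
      mean N (fun x => ind ℂ M (X ^ N + x + Q * Q * u) * h (X ^ N + x)) := by
    rw [← mean_sum]
    unfold monicMean
    congr 1
    ext x
    rw [← Finset.sum_mul, hd, sum_ind_add_mul hM (hco.mul_right hco), one_mul]
  rw [h1, h2, ← Finset.sum_sub_distrib]
  refine (norm_sum_le _ _).trans ?_
  have h3 : ∀ u ∈ polysLT k d,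
      ‖mean N (fun x => ind ℂ M (X ^ N + x + Q * Q * u) * h (X ^ N + x)) -
        mean N (fun x => ind ℂ M (X ^ N + x) * h (X ^ N + x))‖ ≤
      ε / (Fintype.card k : ℝ) ^ d := by
    intro u hu
    have hnu : n₀ u ≤ ∑ u ∈ polysLT k d, n₀ u :=
      Finset.single_le_sum (f := n₀) (fun _ _ => Nat.zero_le _) hu
    have hmem : Q * Q * u ∈ polysLT k N := by
      rw [mem_polysLT] at hu ⊢
      rcases eq_or_ne u 0 with rfl | hu0
      · simp
      rw [degree_eq_natDegree hu0] at hu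
      have hud : u.natDegree < d := by exact_mod_cast hu
      rw [degree_eq_natDegree (mul_ne_zero (mul_ne_zero hQ.ne_zero hQ.ne_zero) hu0),
        natDegree_mul (mul_ne_zero hQ.ne_zero hQ.ne_zero) hu0,
        natDegree_mul hQ.ne_zero hQ.ne_zero]
      exact_mod_cast (by omega : Q.natDegree + Q.natDegree + u.natDegree < N)
    rw [← mean_translate hmem (fun x => ind ℂ M (X ^ N + x) * h (X ^ N + x)), ← mean_sub]
    refine (norm_mean_le _ _).trans (le_trans (mean_mono fun x _ => ?_)
      (hn₀ u N (by omega) (X ^ N) 1 (one_dvd Q)))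
    rw [one_mul, norm_sub_rev (h _), show X ^ N + (x + Q * Q * u) = X ^ N + x + Q * Q * u by ring,
      ← mul_sub, norm_mul, show X ^ N + x + Q * (Q * u) = X ^ N + x + Q * Q * u by ring]
    refine mul_le_of_le_one_left (norm_nonneg _) ?_
    unfold ind
    split_ifs <;> simp
  refine (Finset.sum_le_sum h3).trans (le_of_eq ?_)
  rw [Finset.sum_const, card_polysLT, nsmul_eq_mul]
  push_cast
  field_simp

end LocalIndependence

section Unimodularity

variable {Q : k[X]} {χ h : k[X] → ℂ}

lemma IsDirichletCharacter.map_pow (hχ : IsDirichletCharacter Q h) (M : k[X]) (n : ℕ) :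
    h (M ^ n) = h M ^ n := by
  induction n with
  | zero => simp [hχ.map_one]
  | succ n ih => rw [pow_succ, hχ.map_mul, ih, pow_succ]

/-- The function `M ↦ ‖χ M‖ ^ (i t)` on the support of `χ`. -/
def normTwist (χ : k[X] → ℂ) (t : ℝ) (M : k[X]) : ℂ :=
  if χ M = 0 then 0 else Complex.exp ((t * Real.log ‖χ M‖ : ℝ) * I)

lemma IsDirichletCharacter.normTwist (hχ : IsDirichletCharacter Q χ) (t : ℝ) :
    IsDirichletCharacter Q (normTwist χ t) where
  map_mul A B := by
    unfold FFEDP.normTwist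
    rw [hχ.map_mul]
    by_cases hA : χ A = 0
    · simp [hA]
    by_cases hB : χ B = 0
    · simp [hB]
    rw [if_neg (mul_ne_zero hA hB), if_neg hA, if_neg hB, ← Complex.exp_add, norm_mul,
      Real.log_mul (norm_ne_zero_iff.2 hA) (norm_ne_zero_iff.2 hB)]
    congr 1
    push_cast
    ring
  exists_ne_zero := by
    obtain ⟨M, hM⟩ := hχ.exists_ne_zero
    exact ⟨M, by simp [FFEDP.normTwist, hM]⟩
  periodic M := by simp [FFEDP.normTwist, hχ.periodic]
  eq_zero_of_not_coprime M hM := by simp [FFEDP.normTwist, hχ.eq_zero_of_not_coprime M hM]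

lemma norm_normTwist (t : ℝ) {M : k[X]} (hM : χ M ≠ 0) : ‖normTwist χ t M‖ = 1 := by
  rw [normTwist, if_neg hM, Complex.norm_exp_ofReal_mul_I]

lemma continuous_monicMean_normTwist (χ : k[X] → ℂ) (n : ℕ) :
    Continuous fun t : ℝ => monicMean (normTwist χ t) n := by
  unfold monicMean mean normTwist
  refine Continuous.div_const (continuous_finsetSum _ fun x _ => ?_) _
  beta_reduce
  split_ifs
  · exact continuous_const
  · fun_prop

lemma IsDirichletCharacter.le_norm_monicMean_normTwist_zero (hχ : IsDirichletCharacter Q χ)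
    (hQ : Q.Monic) {n : ℕ} (hn : Q.natDegree ≤ n) :
    ((Fintype.card k : ℝ) ^ Q.natDegree)⁻¹ ≤ ‖monicMean (FFEDP.normTwist χ 0) n‖ := by
  have h1 : monicMean (FFEDP.normTwist χ 0) n =
      ((mean n (fun x => if χ (X ^ n + x) = 0 then (0 : ℝ) else 1) : ℝ) : ℂ) := by
    rw [ofReal_mean, monicMean]
    congr 1
    ext x
    split_ifs <;> simp_all [FFEDP.normTwist]
  rw [h1, Complex.norm_real, ← mean_ind_translate hQ (X ^ n - 1) hn]
  refine le_trans (mean_mono fun x _ => ?_) (le_abs_self _)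
  by_cases hd : Q ∣ x + (X ^ n - 1)
  · rw [ind_of_dvd hd, if_neg]
    refine hχ.ne_zero hQ ?_
    obtain ⟨y, hy⟩ := hd
    exact ⟨1, -y, by rw [show X ^ n + x = Q * y + 1 by rw [← hy]; ring]; ring⟩
  · rw [ind_of_not_dvd hd]
    split_ifs <;> norm_num

lemma IsDirichletCharacter.pow_natDegree_eq_one (hχ : IsDirichletCharacter Q h)
    (hQ : Q.Monic) (hQ0 : 0 < Q.natDegree) (hb : ∀ M, ‖h M‖ ≤ 1) {c : ℝ} (hc : 0 < c) {N : ℕ}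
    (hN : ∀ n, N ≤ n → c ≤ ‖monicMean h n‖) {M : k[X]} (hM : M.Monic) (hco : IsCoprime M Q) :
    h M ^ Q.natDegree = 1 := by
  set D := Q.natDegree with hD
  set d := M.natDegree with hd
  have hdegQ : (1 : k[X]).degree < Q.degree := by
    rw [degree_eq_natDegree hQ.ne_zero, degree_one]; exact_mod_cast hQ0
  have hQ1m : (1 + Q).Monic := hQ.add_of_right hdegQ
  have hQ1d : (1 + Q).natDegree = D := by
    rw [natDegree_add_eq_right_of_degree_lt hdegQ]
  have hQ1c : IsCoprime (1 + Q) Q := ⟨1, -1, by ring⟩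
  have h1 : h ((1 + Q) ^ d) = 1 := by
    rw [hχ.map_pow, hχ.periodic, hχ.map_one, one_pow]
  have hdeg1 : (M ^ D).natDegree = d * D := by rw [hM.natDegree_pow, mul_comm]
  have hdeg2 : ((1 + Q) ^ d).natDegree = d * D := by rw [hQ1m.natDegree_pow, hQ1d]
  rw [← hχ.map_pow, ← h1, ← sub_eq_zero, ← norm_eq_zero]
  refine le_antisymm (le_of_forall_pos_le_add fun ε hε => ?_) (norm_nonneg _)
  have hε' : 0 < ε * c / 2 := by positivity
  obtain ⟨n₁, hn₁⟩ := hχ.exists_norm_monicMean_add_sub_le hQ hb (hM.pow D) hco.pow_left hε'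
  obtain ⟨n₂, hn₂⟩ := hχ.exists_norm_monicMean_add_sub_le hQ hb (hQ1m.pow d) hQ1c.pow_left hε'
  set n := N + n₁ + n₂
  have e1 := hn₁ n (by omega)
  have e2 := hn₂ n (by omega)
  rw [hdeg1] at e1
  rw [hdeg2] at e2
  have e3 : ‖h (M ^ D) - h ((1 + Q) ^ d)‖ * ‖monicMean h n‖ ≤ ε * c := by
    rw [← norm_mul]
    calc _ = ‖(monicMean h (n + d * D) - h ((1 + Q) ^ d) * monicMean h n) -
          (monicMean h (n + d * D) - h (M ^ D) * monicMean h n)‖ := by congr 1; ring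
      _ ≤ _ := norm_sub_le _ _
      _ ≤ ε * c := by linarith
  rw [zero_add]
  refine le_of_mul_le_mul_right (le_trans ?_ e3) hc
  gcongr
  exact hN n (by omega)

/-- A Dirichlet character takes unimodular values on residues coprime to the modulus. -/
theorem IsDirichletCharacter.norm_eq_one (hχ : IsDirichletCharacter Q χ) (hQ : Q.Monic)
    {M : k[X]} (hM : IsCoprime M Q) : ‖χ M‖ = 1 := by
  by_cases hQ0 : Q.natDegree = 0
  · have hQ1 : Q = 1 := hQ.natDegree_eq_zero.1 hQ0
    subst hQ1
    simp [hχ.eq_one_of_isUnit]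
  have hQpos : 0 < Q.natDegree := Nat.pos_of_ne_zero hQ0
  have hmonic : ∀ M : k[X], M.Monic → IsCoprime M Q → ‖χ M‖ = 1 := by
    intro M hMm hco
    have hne := hχ.ne_zero hQ hco
    set D := Q.natDegree with hD
    set ρ : ℝ := ((Fintype.card k : ℝ) ^ D)⁻¹ with hρ
    have hρ0 : 0 < ρ := by
      have : (0 : ℝ) < Fintype.card k := by exact_mod_cast Fintype.card_pos
      positivity
    obtain ⟨N, hDN, hN⟩ := exists_norm_monicMean_sub_le hQ (η := ρ / 4) (by positivity)
    have hcont := (continuous_monicMean_normTwist χ N).norm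
    have hlt : ρ / 2 < ‖monicMean (FFEDP.normTwist χ 0) N‖ :=
      lt_of_lt_of_le (by linarith) (hχ.le_norm_monicMean_normTwist_zero hQ hDN)
    obtain ⟨r, hr, hball⟩ := Metric.eventually_nhds_iff.1
      (hcont.continuousAt.eventually_const_lt hlt)
    by_contra hne1
    set l := Real.log ‖χ M‖ with hl
    have hl0 : l ≠ 0 := by
      rw [hl, Real.log_ne_zero]
      exact ⟨norm_ne_zero_iff.2 hne, hne1, by linarith [norm_nonneg (χ M)]⟩
    have hDl : 0 < D * |l| := by positivity
    set t := min (r / 2) (1 / (D * |l|)) with ht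
    have ht0 : 0 < t := lt_min (by positivity) (by positivity)
    have htr : dist t 0 < r := by
      rw [Real.dist_eq, sub_zero, abs_of_pos ht0]
      exact lt_of_le_of_lt (min_le_left _ _) (by linarith)
    have htl : t * (D * |l|) ≤ 1 := by
      calc t * (D * |l|) ≤ 1 / (D * |l|) * (D * |l|) := by gcongr; exact min_le_right _ _
        _ = 1 := by field_simp
    have hχt := hχ.normTwist t
    have hnorm : ∀ M, IsCoprime M Q → ‖FFEDP.normTwist χ t M‖ = 1 := fun M hM =>
      norm_normTwist t (hχ.ne_zero hQ hM)
    have hpow := hχt.pow_natDegree_eq_one hQ hQpos (hχt.norm_le_one hnorm) (c := ρ / 4)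
      (by positivity) (N := N) (fun n hn => by
        have := hN _ hχt hnorm n hn
        linarith [hball htr]) hMm hco
    rw [FFEDP.normTwist, if_neg hne, ← Complex.exp_nat_mul, ← mul_assoc] at hpow
    have hre := congrArg Complex.re hpow
    rw [← hD, ← hl, show ((D : ℂ) * ((t * l : ℝ) : ℂ)) = ((D * (t * l) : ℝ) : ℂ) by push_cast; ring,
      Complex.exp_ofReal_mul_I_re, Complex.one_re] at hre
    have habs : |(D : ℝ) * (t * l)| ≤ 1 := by
      rw [abs_mul, abs_mul, abs_of_pos ht0, Nat.abs_cast]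
      linarith
    have hpi := Real.pi_gt_three
    have := (Real.cos_eq_one_iff_of_lt_of_lt (by linarith [(abs_le.1 habs).1])
      (by linarith [(abs_le.1 habs).2])).1 hre
    have hD0 : (D : ℝ) ≠ 0 := by exact_mod_cast hQpos.ne'
    exact mul_ne_zero hD0 (mul_ne_zero ht0.ne' hl0) this
  have hM0 : M ≠ 0 := by
    rintro rfl
    have := (isCoprime_zero_left.1 hM)
    exact hQ0 (natDegree_eq_zero_of_isUnit this)
  set c := M.leadingCoeff with hc
  have hc0 : c ≠ 0 := leadingCoeff_ne_zero.2 hM0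
  have hCc : ‖χ (C c)‖ = 1 := by
    have h1 : χ (C c) ^ (Fintype.card k - 1) = 1 := by
      rw [← hχ.map_pow, ← C_pow, FiniteField.pow_card_sub_one_eq_one c hc0, C_1, hχ.map_one]
    have hk : Fintype.card k - 1 ≠ 0 := by
      have := Fintype.one_lt_card (α := k)
      omega
    exact norm_eq_one_of_pow_eq_one h1 hk
  have hMc : M = C c * (C c⁻¹ * M) := by
    rw [← mul_assoc, ← C_mul, mul_inv_cancel₀ hc0, C_1, one_mul]
  have hmon : (C c⁻¹ * M).Monic := by
    rw [Monic, leadingCoeff_mul, leadingCoeff_C, ← hc, inv_mul_cancel₀ hc0]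
  have hco : IsCoprime (C c⁻¹ * M) Q :=
    (isCoprime_mul_unit_left_left (isUnit_C.2 (inv_ne_zero hc0).isUnit) M Q).2 hM
  rw [hMc, hχ.map_mul, norm_mul, hCc, hmonic _ hmon hco, one_mul]

end Unimodularity

section PointwiseComparison

variable {Q P₁ P₂ : k[X]} {χ g : k[X] → ℂ}

lemma exists_eq_pow_mul_pow_mul (hi₁ : Irreducible P₁) (hi₂ : Irreducible P₂) (h₁ : P₁.Monic)
    (h₂ : P₂.Monic) {G : k[X]} (hG : G.Monic) :
    ∃ (a b : ℕ) (E : k[X]), G = P₁ ^ a * P₂ ^ b * E ∧ E.Monic ∧ ¬ P₁ ∣ E ∧ ¬ P₂ ∣ E := by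
  obtain ⟨a, E₁, hE₁, rfl⟩ :=
    WfDvdMonoid.max_power_factor hG.ne_zero hi₁
  have hE₁m : E₁.Monic := (h₁.pow a).of_mul_monic_left hG
  obtain ⟨b, E, hE, rfl⟩ := WfDvdMonoid.max_power_factor hE₁m.ne_zero hi₂
  exact ⟨a, b, E, by ring, (h₂.pow b).of_mul_monic_left hE₁m,
    fun h => hE₁ (h.mul_left _), hE⟩

lemma deviation_nonneg (τ : k[X] → ℝ) (w n l : ℕ) (G : k[X]) : 0 ≤ deviation τ w n l G := by
  unfold deviation
  have h1 : 0 ≤ ∑ P ∈ primesIoc k (n / 2) (n + l), |τ P| * ind ℝ P G :=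
    Finset.sum_nonneg fun P _ => mul_nonneg (abs_nonneg _) (ind_nonneg P G)
  have h2 : 0 ≤ ∑ P ∈ primesIoc k w ((n + l) / 2), ind ℝ (P ^ 2) G :=
    Finset.sum_nonneg fun P _ => ind_nonneg _ G
  positivity

lemma map_pow_of_monic {h : k[X] → ℂ} (h1 : h 1 = 1)
    (hmul : ∀ A B : k[X], A.Monic → B.Monic → h (A * B) = h A * h B) {P : k[X]} (hP : P.Monic)
    (n : ℕ) : h (P ^ n) = h P ^ n := by
  induction n with
  | zero => simp [h1]
  | succ n ih => rw [pow_succ, hmul _ _ (hP.pow n) hP, ih, pow_succ]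

/-- The function `g` is completely multiplicative and unimodular on monic polynomials, and `g`
equals `χ` up to small phases `τ` at the irreducibles of large degree. -/
structure IsTwist (Q : k[X]) (χ g : k[X] → ℂ) (τ : k[X] → ℝ) (w₀ : ℕ) : Prop where
  char : IsDirichletCharacter Q χ
  monic : Q.Monic
  natDegree_le : Q.natDegree ≤ w₀
  map_one : g 1 = 1
  map_mul : ∀ A B : k[X], A.Monic → B.Monic → g (A * B) = g A * g B
  norm_eq_one : ∀ G : k[X], G.Monic → ‖g G‖ = 1
  phase : ∀ P : k[X], P.Monic → Irreducible P → w₀ < P.natDegree →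
    g P * conj (χ P) = exp (τ P * I)
  tails : HasSmallTails τ

variable {τ : k[X] → ℝ} {w₀ : ℕ}

lemma IsTwist.norm_char_eq_one (ht : IsTwist Q χ g τ w₀) {M : k[X]} (hM : IsCoprime M Q) :
    ‖χ M‖ = 1 := ht.char.norm_eq_one ht.monic hM

/-- The value of `g` at a polynomial without small prime factors apart from `P₁` and `P₂` is
determined by `χ` and by the multiplicities of `P₁` and `P₂`, up to a small error. -/
lemma IsTwist.norm_sub_exp_mul_le (ht : IsTwist Q χ g τ w₀) (hi₁ : Irreducible P₁) (hi₂ : Irreducible P₂)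
    (h₁ : P₁.Monic) (h₂ : P₂.Monic) (hne : P₁ ≠ P₂) (hQ₁ : ¬ P₁ ∣ Q) (hQ₂ : ¬ P₂ ∣ Q)
    {w n l J : ℕ} (hw : w₀ ≤ w) (hwn : w ≤ n / 2) (hd₁ : P₁.natDegree ≤ w)
    (hd₂ : P₂.natDegree ≤ w) {A G : k[X]} (hA : A.Monic) (hA₁ : ¬ P₁ ∣ A) (hA₂ : ¬ P₂ ∣ A)
    (hG : G.Monic) (hdeg : G.natDegree ≤ n + l) (hGQ : IsCoprime G Q)
    (hGw : ∀ P : k[X], P.Monic → Irreducible P → P ∣ G → P ≠ P₁ → P ≠ P₂ → w < P.natDegree) :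
    ‖g (A * G) - exp (centre τ w n * I) * (g A * χ G *
      (truncPow P₁ (g P₁ * conj (χ P₁)) J (A * G) *
        truncPow P₂ (g P₂ * conj (χ P₂)) J (A * G)))‖ ≤
      2 * ind ℝ (P₁ ^ J) (A * G) + 2 * ind ℝ (P₂ ^ J) (A * G) + deviation τ w n l G := by
  have hcop : ∀ {P : k[X]}, Irreducible P → ¬ P ∣ Q → IsCoprime P Q := fun hi hd =>
    (hi.coprime_iff_not_dvd).2 hd
  set β₁ := g P₁ * conj (χ P₁) with hβ₁
  set β₂ := g P₂ * conj (χ P₂) with hβ₂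
  have hβ₁n : ‖β₁‖ = 1 := by
    rw [hβ₁, norm_mul, RCLike.norm_conj, ht.norm_eq_one _ h₁, ht.norm_char_eq_one (hcop hi₁ hQ₁),
      one_mul]
  have hβ₂n : ‖β₂‖ = 1 := by
    rw [hβ₂, norm_mul, RCLike.norm_conj, ht.norm_eq_one _ h₂, ht.norm_char_eq_one (hcop hi₂ hQ₂),
      one_mul]
  have hexp : ‖exp (centre τ w n * I)‖ = 1 := Complex.norm_exp_ofReal_mul_I _
  have hdev := deviation_nonneg τ w n l G
  have hnn₁ := ind_nonneg (P₁ ^ J) (A * G)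
  have hnn₂ := ind_nonneg (P₂ ^ J) (A * G)
  have htriv : ‖g (A * G) - exp (centre τ w n * I) * (g A * χ G *
      (truncPow P₁ β₁ J (A * G) * truncPow P₂ β₂ J (A * G)))‖ ≤ 2 := by
    refine (_root_.norm_sub_le _ _).trans ?_
    simp only [norm_mul, hexp, ht.norm_eq_one _ hA, ht.norm_char_eq_one hGQ,
      norm_truncPow hβ₁n J hi₁, norm_truncPow hβ₂n J hi₂, ht.norm_eq_one _ (hA.mul hG)]
    norm_num
  by_cases hJ₁ : P₁ ^ J ∣ A * G
  · rw [ind_of_dvd hJ₁]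
    linarith
  by_cases hJ₂ : P₂ ^ J ∣ A * G
  · rw [ind_of_dvd hJ₂]
    linarith
  obtain ⟨a, b, E, rfl, hE, hE₁, hE₂⟩ := exists_eq_pow_mul_pow_mul hi₁ hi₂ h₁ h₂ hG
  have hP₁P₂ : ¬ P₁ ∣ P₂ := fun h =>
    hne (eq_of_monic_of_associated h₁ h₂ (hi₁.associated_of_dvd hi₂ h))
  have hP₂P₁ : ¬ P₂ ∣ P₁ := fun h =>
    hne (eq_of_monic_of_associated h₂ h₁ (hi₂.associated_of_dvd hi₁ h)).symm
  have ha : a < J := by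
    by_contra! hc
    exact hJ₁ (((pow_dvd_pow P₁ hc).trans ((dvd_mul_right _ _).trans (dvd_mul_right _ _))).mul_left A)
  have hb : b < J := by
    by_contra! hc
    exact hJ₂ (((pow_dvd_pow P₂ hc).trans ((dvd_mul_left _ _).trans (dvd_mul_right _ _))).mul_left A)
  have ht₁ : truncPow P₁ β₁ J (A * (P₁ ^ a * P₂ ^ b * E)) = β₁ ^ a := by
    rw [truncPow_eq β₁ (v := a) (y := A * P₂ ^ b * E) (by ring) hi₁.ne_zero, min_eq_left ha.le]
    intro hd
    rcases hi₁.prime.dvd_or_dvd hd with h | h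
    · rcases hi₁.prime.dvd_or_dvd h with h | h
      · exact hA₁ h
      · exact hP₁P₂ (hi₁.prime.dvd_of_dvd_pow h)
    · exact hE₁ h
  have ht₂ : truncPow P₂ β₂ J (A * (P₁ ^ a * P₂ ^ b * E)) = β₂ ^ b := by
    rw [truncPow_eq β₂ (v := b) (y := A * P₁ ^ a * E) (by ring) hi₂.ne_zero, min_eq_left hb.le]
    intro hd
    rcases hi₂.prime.dvd_or_dvd hd with h | h
    · rcases hi₂.prime.dvd_or_dvd h with h | h
      · exact hA₂ h
      · exact hP₂P₁ (hi₂.prime.dvd_of_dvd_pow h)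
    · exact hE₂ h
  set h : k[X] → ℂ := fun M => g M * conj (χ M) with hh
  have hh1 : h 1 = 1 := by simp [hh, ht.map_one, ht.char.map_one]
  have hhmul : ∀ A B : k[X], A.Monic → B.Monic → h (A * B) = h A * h B := by
    intro A B hA hB
    simp only [hh, ht.map_mul A B hA hB, ht.char.map_mul, _root_.map_mul]
    ring
  have hEQ : IsCoprime E Q := hGQ.of_mul_left_right
  have hEprime : ∀ P : k[X], P.Monic → Irreducible P → P ∣ E → w < P.natDegree := by
    intro P hP hi hd
    refine hGw P hP hi (hd.mul_left _) ?_ ?_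
    · rintro rfl; exact hE₁ hd
    · rintro rfl; exact hE₂ hd
  have hEG : ∀ P : k[X], P.Monic → Irreducible P → w < P.natDegree → P ∣ P₁ ^ a * P₂ ^ b * E →
      P ∣ E := by
    intro P hP hi hPw hd
    rcases hi.prime.dvd_or_dvd hd with hd | hd
    · rcases hi.prime.dvd_or_dvd hd with hd | hd
      · have := eq_of_monic_of_associated hP h₁
          (hi.associated_of_dvd hi₁ (hi.prime.dvd_of_dvd_pow hd))
        subst this; omega
      · have := eq_of_monic_of_associated hP h₂
          (hi.associated_of_dvd hi₂ (hi.prime.dvd_of_dvd_pow hd))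
        subst this; omega
    · exact hd
  have hnormE : ‖h E‖ = 1 := by
    simp only [hh]
    rw [norm_mul, RCLike.norm_conj, ht.norm_eq_one _ hE, ht.norm_char_eq_one hEQ, one_mul]
  have hEdeg : E.natDegree ≤ n + l := by
    refine le_trans ?_ hdeg
    exact natDegree_le_of_dvd (dvd_mul_left _ _) hG.ne_zero
  have hmain := norm_sub_exp_centre_le hwn hh1 hhmul
    (fun P hP hi hPw => ht.phase P hP hi (lt_of_le_of_lt hw hPw)) hE hEdeg hEprime
    (dvd_mul_left E (P₁ ^ a * P₂ ^ b)) hEG hnormE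
  have hhG : h (P₁ ^ a * P₂ ^ b * E) = β₁ ^ a * β₂ ^ b * h E := by
    rw [hhmul _ _ ((h₁.pow a).mul (h₂.pow b)) hE, hhmul _ _ (h₁.pow a) (h₂.pow b),
      map_pow_of_monic hh1 hhmul h₁, map_pow_of_monic hh1 hhmul h₂]
  have hgG : g (P₁ ^ a * P₂ ^ b * E) =
      χ (P₁ ^ a * P₂ ^ b * E) * h (P₁ ^ a * P₂ ^ b * E) := by
    simp only [hh]
    rw [mul_left_comm, Complex.mul_conj', ht.norm_char_eq_one hGQ]
    simp
  rw [ht₁, ht₂, ht.map_mul _ _ hA hG, hgG, hhG]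
  set z := χ (P₁ ^ a * P₂ ^ b * E)
  have hz : ‖z‖ = 1 := ht.norm_char_eq_one hGQ
  rw [show g A * (z * (β₁ ^ a * β₂ ^ b * h E)) -
      exp (centre τ w n * I) * (g A * z * (β₁ ^ a * β₂ ^ b)) =
      g A * z * (β₁ ^ a * β₂ ^ b) * (h E - exp (centre τ w n * I)) by ring, norm_mul, norm_mul,
    norm_mul, norm_mul, norm_pow, norm_pow, hβ₁n, hβ₂n, hz, ht.norm_eq_one _ hA]
  simp only [one_pow, one_mul]
  linarith

end PointwiseComparison

section Windows

lemma truncPow_periodic (P : k[X]) (β : ℂ) (J : ℕ) : PeriodicMod (P ^ J) (truncPow P β J) := by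
  intro x y
  unfold truncPow
  congr 1
  refine Finset.sum_congr rfl fun i hi => ?_
  rw [(ind_periodic ℂ (P ^ (i + 1))).of_dvd (pow_dvd_pow P (Finset.mem_range.1 hi)) x y]

lemma mean_comm {K : Type*} [Field K] (n m : ℕ) (a : k[X] → k[X] → K) :
    mean n (fun x => mean m (fun z => a x z)) = mean m (fun z => mean n (fun x => a x z)) := by
  unfold mean
  rw [← Finset.sum_div, ← Finset.sum_div, Finset.sum_comm, div_right_comm]

lemma sq_norm_sub_le {s t : ℂ} {K e : ℝ} (hs : ‖s‖ ≤ K) (ht : ‖t‖ ≤ K) (hst : ‖s - t‖ ≤ e) :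
    ‖t‖ ^ 2 - 2 * K * e ≤ ‖s‖ ^ 2 := by
  have h1 : ‖t‖ ≤ ‖s‖ + e := by
    have := norm_sub_norm_le t s
    rw [norm_sub_rev] at this
    linarith
  have h2 := norm_nonneg s
  have h3 := norm_nonneg t
  have he : 0 ≤ e := (norm_nonneg _).trans hst
  by_cases hle : ‖t‖ ≤ ‖s‖
  · nlinarith [mul_nonneg (h2.trans hs) he]
  · push Not at hle
    nlinarith

/-- A lower bound for a second moment follows from lower bounds for an approximation in almost all
windows. -/
lemma le_mean_norm_sq_of_windows {n n₁ : ℕ} {V : k[X]}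
    (hV : ∀ z ∈ polysLT k n₁, V * z ∈ polysLT k n) {S : k[X] → ℂ} {T : k[X] → k[X] → ℂ}
    {err : k[X] → k[X] → ℝ} {b K e : ℝ} (hS : ∀ x ∈ polysLT k n, ‖S x‖ ≤ K)
    (hT : ∀ x ∈ polysLT k n, ∀ z ∈ polysLT k n₁, ‖T x z‖ ≤ K)
    (hb : ∀ x ∈ polysLT k n, b ≤ mean n₁ (fun z => ‖T x z‖ ^ 2))
    (hST : ∀ x ∈ polysLT k n, ∀ z ∈ polysLT k n₁, ‖S (x + V * z) - T x z‖ ≤ err x z)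
    (he : ∀ z ∈ polysLT k n₁, mean n (fun x => err x z) ≤ e) (hK : 0 ≤ K) :
    b - 2 * K * e ≤ mean n (fun x => ‖S x‖ ^ 2) := by
  have hadd : ∀ x ∈ polysLT k n, ∀ z ∈ polysLT k n₁, x + V * z ∈ polysLT k n := by
    intro x hx z hz
    rw [← sub_neg_eq_add]
    exact sub_mem_polysLT hx (by simpa using hV z hz)
  calc b - 2 * K * e ≤ mean n (fun x => mean n₁ (fun z => ‖T x z‖ ^ 2)) -
        mean n₁ (fun z => 2 * K * mean n (fun x => err x z)) := by
        refine sub_le_sub ?_ ?_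
        · rw [← mean_const (k := k) n b]
          exact mean_mono hb
        · rw [← mean_const (k := k) n₁ (2 * K * e)]
          exact mean_mono fun z hz => by gcongr; exact he z hz
    _ = mean n₁ (fun z => mean n (fun x => ‖T x z‖ ^ 2 - 2 * K * err x z)) := by
        rw [mean_comm, ← mean_sub]
        simp only [mean_sub, mean_const_mul]
    _ ≤ mean n₁ (fun z => mean n (fun x => ‖S (x + V * z)‖ ^ 2)) :=
        mean_mono fun z hz => mean_mono fun x hx =>
          sq_norm_sub_le (hS _ (hadd x hx z hz)) (hT x hx z hz) (hST x hx z hz)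
    _ ≤ mean n₁ (fun _ : k[X] => mean n (fun x => ‖S x‖ ^ 2)) :=
        mean_mono fun z hz => (mean_translate (hV z hz) (fun x => ‖S x‖ ^ 2)).le
    _ = _ := mean_const _ _

variable {P₁ P₂ : k[X]}

lemma le_mean_norm_sq_truncPow_affine (h₁ : P₁.Monic) (h₂ : P₂.Monic)
    (hco : IsCoprime P₁ P₂) (hd₁ : 2 ≤ P₁.natDegree) (hd₂ : 2 ≤ P₂.natDegree) {β₁ β₂ : ℂ}
    (hβ₁ : ‖β₁‖ = 1) (hβ₂ : ‖β₂‖ = 1) {u : k[X] → ℂ} {m J : ℕ}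
    (hu : ∀ M ∈ polysLT k (m * P₁.natDegree * P₂.natDegree), ‖u M‖ = 1)
    (hJ₁ : P₁.natDegree * m + 1 ≤ J) (hJ₂ : P₂.natDegree * m + 1 ≤ J) {V : k[X]}
    (hV₁ : IsCoprime P₁ V) (hV₂ : IsCoprime P₂ V) (A : k[X]) :
    (m + 1) * ((‖β₁ - 1‖ / 2) ^ 2 * (‖β₂ - 1‖ / 2) ^ 2 *
      (((Fintype.card k : ℝ) ^ P₁.natDegree)⁻¹ * (1 - ((Fintype.card k : ℝ) ^ P₁.natDegree)⁻¹) *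
      (((Fintype.card k : ℝ) ^ P₂.natDegree)⁻¹ *
        (1 - ((Fintype.card k : ℝ) ^ P₂.natDegree)⁻¹)))) ≤
    mean (J * P₁.natDegree + J * P₂.natDegree)
      (fun z => ‖∑ M ∈ polysLT k (m * P₁.natDegree * P₂.natDegree),
        u M * (truncPow P₁ β₁ J (A + V * z + M) * truncPow P₂ β₂ J (A + V * z + M))‖ ^ 2) := by
  refine (le_mean_norm_sq_truncPow h₁ h₂ hco hd₁ hd₂ hβ₁ hβ₂ hu hJ₁ hJ₂ le_rfl).trans
    (le_of_eq ?_)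
  have hR : (P₁ ^ J * P₂ ^ J).Monic := (h₁.pow J).mul (h₂.pow J)
  have hRd : (P₁ ^ J * P₂ ^ J).natDegree = J * P₁.natDegree + J * P₂.natDegree := by
    rw [(h₁.pow J).natDegree_mul (h₂.pow J), h₁.natDegree_pow, h₂.natDegree_pow]
  have hper : PeriodicMod (P₁ ^ J * P₂ ^ J) (fun x : k[X] =>
      ‖∑ M ∈ polysLT k (m * P₁.natDegree * P₂.natDegree),
        u M * (truncPow P₁ β₁ J (x + M) * truncPow P₂ β₂ J (x + M))‖ ^ 2) := by
    intro x y
    beta_reduce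
    congr 2
    refine Finset.sum_congr rfl fun M _ => ?_
    rw [show x + P₁ ^ J * P₂ ^ J * y + M = x + M + P₁ ^ J * P₂ ^ J * y by ring,
      (truncPow_periodic P₁ β₁ J).of_dvd (dvd_mul_right _ (P₂ ^ J)),
      (truncPow_periodic P₂ β₂ J).of_dvd (dvd_mul_left _ (P₁ ^ J))]
  have := mean_affine hR (L := V) (hV₁.pow_left.mul_left hV₂.pow_left) hper A hRd.le
  rw [this, hRd]

end Windows

section Modulus

variable {Q P₁ P₂ : k[X]}

/-- A factorization `X ^ H + M = A * c`, `L = A * B` in which `A` collects the prime factors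
different from `P₁` and `P₂`, and `B` has exactly the remaining prime factors of degree at
most `w`. -/
structure IsSplitting (Q P₁ P₂ L : k[X]) (H w : ℕ) (M A B c : k[X]) : Prop where
  add_eq : X ^ H + M = A * c
  modulus_eq : L = A * B
  monic_left : A.Monic
  not_dvd_left : ¬ P₁ ∣ A
  not_dvd_left' : ¬ P₂ ∣ A
  dvd_right : Q ∣ B
  coprime : IsCoprime c B
  dvd_of_natDegree_le : ∀ P : k[X], P.Monic → Irreducible P → P.natDegree ≤ w → P ≠ P₁ → P ≠ P₂ →
    P ∣ B
  coprime_of_lt_natDegree : ∀ P : k[X], P.Monic → Irreducible P → w < P.natDegree → IsCoprime P B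

lemma exists_isSplitting (hQ : Q.Monic) (hi₁ : Irreducible P₁) (hi₂ : Irreducible P₂)
    (h₁ : P₁.Monic) (h₂ : P₂.Monic) (hQ₁ : ¬ P₁ ∣ Q) (hQ₂ : ¬ P₂ ∣ Q) {H w : ℕ}
    (hH : H ≤ w) (hQw : Q.natDegree ≤ w) :
    ∃ L : k[X], L.Monic ∧ IsCoprime P₁ L ∧ IsCoprime P₂ L ∧ Q ∣ L ∧
      ∃ A B c : k[X] → k[X], ∀ M ∈ polysLT k H,
        IsSplitting Q P₁ P₂ L H w M (A M) (B M) (c M) := by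
  classical
  have hex : ∀ M : k[X], ∃ (a b : ℕ) (E : k[X]), M ∈ polysLT k H →
      X ^ H + M = P₁ ^ a * P₂ ^ b * E ∧ E.Monic ∧ ¬ P₁ ∣ E ∧ ¬ P₂ ∣ E := by
    intro M
    by_cases hM : M ∈ polysLT k H
    · obtain ⟨a, b, E, hE⟩ :=
        exists_eq_pow_mul_pow_mul hi₁ hi₂ h₁ h₂ (monic_X_pow_add_of_mem hM)
      exact ⟨a, b, E, fun _ => hE⟩
    · exact ⟨0, 0, 0, fun h => absurd h hM⟩
  choose a b A hA using hex
  set T := (primesIoc k 0 w).filter (fun P => P ≠ P₁ ∧ P ≠ P₂) with hT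
  set R : k[X] := Q * ∏ P ∈ T, P with hR
  have hTm : ∀ P ∈ T, P.Monic ∧ Irreducible P ∧ P.natDegree ≤ w ∧ P ≠ P₁ ∧ P ≠ P₂ := by
    intro P hP
    rw [hT, Finset.mem_filter, mem_primesIoc] at hP
    exact ⟨hP.1.1, hP.1.2.1, hP.1.2.2.2, hP.2⟩
  have hRm : R.Monic := hQ.mul (monic_prod_of_monic _ _ fun P hP => (hTm P hP).1)
  set B : k[X] → k[X] := fun M => R * ∏ M' ∈ (polysLT k H).erase M, A M' with hB
  set L : k[X] := R * ∏ M ∈ polysLT k H, A M with hL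
  have hLm : L.Monic := hRm.mul (monic_prod_of_monic _ _ fun M hM => (hA M hM).2.1)
  have hLB : ∀ M ∈ polysLT k H, L = A M * B M := by
    intro M hM
    rw [hL, hB, ← Finset.mul_prod_erase _ _ hM]
    ring
  have hnot : ∀ P : k[X], Irreducible P → ¬ P ∣ Q → (∀ P' ∈ T, ¬ P ∣ P') →
      (∀ M ∈ polysLT k H, ¬ P ∣ A M) → ¬ P ∣ L := by
    intro P hi hPQ hPT hPA hd
    rcases hi.prime.dvd_or_dvd hd with hd | hd
    · rcases hi.prime.dvd_or_dvd hd with hd | hd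
      · exact hPQ hd
      · obtain ⟨P', hP', hd⟩ := (hi.prime.dvd_finsetProd_iff _).1 hd
        exact hPT P' hP' hd
    · obtain ⟨M, hM, hd⟩ := (hi.prime.dvd_finsetProd_iff _).1 hd
      exact hPA M hM hd
  have heq : ∀ {P P' : k[X]}, P.Monic → P'.Monic → Irreducible P → Irreducible P' → P ∣ P' →
      P' = P := fun hP hP' hi hi' hd =>
    (eq_of_monic_of_associated hP hP' (hi.associated_of_dvd hi' hd)).symm
  have hL₁ : IsCoprime P₁ L := (hi₁.coprime_iff_not_dvd).2 <| hnot P₁ hi₁ hQ₁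
    (fun P' hP' hd => (hTm P' hP').2.2.2.1 (heq h₁ (hTm P' hP').1 hi₁ (hTm P' hP').2.1 hd))
    (fun M hM => (hA M hM).2.2.1)
  have hL₂ : IsCoprime P₂ L := (hi₂.coprime_iff_not_dvd).2 <| hnot P₂ hi₂ hQ₂
    (fun P' hP' hd => (hTm P' hP').2.2.2.2 (heq h₂ (hTm P' hP').1 hi₂ (hTm P' hP').2.1 hd))
    (fun M hM => (hA M hM).2.2.2)
  have hLw : ∀ P : k[X], P.Monic → Irreducible P → w < P.natDegree → IsCoprime P L := by
    intro P hP hi hPw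
    have hle : ∀ {G : k[X]}, G.Monic → G.natDegree ≤ w → ¬ P ∣ G := fun hG hGw hd => by
      have := natDegree_le_of_dvd hd hG.ne_zero
      omega
    refine (hi.coprime_iff_not_dvd).2 (hnot P hi (hle hQ hQw)
      (fun P' hP' => hle (hTm P' hP').1 (hTm P' hP').2.2.1) fun M hM => ?_)
    refine hle (hA M hM).2.1 ?_
    have h1 := natDegree_X_pow_add_of_mem hM
    have h2 : (A M).natDegree ≤ (X ^ H + M).natDegree :=
      natDegree_le_of_dvd ((hA M hM).1 ▸ dvd_mul_left _ _) (monic_X_pow_add_of_mem hM).ne_zero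
    omega
  refine ⟨L, hLm, hL₁, hL₂, (dvd_mul_right Q _).mul_right _, A, B,
    fun M => P₁ ^ a M * P₂ ^ b M, fun M hM => ?_⟩
  have hBL : B M ∣ L := hLB M hM ▸ dvd_mul_left _ _
  exact
    { add_eq := by rw [(hA M hM).1]; ring
      modulus_eq := hLB M hM
      monic_left := (hA M hM).2.1
      not_dvd_left := (hA M hM).2.2.1
      not_dvd_left' := (hA M hM).2.2.2
      dvd_right := (dvd_mul_right Q _).mul_right _
      coprime := (hL₁.of_isCoprime_of_dvd_right hBL).pow_left.mul_left
        (hL₂.of_isCoprime_of_dvd_right hBL).pow_left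
      dvd_of_natDegree_le := fun P hP hi hPw hne₁ hne₂ => by
        refine Dvd.dvd.mul_right (Dvd.dvd.mul_left (Finset.dvd_prod_of_mem _ ?_) Q) _
        rw [hT, Finset.mem_filter, mem_primesIoc]
        exact ⟨⟨hP, hi, hi.natDegree_pos, hPw⟩, hne₁, hne₂⟩
      coprime_of_lt_natDegree := fun P hP hi hPw =>
        (hLw P hP hi hPw).of_isCoprime_of_dvd_right hBL }

variable {L M A B c : k[X]} {H w : ℕ}

lemma IsSplitting.add_mul_eq (hs : IsSplitting Q P₁ P₂ L H w M A B c) (Y : k[X]) :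
    X ^ H + L * Y + M = A * (c + B * Y) := by
  rw [add_right_comm, hs.add_eq, hs.modulus_eq]
  ring

lemma IsSplitting.isCoprime_add (hs : IsSplitting Q P₁ P₂ L H w M A B c) (Y : k[X]) :
    IsCoprime (c + B * Y) Q :=
  (IsCoprime.add_mul_left_left hs.coprime Y).of_isCoprime_of_dvd_right hs.dvd_right

lemma IsSplitting.lt_natDegree (hs : IsSplitting Q P₁ P₂ L H w M A B c) {Y P : k[X]} (hP : P.Monic)
    (hi : Irreducible P) (hd : P ∣ c + B * Y) (hne₁ : P ≠ P₁) (hne₂ : P ≠ P₂) :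
    w < P.natDegree := by
  by_contra! hle
  have hB := hs.dvd_of_natDegree_le P hP hi hle hne₁ hne₂
  exact hi.not_isUnit (hs.coprime.isUnit_of_dvd' ((dvd_add_left (hB.mul_right Y)).1 hd) hB)

end Modulus

section SecondMoment

variable {Q P₁ P₂ : k[X]} {χ g : k[X] → ℂ} {τ : k[X] → ℝ} {w₀ : ℕ}

lemma norm_sum_polysLT_le {H : ℕ} {a : k[X] → ℂ} (ha : ∀ M ∈ polysLT k H, ‖a M‖ ≤ 1) :
    ‖∑ M ∈ polysLT k H, a M‖ ≤ (Fintype.card k : ℝ) ^ H := by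
  refine (norm_sum_le_of_le _ ha).trans (le_of_eq ?_)
  rw [Finset.sum_const, card_polysLT, nsmul_eq_mul, mul_one]
  push_cast
  rfl

lemma IsTwist.norm_mul_conj_eq_one (ht : IsTwist Q χ g τ w₀) {P : k[X]} (hP : P.Monic)
    (hi : Irreducible P) (hPQ : ¬ P ∣ Q) : ‖g P * conj (χ P)‖ = 1 := by
  rw [norm_mul, RCLike.norm_conj, ht.norm_eq_one _ hP,
    ht.norm_char_eq_one ((hi.coprime_iff_not_dvd).2 hPQ), one_mul]

/-- If `g` is twisted at two irreducibles `P₁` and `P₂`, then its sums over short intervals are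
unbounded. -/
theorem IsTwist.exists_le_norm_sum (ht : IsTwist Q χ g τ w₀) (hi₁ : Irreducible P₁)
    (hi₂ : Irreducible P₂) (h₁ : P₁.Monic) (h₂ : P₂.Monic) (hne : P₁ ≠ P₂) (hQ₁ : ¬ P₁ ∣ Q)
    (hQ₂ : ¬ P₂ ∣ Q) (hd₁ : 2 ≤ P₁.natDegree) (hd₂ : 2 ≤ P₂.natDegree)
    (hβ₁ : g P₁ * conj (χ P₁) ≠ 1) (hβ₂ : g P₂ * conj (χ P₂) ≠ 1) (K : ℝ) (H₀ : ℕ) :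
    ∃ H, H₀ ≤ H ∧ ∃ N₀ : ℕ, ∀ N, N₀ ≤ N → ∃ G₀ : k[X], G₀.Monic ∧ G₀.natDegree = N ∧
      K ≤ ‖∑ M ∈ polysLT k H, g (G₀ + M)‖ := by
  have hq2 : (2 : ℝ) ≤ Fintype.card k := two_le_card
  have hβ₁n := ht.norm_mul_conj_eq_one h₁ hi₁ hQ₁
  have hβ₂n := ht.norm_mul_conj_eq_one h₂ hi₂ hQ₂
  set β₁ := g P₁ * conj (χ P₁) with hβ₁d
  set β₂ := g P₂ * conj (χ P₂) with hβ₂d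
  have hlt : ∀ d : ℕ, 2 ≤ d → 0 < 1 - ((Fintype.card k : ℝ) ^ d)⁻¹ := fun d hd => by
    rw [sub_pos]
    exact inv_lt_one_of_one_lt₀ (one_lt_pow₀ (by linarith) (by omega))
  have hco : IsCoprime P₁ P₂ := isCoprime_of_irreducible_of_ne h₁ h₂ hi₁ hi₂ hne
  obtain ⟨κ, hκ0, hκ⟩ : ∃ κ : ℝ, 0 < κ ∧ κ = (‖β₁ - 1‖ / 2) ^ 2 * (‖β₂ - 1‖ / 2) ^ 2 *
      (((Fintype.card k : ℝ) ^ P₁.natDegree)⁻¹ * (1 - ((Fintype.card k : ℝ) ^ P₁.natDegree)⁻¹) *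
      (((Fintype.card k : ℝ) ^ P₂.natDegree)⁻¹ *
        (1 - ((Fintype.card k : ℝ) ^ P₂.natDegree)⁻¹))) := by
    refine ⟨_, ?_, rfl⟩
    have e1 := hlt _ hd₁
    have e2 := hlt _ hd₂
    have e3 : 0 < ‖β₁ - 1‖ := norm_pos_iff.2 (sub_ne_zero.2 hβ₁)
    have e4 : 0 < ‖β₂ - 1‖ := norm_pos_iff.2 (sub_ne_zero.2 hβ₂)
    positivity
  obtain ⟨m, hm⟩ := exists_nat_ge ((K ^ 2 + 1) / κ + H₀)
  have hmK : K ^ 2 + 1 ≤ (m + 1) * κ := by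
    rw [← div_le_iff₀ hκ0]
    have : (0 : ℝ) ≤ H₀ := by positivity
    linarith
  have hmH : H₀ ≤ m := by
    have : 0 ≤ (K ^ 2 + 1) / κ := by positivity
    exact_mod_cast (by linarith : (H₀ : ℝ) ≤ m)
  set H := m * P₁.natDegree * P₂.natDegree with hH
  have hHm : m ≤ H := by
    rw [hH, mul_assoc]
    exact Nat.le_mul_of_pos_right _ (by positivity)
  refine ⟨H, hmH.trans hHm, ?_⟩
  set q : ℝ := (Fintype.card k : ℝ) with hq
  set η : ℝ := 1 / (12 * (q ^ H * q ^ H)) with hη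
  have hq0 : 0 < q := by linarith
  have hη0 : 0 < η := by positivity
  obtain ⟨j₀, hj₀⟩ := exists_inv_card_pow_le k hη0
  set J := j₀ + P₁.natDegree * m + P₂.natDegree * m + 1 with hJ
  obtain ⟨w₁, hw₁⟩ := exists_mean_deviation_le ht.tails hη0
  set w := w₁ + w₀ + H + P₁.natDegree + P₂.natDegree with hw
  obtain ⟨L, hLm, hL₁, hL₂, hQL, A, B, c, hs⟩ := exists_isSplitting ht.monic hi₁ hi₂ h₁ h₂ hQ₁ hQ₂
    (H := H) (w := w) (by omega) (by have := ht.natDegree_le; omega)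
  have hdev : ∀ M : k[X], ∃ n₀ : ℕ, M ∈ polysLT k H → ∀ n, n₀ ≤ n → ∀ A' : k[X],
      mean n (fun x => deviation τ w n L.natDegree (A' + B M * x)) ≤ η := by
    intro M
    by_cases hM : M ∈ polysLT k H
    · obtain ⟨n₀, hn₀⟩ := hw₁ w (by omega) (B M) (hs M hM).coprime_of_lt_natDegree L.natDegree
      exact ⟨n₀, fun _ => hn₀⟩
    · exact ⟨0, fun h => absurd h hM⟩
  choose nd hnd using hdev
  have hb : ∀ M, ‖χ M‖ ≤ 1 := ht.char.norm_le_one fun M hM => ht.norm_char_eq_one hM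
  have hshift : ∀ e : k[X], ∃ n₀ : ℕ, ∀ n, n₀ ≤ n → ∀ A' B' : k[X], B' ∣ L →
      mean n (fun y => ‖χ (A' + B' * y + Q * (L * e)) - χ (A' + B' * y)‖) ≤ η := fun e =>
    ht.char.exists_mean_shift_le hb hLm hQL e hη0
  choose ns hns using hshift
  set n₁ := J * P₁.natDegree + J * P₂.natDegree with hn₁
  set nD := ∑ M ∈ polysLT k H, nd M with hnD
  set nS := ∑ M ∈ polysLT k H, ∑ z ∈ polysLT k n₁, ns (B M * z) with hnS
  refine ⟨L.natDegree + (nD + nS + 2 * w + Q.natDegree + L.natDegree + n₁ + H + 1),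
    fun N hN => ?_⟩
  obtain ⟨n, rfl⟩ := Nat.exists_eq_add_of_le ((Nat.le_add_right _ _).trans hN)
  have hn : nD + nS + 2 * w + Q.natDegree + L.natDegree + n₁ + H + 1 ≤ n := by omega
  clear hN
  have hV : ∀ z ∈ polysLT k n₁, Q * L * z ∈ polysLT k n := by
    intro z hz
    rw [mem_polysLT] at hz ⊢
    rcases eq_or_ne z 0 with rfl | hz0
    · simp
    rw [degree_eq_natDegree hz0] at hz
    have hzd : z.natDegree < n₁ := by exact_mod_cast hz
    have hQLm := ht.monic.mul hLm
    rw [degree_eq_natDegree (mul_ne_zero hQLm.ne_zero hz0),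
      natDegree_mul hQLm.ne_zero hz0, ht.monic.natDegree_mul hLm]
    exact_mod_cast (by omega : Q.natDegree + L.natDegree + z.natDegree < n)
  have hdegL : ∀ {x M : k[X]}, x ∈ polysLT k n → M ∈ polysLT k H →
      (X ^ H + M).degree < (L * (X ^ n + x)).degree := by
    intro x M hx hM
    rw [degree_eq_natDegree (monic_X_pow_add_of_mem hM).ne_zero, natDegree_X_pow_add_of_mem hM,
      degree_eq_natDegree (hLm.mul (monic_X_pow_add_of_mem hx)).ne_zero,
      hLm.natDegree_mul (monic_X_pow_add_of_mem hx), natDegree_X_pow_add_of_mem hx]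
    exact_mod_cast (by omega : H < L.natDegree + n)
  have hGm : ∀ {x M : k[X]}, x ∈ polysLT k n → M ∈ polysLT k H →
      (X ^ H + L * (X ^ n + x) + M).Monic ∧
        (X ^ H + L * (X ^ n + x) + M).natDegree = L.natDegree + n := by
    intro x M hx hM
    rw [show X ^ H + L * (X ^ n + x) + M = L * (X ^ n + x) + (X ^ H + M) by ring]
    refine ⟨(hLm.mul (monic_X_pow_add_of_mem hx)).add_of_left (hdegL hx hM), ?_⟩
    rw [natDegree_add_eq_left_of_degree_lt (hdegL hx hM),
      hLm.natDegree_mul (monic_X_pow_add_of_mem hx), natDegree_X_pow_add_of_mem hx]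
  have hG'm : ∀ {x M : k[X]}, x ∈ polysLT k n → M ∈ polysLT k H →
      (c M + B M * (X ^ n + x)).Monic ∧
        (c M + B M * (X ^ n + x)).natDegree ≤ n + L.natDegree := by
    intro x M hx hM
    have hG := hGm hx hM
    rw [(hs M hM).add_mul_eq] at hG
    refine ⟨(hs M hM).monic_left.of_mul_monic_left hG.1, ?_⟩
    have := natDegree_le_of_dvd (dvd_mul_left (c M + B M * (X ^ n + x)) (A M)) hG.1.ne_zero
    omega
  have hadd : ∀ x ∈ polysLT k n, ∀ z ∈ polysLT k n₁, x + Q * L * z ∈ polysLT k n := by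
    intro x hx z hz
    rw [← sub_neg_eq_add]
    exact sub_mem_polysLT hx (by simpa using hV z hz)
  set S : k[X] → ℂ := fun x => ∑ M ∈ polysLT k H, g (X ^ H + L * (X ^ n + x) + M) with hS
  set u : k[X] → k[X] → ℂ := fun x M => g (A M) * χ (c M + B M * (X ^ n + x)) with hu
  set p : k[X] → ℂ := fun G => truncPow P₁ β₁ J G * truncPow P₂ β₂ J G with hp
  set ω : ℂ := exp (centre τ w n * I) with hω
  have hωn : ‖ω‖ = 1 := Complex.norm_exp_ofReal_mul_I _
  set T : k[X] → k[X] → ℂ := fun x z => ω * ∑ M ∈ polysLT k H,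
    u x M * p (X ^ H + L * (X ^ n + x) + L * (Q * L) * z + M) with hT
  set err : k[X] → k[X] → ℝ := fun x z => ∑ M ∈ polysLT k H,
    (2 * ind ℝ (P₁ ^ J) (X ^ H + M + L * (X ^ n + Q * L * z) + L * x) +
      2 * ind ℝ (P₂ ^ J) (X ^ H + M + L * (X ^ n + Q * L * z) + L * x) +
      deviation τ w n L.natDegree (c M + B M * (X ^ n + Q * L * z) + B M * x) +
      ‖χ (c M + B M * X ^ n + B M * x + Q * (L * (B M * z))) -
        χ (c M + B M * X ^ n + B M * x)‖) with herr
  have hun : ∀ x, ∀ M ∈ polysLT k H, ‖u x M‖ = 1 := by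
    intro x M hM
    rw [hu, norm_mul, ht.norm_eq_one _ (hs M hM).monic_left,
      ht.norm_char_eq_one ((hs M hM).isCoprime_add _), one_mul]
  have hpn : ∀ G, ‖p G‖ = 1 := fun G => by
    rw [hp, norm_mul, norm_truncPow hβ₁n J hi₁, norm_truncPow hβ₂n J hi₂, one_mul]
  have hmain : (m + 1) * κ - 2 * q ^ H * (q ^ H * (6 * η)) ≤ mean n (fun x => ‖S x‖ ^ 2) := by
    refine le_mean_norm_sq_of_windows hV (T := T) (err := err) (fun x hx => ?_)
      (fun x hx z hz => ?_) (fun x hx => ?_) (fun x hx z hz => ?_) (fun z hz => ?_) (by positivity)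
    · exact norm_sum_polysLT_le fun M hM => (ht.norm_eq_one _ (hGm hx hM).1).le
    · rw [hT, norm_mul, hωn, one_mul]
      exact norm_sum_polysLT_le fun M hM => by rw [norm_mul, hun x M hM, hpn, one_mul]
    · have hLQ₁ : IsCoprime P₁ (L * (Q * L)) :=
        hL₁.mul_right (((hi₁.coprime_iff_not_dvd).2 hQ₁).mul_right hL₁)
      have hLQ₂ : IsCoprime P₂ (L * (Q * L)) :=
        hL₂.mul_right (((hi₂.coprime_iff_not_dvd).2 hQ₂).mul_right hL₂)
      have := le_mean_norm_sq_truncPow_affine h₁ h₂ hco hd₁ hd₂ hβ₁n hβ₂n (u := u x) (m := m)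
        (J := J) (hun x) (by omega) (by omega) hLQ₁ hLQ₂ (X ^ H + L * (X ^ n + x))
      rw [← hq, ← hκ] at this
      simpa only [hT, hp, norm_mul, hωn, one_mul] using this
    · rw [hS, hT, herr]
      beta_reduce
      rw [Finset.mul_sum, ← Finset.sum_sub_distrib]
      refine norm_sum_le_of_le _ fun M hM => ?_
      have hsM := hs M hM
      have hx' := hadd x hx z hz
      have hcmp := ht.norm_sub_exp_mul_le hi₁ hi₂ h₁ h₂ hne hQ₁ hQ₂ (w := w) (n := n)
        (l := L.natDegree) (J := J) (by omega) (by omega) (by omega) (by omega)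
        hsM.monic_left hsM.not_dvd_left hsM.not_dvd_left' (hG'm hx' hM).1 (hG'm hx' hM).2
        (hsM.isCoprime_add _) (fun P hP hi hd => hsM.lt_natDegree hP hi hd)
      rw [← hsM.add_mul_eq] at hcmp
      have e1 : X ^ H + L * (X ^ n + (x + Q * L * z)) + M =
          X ^ H + M + L * (X ^ n + Q * L * z) + L * x := by ring
      have e2 : X ^ H + L * (X ^ n + x) + L * (Q * L) * z + M =
          X ^ H + M + L * (X ^ n + Q * L * z) + L * x := by ring
      have e3 : c M + B M * (X ^ n + (x + Q * L * z)) =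
          c M + B M * (X ^ n + Q * L * z) + B M * x := by ring
      have e4 : c M + B M * X ^ n + B M * x + Q * (L * (B M * z)) =
          c M + B M * (X ^ n + Q * L * z) + B M * x := by ring
      have e5 : c M + B M * X ^ n + B M * x = c M + B M * (X ^ n + x) := by ring
      rw [e1, e3] at hcmp
      rw [e1, e2, e4, e5]
      set G := X ^ H + M + L * (X ^ n + Q * L * z) + L * x
      set G' := c M + B M * (X ^ n + Q * L * z) + B M * x
      refine (norm_sub_le_norm_sub_add_norm_sub _
        (ω * (g (A M) * χ G' * p G)) _).trans (add_le_add hcmp (le_of_eq ?_))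
      rw [hu, show ω * (g (A M) * χ G' * p G) - ω * (g (A M) * χ (c M + B M * (X ^ n + x)) * p G) =
        ω * (g (A M) * p G) * (χ G' - χ (c M + B M * (X ^ n + x))) by ring, norm_mul, norm_mul,
        norm_mul, hωn, hpn, ht.norm_eq_one _ hsM.monic_left, one_mul, one_mul, one_mul]
    · rw [herr, mean_sum]
      refine (Finset.sum_le_card_nsmul _ _ (6 * η) fun M hM => ?_).trans (le_of_eq ?_)
      · have hind : ∀ P : k[X], P.Monic → 2 ≤ P.natDegree → IsCoprime P L → J * P.natDegree ≤ n →
            mean n (fun x => ind ℝ (P ^ J) (X ^ H + M + L * (X ^ n + Q * L * z) + L * x)) ≤ η := by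
          intro P hP hPd hPL hPn
          rw [mean_ind_affine (hP.pow J) hPL.pow_left _ (by rwa [hP.natDegree_pow]),
            hP.natDegree_pow]
          exact hj₀ _ (le_trans (by omega) (Nat.le_mul_of_pos_right J (by omega)))
        have i1 := hind P₁ h₁ hd₁ hL₁ (by omega)
        have i2 := hind P₂ h₂ hd₂ hL₂ (by omega)
        have hle : nd M ≤ nD := Finset.single_le_sum (f := nd) (fun _ _ => Nat.zero_le _) hM
        have i3 := hnd M hM n (by omega) (c M + B M * (X ^ n + Q * L * z))
        have hle₁ : ns (B M * z) ≤ ∑ z ∈ polysLT k n₁, ns (B M * z) :=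
          Finset.single_le_sum (f := fun z => ns (B M * z)) (fun _ _ => Nat.zero_le _) hz
        have hle₂ : ∑ z ∈ polysLT k n₁, ns (B M * z) ≤ nS :=
          Finset.single_le_sum (f := fun M => ∑ z ∈ polysLT k n₁, ns (B M * z))
            (fun _ _ => Nat.zero_le _) hM
        have i4 := hns (B M * z) n (by omega) (c M + B M * X ^ n) (B M)
          ((hs M hM).modulus_eq ▸ dvd_mul_left _ _)
        simp only [mean_add, mean_const_mul]
        linarith
      · rw [card_polysLT, nsmul_eq_mul]
        push_cast
        rfl
  have hfin : K ^ 2 ≤ mean n (fun x => ‖S x‖ ^ 2) := by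
    refine le_trans ?_ hmain
    have : 2 * q ^ H * (q ^ H * (6 * η)) = 1 := by rw [hη]; field_simp; norm_num
    linarith
  obtain ⟨x, hx, hKx⟩ := exists_le_of_le_mean hfin
  have h0 : (0 : k[X]) ∈ polysLT k H := by simp [mem_polysLT]
  have hG0 := hGm hx h0
  rw [add_zero] at hG0
  exact ⟨X ^ H + L * (X ^ n + x), hG0.1, hG0.2,
    (le_abs_self K).trans (abs_le_of_sq_le_sq hKx (norm_nonneg _))⟩

end SecondMoment

section ShortIntervalCharacter

lemma pow_card_pow_eq_expand (A : k[X]) (n : ℕ) :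
    A ^ Fintype.card k ^ n = expand k (Fintype.card k ^ n) A := by
  induction n with
  | zero => simp
  | succ n ih => rw [pow_succ, pow_mul, ih, ← FiniteField.expand_card, expand_expand, mul_comm]

lemma topCoeff_pow_card_pow {A : k[X]} (hA : A.Monic) {ν i : ℕ} (hi : i ≤ ν) :
    topCoeff (A ^ Fintype.card k ^ ν) i = topCoeff 1 i := by
  set m := Fintype.card k ^ ν with hm
  have hlt : i < m := hi.trans_lt (Nat.lt_pow_self Fintype.one_lt_card)
  rcases Nat.eq_zero_or_pos i with rfl | hi0
  · simp [topCoeff, hA.leadingCoeff]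
  · have h1 : ¬ i ≤ (1 : k[X]).natDegree := by simp; omega
    rw [topCoeff, topCoeff, if_neg h1, pow_card_pow_eq_expand]
    split_ifs with h
    · rw [coeff_expand (by omega), if_neg]
      intro hd
      rw [natDegree_expand] at h hd
      have hdvd := (Nat.dvd_sub_iff_right h (Dvd.intro_left _ rfl)).1 hd
      exact absurd (Nat.le_of_dvd hi0 hdvd) (by omega)
    · rfl

variable {ν : ℕ} {ξ : k[X] → ℂ}

lemma IsShortIntervalCharacterOfLength.map_one (hξ : IsShortIntervalCharacterOfLength ν ξ) :
    ξ 1 = 1 := by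
  obtain ⟨A, hA, hne⟩ := hξ.2.1
  have h := hξ.1 A 1 hA monic_one
  rw [mul_one] at h
  exact mul_left_cancel₀ hne (by rw [← h, mul_one])

lemma IsShortIntervalCharacterOfLength.map_pow (hξ : IsShortIntervalCharacterOfLength ν ξ)
    {A : k[X]} (hA : A.Monic) (n : ℕ) : ξ (A ^ n) = ξ A ^ n := by
  induction n with
  | zero => simpa using hξ.map_one
  | succ n ih => rw [pow_succ, hξ.1 _ _ (hA.pow n) hA, ih, pow_succ]

lemma IsShortIntervalCharacterOfLength.norm_eq_one (hξ : IsShortIntervalCharacterOfLength ν ξ)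
    {A : k[X]} (hA : A.Monic) : ‖ξ A‖ = 1 := by
  have h := hξ.2.2 _ 1 (hA.pow (Fintype.card k ^ ν)) monic_one
    fun i hi => topCoeff_pow_card_pow hA hi
  rw [hξ.map_pow hA, hξ.map_one] at h
  exact norm_eq_one_of_pow_eq_one h (pow_ne_zero _ Fintype.card_ne_zero)

lemma IsShortIntervalCharacterOfLength.map_add (hξ : IsShortIntervalCharacterOfLength ν ξ)
    {G M : k[X]} {H : ℕ} (hG : G.Monic) (hM : M.degree < H) (hd : H + ν ≤ G.natDegree) :
    ξ (G + M) = ξ G := by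
  have hlt : M.degree < G.degree := by
    rw [degree_eq_natDegree hG.ne_zero]
    exact hM.trans_le (by exact_mod_cast (by omega))
  refine hξ.2.2 _ _ (hG.add_of_left hlt) hG fun i hi => ?_
  rw [topCoeff, topCoeff, natDegree_add_eq_left_of_degree_lt hlt, if_pos (by omega),
    if_pos (by omega), coeff_add, coeff_eq_zero_of_degree_lt (p := M), add_zero]
  exact hM.trans_le (by exact_mod_cast (by omega))

end ShortIntervalCharacter

section Archimedean

lemma eTheta_one (θ : ℝ) : eTheta θ (1 : k[X]) = 1 := by
  simp [eTheta]

lemma eTheta_mul (θ : ℝ) {G H : k[X]} (hG : G.Monic) (hH : H.Monic) :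
    eTheta θ (G * H) = eTheta θ G * eTheta θ H := by
  rw [eTheta, eTheta, eTheta, ← Complex.exp_add, hG.natDegree_mul hH]
  push_cast
  ring_nf

lemma norm_eTheta (θ : ℝ) (G : k[X]) : ‖eTheta θ G‖ = 1 := by
  rw [eTheta, show 2 * (Real.pi : ℂ) * Complex.I * (θ : ℂ) * (G.natDegree : ℂ) =
    ((2 * Real.pi * θ * G.natDegree : ℝ) : ℂ) * Complex.I by push_cast; ring]
  exact Complex.norm_exp_ofReal_mul_I _

lemma eTheta_add (θ : ℝ) {G M : k[X]} (h : M.degree < G.degree) :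
    eTheta θ (G + M) = eTheta θ G := by
  rw [eTheta, eTheta, natDegree_add_eq_left_of_degree_lt h]

end Archimedean

section Reduction

lemma shortIntervalSum_eq_sum (f : k[X] → ℂ) {H : ℕ} {G₀ : k[X]} (hG₀ : G₀.Monic)
    (hH : H ≤ G₀.natDegree) :
    shortIntervalSum f H G₀ = ∑ M ∈ polysLT k H, f (G₀ + M) := by
  classical
  have himage : {G : k[X] | G.Monic ∧ (G - G₀).degree < (H : WithBot ℕ)} =
      ((polysLT k H).image (G₀ + ·) : Finset k[X]) := by
    ext G
    simp only [Set.mem_ofPred_eq, Finset.coe_image, Set.mem_image, Finset.mem_coe, mem_polysLT]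
    constructor
    · rintro ⟨-, h⟩
      exact ⟨G - G₀, h, by ring⟩
    · rintro ⟨M, hM, rfl⟩
      have hlt : M.degree < G₀.degree := by
        rw [degree_eq_natDegree hG₀.ne_zero]
        exact hM.trans_le (by exact_mod_cast hH)
      exact ⟨hG₀.add_of_left hlt, by simpa using hM⟩
  rw [shortIntervalSum, himage, finsum_mem_coe_finset,
    Finset.sum_image fun _ _ _ _ h => add_left_cancel h]

lemma norm_shortIntervalSum_eq {f ξ : k[X] → ℂ} {ν H : ℕ}
    (hξ : IsShortIntervalCharacterOfLength ν ξ) (θ : ℝ) {G₀ : k[X]} (hG₀ : G₀.Monic)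
    (hH : H + ν ≤ G₀.natDegree) :
    ‖shortIntervalSum f H G₀‖ =
      ‖∑ M ∈ polysLT k H, f (G₀ + M) * conj (ξ (G₀ + M) * eTheta θ (G₀ + M))‖ := by
  have hsum : ∑ M ∈ polysLT k H, f (G₀ + M) * conj (ξ (G₀ + M) * eTheta θ (G₀ + M)) =
      (∑ M ∈ polysLT k H, f (G₀ + M)) * conj (ξ G₀ * eTheta θ G₀) := by
    rw [Finset.sum_mul]
    refine Finset.sum_congr rfl fun M hM => ?_
    have hM' := mem_polysLT.1 hM
    have hlt : M.degree < G₀.degree := by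
      rw [degree_eq_natDegree hG₀.ne_zero]
      exact hM'.trans_le (by exact_mod_cast (by omega))
    rw [hξ.map_add hG₀ hM' hH, eTheta_add θ hlt]
  rw [shortIntervalSum_eq_sum f hG₀ (by omega), hsum, norm_mul, RCLike.norm_conj, norm_mul,
    hξ.norm_eq_one hG₀, norm_eTheta, mul_one, mul_one]

lemma shortSumDisc_eq_top {f : k[X] → ℂ}
    (h : ∀ (K : ℝ) (H₀ : ℕ), ∃ H, H₀ ≤ H ∧ ∃ N₀ : ℕ, ∀ N, N₀ ≤ N → ∃ G₀ : k[X],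
      G₀.Monic ∧ G₀.natDegree = N ∧ K ≤ ‖shortIntervalSum f H G₀‖) :
    shortSumDisc f = ⊤ := by
  refine ENNReal.eq_top_of_forall_nnreal_le fun K => ?_
  refine le_limsup_of_frequently_le (frequently_atTop.2 fun H₀ => ?_)
  obtain ⟨H, hH, N₀, hN⟩ := h K H₀
  refine ⟨H, hH, le_limsup_of_frequently_le (Eventually.frequently ?_)⟩
  filter_upwards [eventually_ge_atTop N₀] with N hNN
  obtain ⟨G₀, hG₀, hd, hK⟩ := hN N hNN
  refine le_iSup₂_of_le G₀ ⟨hG₀, hd⟩ ?_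
  exact_mod_cast hK

lemma arg_sq_le {z : ℂ} (hz : ‖z‖ = 1) : z.arg ^ 2 ≤ Real.pi ^ 2 / 2 * (1 - z.re) := by
  have hcos : Real.cos z.arg = z.re := by
    rw [Complex.cos_arg (by rintro rfl; simp at hz), hz, div_one]
  have h := Real.cos_le_one_sub_mul_cos_sq (Complex.abs_arg_le_pi z)
  rw [hcos, div_mul_eq_mul_div, le_sub_comm, div_le_iff₀ (by positivity)] at h
  linarith

lemma isTwist_of_pretentious {f χ ξ : k[X] → ℂ} {Q : k[X]} {θ : ℝ} {ν : ℕ}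
    (hf : CompMultOnMonic f) (hu : UnimodularOnMonic f) (hQ : Q.Monic)
    (hχ : IsDirichletCharacter Q χ) (hξ : IsShortIntervalCharacterOfLength ν ξ)
    (hpret : Summable (fun P : {P : k[X] // P.Monic ∧ Irreducible P} =>
      ((Fintype.card k : ℝ) ^ (P : k[X]).natDegree)⁻¹ *
        (1 - (f (P : k[X]) *
          conj (χ (P : k[X]) * ξ (P : k[X]) * eTheta θ (P : k[X]))).re))) :
    IsTwist Q χ (fun G => f G * conj (ξ G * eTheta θ G))
      (fun P => (f P * conj (ξ P * eTheta θ P) * conj (χ P)).arg) Q.natDegree := by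
  have hnorm (G : k[X]) (hG : G.Monic) : ‖f G * conj (ξ G * eTheta θ G)‖ = 1 := by
    rw [norm_mul, RCLike.norm_conj, norm_mul, hu G hG, hξ.norm_eq_one hG, norm_eTheta]
    norm_num
  have hβ (P : k[X]) (hP : P.Monic) (hirr : Irreducible P) (hd : Q.natDegree < P.natDegree) :
      ‖f P * conj (ξ P * eTheta θ P) * conj (χ P)‖ = 1 := by
    have hcop : IsCoprime P Q := hirr.coprime_iff_not_dvd.2 fun hdvd =>
      absurd (natDegree_le_of_dvd hdvd hQ.ne_zero) (by omega)
    rw [norm_mul, hnorm P hP, RCLike.norm_conj, hχ.norm_eq_one hQ hcop, mul_one]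
  refine ⟨hχ, hQ, le_rfl, ?_, ?_, hnorm, ?_, ?_⟩
  · simp [hf.1, hξ.map_one, eTheta_one]
  · intro G H hG hH
    simp only [hf.2 G H hG hH, hξ.1 G H hG hH, eTheta_mul θ hG hH, map_mul]
    ring
  · intro P hP hirr hd
    have h := Complex.norm_mul_exp_arg_mul_I (f P * conj (ξ P * eTheta θ P) * conj (χ P))
    rw [hβ P hP hirr hd, Complex.ofReal_one, one_mul] at h
    exact h.symm
  · intro ε hε
    obtain ⟨w₀, hw₀⟩ := exists_sum_primesIoc_le (c := fun P =>
      ((Fintype.card k : ℝ) ^ P.natDegree)⁻¹ *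
        (1 - (f P * conj (χ P * ξ P * eTheta θ P)).re)) hpret
      (show 0 < ε / (Real.pi ^ 2 / 2) by positivity)
    refine ⟨max w₀ Q.natDegree, fun a ha b => ?_⟩
    have h := hw₀ a ((le_max_left _ _).trans ha) b
    rw [le_div_iff₀ (by positivity), Finset.sum_mul] at h
    refine le_trans (Finset.sum_le_sum fun P hP => ?_) h
    obtain ⟨hm, hirr, hd, -⟩ := mem_primesIoc.1 hP
    have hsq := arg_sq_le (hβ P hm hirr (((le_max_right _ _).trans ha).trans_lt hd))
    have heq : f P * conj (χ P * ξ P * eTheta θ P) =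
        f P * conj (ξ P * eTheta θ P) * conj (χ P) := by
      simp only [map_mul]
      ring
    rw [heq, mul_assoc, mul_comm (1 - _)]
    gcongr

lemma exists_mem_lt_natDegree {S : Set k[X]} (hS : S.Infinite) (n : ℕ) :
    ∃ P ∈ S, n < P.natDegree := by
  by_contra! h
  refine hS ((polysLT k (n + 1)).finite_toSet.subset fun P hP => ?_)
  rw [Finset.mem_coe, mem_polysLT]
  exact (degree_le_of_natDegree_le (h P hP)).trans_lt (by exact_mod_cast n.lt_succ_self)

end Reduction

/-- if `f : 𝓜 → S¹` is completely multiplicative, pretends to be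
`χ·ξ·e_θ` (i.e. `𝔻(f, χξe_θ; ∞) < ∞`) but differs from it at infinitely many
monic irreducibles, then the short sum discrepancy of `f` is infinite. -/
theorem shortSumDisc_infinite_of_infinitely_many_twists
    (f χ ξ : F[X] → ℂ) (Q : F[X]) (θ : ℝ)
    (hf : CompMultOnMonic f) (hu : UnimodularOnMonic f)
    (hQm : Q.Monic)
    (hχ : IsPrimitiveDirichletCharacter Q χ)
    (hξ : IsShortIntervalCharacter ξ)
    (hθ : θ ∈ Set.Icc (0 : ℝ) 1)
    (hpret : Summable (fun P : {P : F[X] // P.Monic ∧ Irreducible P} =>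
      ((Fintype.card F : ℝ) ^ (P : F[X]).natDegree)⁻¹ *
        (1 - (f (P : F[X]) *
          conj (χ (P : F[X]) * ξ (P : F[X]) * eTheta θ (P : F[X]))).re)))
    (hS : {P : F[X] | P.Monic ∧ Irreducible P ∧
        f P ≠ χ P * ξ P * eTheta θ P}.Infinite) :
    shortSumDisc f = ⊤ := by
  obtain ⟨ν, hν⟩ := hξ
  have ht := isTwist_of_pretentious (θ := θ) hf hu hQm hχ.1 hν hpret
  have hexists (n : ℕ) : ∃ P : F[X], n < P.natDegree ∧ P.Monic ∧ Irreducible P ∧ ¬ P ∣ Q ∧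
      2 ≤ P.natDegree ∧ f P * conj (ξ P * eTheta θ P) * conj (χ P) ≠ 1 := by
    obtain ⟨P, ⟨hm, hirr, hne⟩, hd⟩ := exists_mem_lt_natDegree hS (n + Q.natDegree + 1)
    have hdvd : ¬ P ∣ Q := fun h => absurd (natDegree_le_of_dvd h hQm.ne_zero) (by omega)
    refine ⟨P, by omega, hm, hirr, hdvd, by omega, fun h => hne ?_⟩
    have hnorm : ‖χ P * ξ P * eTheta θ P‖ = 1 := by
      rw [norm_mul, norm_mul, hχ.1.norm_eq_one hQm (hirr.coprime_iff_not_dvd.2 hdvd),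
        hν.norm_eq_one hm, norm_eTheta, mul_one, mul_one]
    have hone : χ P * ξ P * eTheta θ P * conj (χ P * ξ P * eTheta θ P) = 1 := by
      rw [Complex.mul_conj', hnorm]
      norm_num
    have h' : f P * conj (χ P * ξ P * eTheta θ P) = 1 := by
      rw [← h]
      simp only [map_mul]
      ring
    exact mul_right_cancel₀ (right_ne_zero_of_mul_eq_one hone) (h'.trans hone.symm)
  obtain ⟨P₁, -, hm₁, hi₁, hQ₁, hd₁, hβ₁⟩ := hexists 0
  obtain ⟨P₂, hlt, hm₂, hi₂, hQ₂, hd₂, hβ₂⟩ := hexists P₁.natDegree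
  have hne : P₁ ≠ P₂ := fun h => absurd hlt (by rw [h]; exact lt_irrefl _)
  refine shortSumDisc_eq_top fun K H₀ => ?_
  obtain ⟨H, hH, N₀, hN⟩ := ht.exists_le_norm_sum hi₁ hi₂ hm₁ hm₂ hne hQ₁ hQ₂ hd₁ hd₂ hβ₁ hβ₂ K H₀
  refine ⟨H, hH, max N₀ (H + ν), fun N hNN => ?_⟩
  obtain ⟨G₀, hG₀, hd, hK⟩ := hN N ((le_max_left _ _).trans hNN)
  refine ⟨G₀, hG₀, hd, ?_⟩
  rw [norm_shortIntervalSum_eq hν θ hG₀ (by rw [hd]; exact (le_max_right _ _).trans hNN)]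
  exact hK

end FFEDP

end
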